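/- arXiv:2101.00064 — 3 statements merged into one kernel-verified Lean document; each statement's English description precedes it below -/
import Mathlib

section
/- Let W = (W(t))_{t∈[0,1]} be a standard Brownian motion and S(W) = sup_{0≤t≤1} W(t). There exists a constant c₁ > 0 such that for every n ∈ ℕ, the algorithm A_n^eq(W) = max_{k=1,...,n} W(k/n) satisfies E(|S(W) − A_n^eq(W)|) ≤ c₁ · n^{−1/2}. -/
open MeasureTheory ProbabilityTheory Filter

noncomputable section

/-- A standard Brownian motion on `[0,1]`: a centered Gaussian process with continuous
paths, `W 0 = 0`, and covariance `E(W s · W t) = min s t`. -/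
def IsBrownianMotion {Ω : Type*} [MeasurableSpace Ω] (P : Measure Ω)
    (W : ℝ → Ω → ℝ) : Prop :=
  (∀ t : ℝ, Measurable (W t)) ∧
  (∀ ω, W 0 ω = 0) ∧
  (∀ ω, ContinuousOn (fun t => W t ω) (Set.Icc 0 1)) ∧
  (∀ (n : ℕ) (c t : Fin n → ℝ), (∀ i, t i ∈ Set.Icc (0 : ℝ) 1) →
    ∃ v : NNReal, Measure.map (fun ω => ∑ i, c i * W (t i) ω) P = gaussianReal 0 v) ∧
  (∀ s t : ℝ, s ∈ Set.Icc (0 : ℝ) 1 → t ∈ Set.Icc (0 : ℝ) 1 →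
    ∫ ω, W s ω * W t ω ∂P = min s t)

/-- The supremum `S(W) = sup_{0 ≤ t ≤ 1} W t ω` of a path. -/
def supBM {Ω : Type*} (W : ℝ → Ω → ℝ) (ω : Ω) : ℝ :=
  sSup {x : ℝ | ∃ t ∈ Set.Icc (0 : ℝ) 1, x = W t ω}


/-- A linear space of random variables is centered Gaussian if each of its members is a
measurable function with a centered normal distribution. -/
def IsCenteredGaussianSpace {Ω : Type*} [MeasurableSpace Ω] (P : Measure Ω)
    (H : Submodule ℝ (Ω → ℝ)) : Prop :=
  ∀ Y ∈ H, Measurable Y ∧ ∃ v : NNReal, P.map Y = gaussianReal 0 v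

namespace IsCenteredGaussianSpace

variable {Ω : Type*} [MeasurableSpace Ω] {P : Measure Ω} {H : Submodule ℝ (Ω → ℝ)}

lemma memLp (hH : IsCenteredGaussianSpace P H) {Y : Ω → ℝ} (hY : Y ∈ H) : MemLp Y 2 P := by
  obtain ⟨hm, v, hv⟩ := hH Y hY
  have h := memLp_id_gaussianReal (μ := 0) (v := v) 2
  rw [← hv, memLp_map_measure_iff (by fun_prop) hm.aemeasurable] at h
  exact h

lemma integrable_mul (hH : IsCenteredGaussianSpace P H) {Y Z : Ω → ℝ} (hY : Y ∈ H) (hZ : Z ∈ H) :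
    Integrable (fun ω => Y ω * Z ω) P :=
  (hH.memLp hY).integrable_mul (hH.memLp hZ)

lemma map_eq_gaussianReal (hH : IsCenteredGaussianSpace P H) {Y : Ω → ℝ} (hY : Y ∈ H) :
    P.map Y = gaussianReal 0 (∫ ω, Y ω * Y ω ∂P).toNNReal := by
  obtain ⟨hm, v, hv⟩ := hH Y hY
  have h : ∫ ω, Y ω * Y ω ∂P = v := by
    have h1 := variance_fun_id_gaussianReal (μ := 0) (v := v)
    rw [variance_of_integral_eq_zero (by fun_prop) integral_id_gaussianReal, ← hv,
      integral_map hm.aemeasurable (by fun_prop)] at h1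
    simpa only [pow_two] using h1
  rw [h, Real.toNNReal_coe, hv]

lemma integral_sq_sum (hH : IsCenteredGaussianSpace P H) {ι : Type*} [Fintype ι]
    {X : ι → Ω → ℝ} (hX : ∀ i, X i ∈ H) (c : ι → ℝ) :
    ∫ ω, (∑ i, c i • X i) ω * (∑ i, c i • X i) ω ∂P
      = ∑ i, ∑ j, c i * c j * ∫ ω, X i ω * X j ω ∂P := by
  have h (ω : Ω) : (∑ i, c i • X i) ω * (∑ i, c i • X i) ω
      = ∑ i, ∑ j, c i * c j * (X i ω * X j ω) := by
    simp only [Finset.sum_apply, Pi.smul_apply, smul_eq_mul, Finset.sum_mul_sum]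
    exact Finset.sum_congr rfl fun i _ => Finset.sum_congr rfl fun j _ => by ring
  simp_rw [h]
  rw [integral_finsetSum _ fun i _ => integrable_finsetSum _ fun j _ =>
    (hH.integrable_mul (hX i) (hX j)).const_mul _]
  refine Finset.sum_congr rfl fun i _ => ?_
  rw [integral_finsetSum _ fun j _ => (hH.integrable_mul (hX i) (hX j)).const_mul _]
  exact Finset.sum_congr rfl fun j _ => integral_const_mul _ _

lemma integral_mul_sub_sub (hH : IsCenteredGaussianSpace P H) {A B C D : Ω → ℝ}
    (hA : A ∈ H) (hB : B ∈ H) (hC : C ∈ H) (hD : D ∈ H) :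
    ∫ ω, (A - B) ω * (C - D) ω ∂P = ∫ ω, A ω * C ω ∂P - ∫ ω, A ω * D ω ∂P
      - ∫ ω, B ω * C ω ∂P + ∫ ω, B ω * D ω ∂P := by
  have hAC := hH.integrable_mul hA hC
  have hAD := hH.integrable_mul hA hD
  have hBC := hH.integrable_mul hB hC
  have hBD := hH.integrable_mul hB hD
  rw [← integral_sub hAC hAD, ← integral_sub (by exact hAC.sub hAD) hBC,
    ← integral_add (by exact (hAC.sub hAD).sub hBC) hBD]
  congr with ω
  simp only [Pi.sub_apply]
  ring

lemma integral_mul_sub (hH : IsCenteredGaussianSpace P H) {A C D : Ω → ℝ}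
    (hA : A ∈ H) (hC : C ∈ H) (hD : D ∈ H) :
    ∫ ω, A ω * (C - D) ω ∂P = ∫ ω, A ω * C ω ∂P - ∫ ω, A ω * D ω ∂P := by
  simpa using hH.integral_mul_sub_sub hA H.zero_mem hC hD

/-- The joint law of finitely many members of a centered Gaussian space is determined by their
covariances. -/
lemma identDistrib [IsProbabilityMeasure P] (hH : IsCenteredGaussianSpace P H)
    {ι : Type*} [Fintype ι] {X Y : ι → Ω → ℝ} (hX : ∀ i, X i ∈ H) (hY : ∀ i, Y i ∈ H)
    (hXY : ∀ i j, ∫ ω, X i ω * X j ω ∂P = ∫ ω, Y i ω * Y j ω ∂P) :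
    IdentDistrib (fun ω i => X i ω) (fun ω i => Y i ω) P P := by
  classical
  have hXm : Measurable (fun ω i => X i ω) := measurable_pi_lambda _ fun i => (hH _ (hX i)).1
  have hYm : Measurable (fun ω i => Y i ω) := measurable_pi_lambda _ fun i => (hH _ (hY i)).1
  refine ⟨hXm.aemeasurable, hYm.aemeasurable, ?_⟩
  have := Measure.isProbabilityMeasure_map (μ := P) hXm.aemeasurable
  have := Measure.isProbabilityMeasure_map (μ := P) hYm.aemeasurable
  refine Measure.ext_of_charFunDual ?_
  ext L
  have hL (Z : ι → Ω → ℝ) :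
      (L ∘ fun ω i => Z i ω) = ∑ i, L (Pi.single i 1) • Z i := by
    ext ω
    simp only [Function.comp_apply, Finset.sum_apply, Pi.smul_apply, smul_eq_mul]
    conv_lhs => rw [pi_eq_sum_univ' (fun i => Z i ω), map_sum]
    refine Finset.sum_congr rfl fun i _ => ?_
    rw [map_smul, smul_eq_mul, mul_comm]
  rw [charFunDual_eq_charFun_map_one, charFunDual_eq_charFun_map_one,
    Measure.map_map (by fun_prop) hXm, Measure.map_map (by fun_prop) hYm, hL, hL,
    hH.map_eq_gaussianReal (H.sum_mem fun i _ => H.smul_mem _ (hX i)),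
    hH.map_eq_gaussianReal (H.sum_mem fun i _ => H.smul_mem _ (hY i)),
    hH.integral_sq_sum hX, hH.integral_sq_sum hY]
  simp_rw [hXY]

/-- The mean of a positively homogeneous function of a centered Gaussian variable scales with the
standard deviation. -/
lemma integral_comp_eq_sqrt_mul (hH : IsCenteredGaussianSpace P H) {Y : Ω → ℝ} (hY : Y ∈ H)
    {f : ℝ → ℝ} (hf : Measurable f) (hhom : ∀ a, 0 ≤ a → ∀ x, f (a * x) = a * f x) :
    ∫ ω, f (Y ω) ∂P = √(∫ ω, Y ω * Y ω ∂P) * ∫ x, f x ∂(gaussianReal 0 1) := by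
  have h0 : 0 ≤ ∫ ω, Y ω * Y ω ∂P := integral_nonneg fun ω => mul_self_nonneg _
  have h : P.map Y = (gaussianReal 0 1).map (√(∫ ω, Y ω * Y ω ∂P) * ·) := by
    rw [hH.map_eq_gaussianReal hY, gaussianReal_map_const_mul, mul_zero]
    congr 1
    ext
    simp [Real.sq_sqrt h0, h0]
  rw [← integral_map (hH Y hY).1.aemeasurable hf.aestronglyMeasurable, h,
    integral_map (by fun_prop) hf.aestronglyMeasurable, ← integral_const_mul]
  simp_rw [hhom _ (Real.sqrt_nonneg _)]

end IsCenteredGaussianSpace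

lemma partialSups_congr {α : Type*} [SemilatticeSup α] {f g : ℕ → α} {n : ℕ}
    (h : ∀ k ≤ n, f k = g k) : partialSups f n = partialSups g n := by
  rw [partialSups_apply, partialSups_apply]
  exact Finset.sup'_congr _ rfl fun k hk => h k (Finset.mem_Iic.1 hk)

lemma measurable_partialSups {α : Type*} [MeasurableSpace α] {f : ℕ → α → ℝ} {n : ℕ}
    (hf : ∀ k ≤ n, Measurable (f k)) : Measurable fun a => partialSups (fun k => f k a) n := by
  induction n with
  | zero => simpa using hf 0 le_rfl
  | succ n ih =>
    simp_rw [partialSups_add_one]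
    exact (ih fun k hk => hf k (by omega)).max (hf _ le_rfl)

lemma integrable_partialSups {α : Type*} [MeasurableSpace α] {μ : Measure α} {f : ℕ → α → ℝ}
    {n : ℕ} (hf : ∀ k ≤ n, Integrable (f k) μ) :
    Integrable (fun a => partialSups (fun k => f k a) n) μ := by
  induction n with
  | zero => simpa using hf 0 le_rfl
  | succ n ih =>
    simp_rw [partialSups_add_one]
    exact (ih fun k hk => hf k (by omega)).sup (hf _ le_rfl)

/-- The decomposition of a running maximum by the sign of the last value. -/
lemma partialSups_add_one_sub (s : ℕ → ℝ) (h0 : s 0 = 0) (n : ℕ) :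
    partialSups s (n + 1) - partialSups s n
      = (if 0 < s (n + 1) then s 1 else 0)
        + (if 0 < s (n + 1) then partialSups (fun k => s (k + 1) - s 1) n else 0)
        - (if 0 < s (n + 1) then partialSups s n else 0) := by
  split_ifs with h
  · have h1 := partialSups_add_one' s n
    have h2 : s ∘ (· + 1) = fun k => s 1 + (s (k + 1) - s 1) := by ext k; simp
    have h3 : s (n + 1) ≤ partialSups (s ∘ (· + 1)) n := le_partialSups (s ∘ (· + 1)) n
    rw [bot_eq_zero, h0, sup_eq_right.2 (h.le.trans h3), h2, partialSups_const_add] at h1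
    linarith
  · have h1 : 0 ≤ partialSups s n := h0 ▸ le_partialSups_of_le s (Nat.zero_le n)
    rw [partialSups_add_one, sup_eq_left.2 (by linarith)]
    ring

namespace IsCenteredGaussianSpace

variable {Ω : Type*} [MeasurableSpace Ω] {P : Measure Ω} [IsProbabilityMeasure P]
  {H : Submodule ℝ (Ω → ℝ)}

lemma integrable (hH : IsCenteredGaussianSpace P H) {Y : Ω → ℝ} (hY : Y ∈ H) : Integrable Y P :=
  (hH.memLp hY).integrable one_le_two

section Walk

variable {s : ℕ → Ω → ℝ} {n : ℕ} {v : ℝ}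

/-- Removing the first step of a Gaussian random walk does not change the joint law of the walk
of length `n` and the endpoint of the walk of length `n + 1`. -/
lemma integral_ite_partialSups_shift (hH : IsCenteredGaussianSpace P H)
    (hs : ∀ k ≤ n + 1, s k ∈ H)
    (hcov : ∀ j ≤ n + 1, ∀ k ≤ n + 1, ∫ ω, s j ω * s k ω ∂P = min (j : ℝ) k * v) :
    ∫ ω, (if 0 < s (n + 1) ω then partialSups (fun k => s (k + 1) ω - s 1 ω) n else 0) ∂P
      = ∫ ω, (if 0 < s (n + 1) ω then partialSups (fun k => s k ω) n else 0) ∂P := by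
  let Y : Fin (n + 2) → Ω → ℝ := fun i => if (i : ℕ) ≤ n then s (i + 1) - s 1 else s (n + 1)
  let F : (Fin (n + 2) → ℝ) → ℝ := fun x =>
    if 0 < x (Fin.last _) then partialSups (fun k => x (Fin.ofNat (n + 2) k)) n else 0
  have hF : Measurable F :=
    Measurable.ite (measurableSet_lt measurable_const (measurable_pi_apply _))
      (measurable_partialSups fun k _ => measurable_pi_apply _) measurable_const
  have h1 := hs 1 (by omega)
  have hY (i) : Y i ∈ H := by
    simp only [Y]
    split_ifs with hi
    · exact H.sub_mem (hs _ (by omega)) h1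
    · exact hs _ le_rfl
  have hX (i : Fin (n + 2)) : s i ∈ H := hs _ (by omega)
  have hlaw := hH.identDistrib (X := fun i : Fin (n + 2) => s i) (Y := Y) hX hY (by
    intro i j
    have hi' : ¬ (i : ℕ) ≤ n → (i : ℕ) = n + 1 := by omega
    have hj' : ¬ (j : ℕ) ≤ n → (j : ℕ) = n + 1 := by omega
    simp only [Y]
    split_ifs with hi hj hj
    · rw [hH.integral_mul_sub_sub (hs _ (by omega)) h1 (hs _ (by omega)) h1,
        hcov _ (by omega) _ (by omega), hcov _ (by omega) _ (by omega),
        hcov _ (by omega) _ (by omega), hcov _ (by omega) _ (by omega),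
        hcov _ (by omega) _ (by omega)]
      push_cast
      simp [min_add_add_right]
      ring
    · have : (i : ℝ) ≤ n := by exact_mod_cast hi
      simp_rw [mul_comm _ (s (n + 1) _)]
      rw [hH.integral_mul_sub (hs _ le_rfl) (hs _ (by omega)) h1,
        hcov _ (by omega) _ (by omega), hcov _ (by omega) _ (by omega),
        hcov _ (by omega) _ (by omega), hj' hj]
      push_cast
      rw [min_eq_left (by linarith), min_eq_right (by linarith), min_eq_right (by simp)]
      ring
    · have : (j : ℝ) ≤ n := by exact_mod_cast hj
      rw [hH.integral_mul_sub (hs _ le_rfl) (hs _ (by omega)) h1,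
        hcov _ (by omega) _ (by omega), hcov _ (by omega) _ (by omega),
        hcov _ (by omega) _ (by omega), hi' hi]
      push_cast
      rw [min_eq_right (by linarith), min_eq_right (by linarith), min_eq_right (by simp)]
      ring
    · rw [hi' hi, hj' hj])
  have key := (hlaw.comp hF).integral_eq
  have hmod {k : ℕ} (hk : k ≤ n) : ((Fin.ofNat (n + 2) k : Fin (n + 2)) : ℕ) = k :=
    Nat.mod_eq_of_lt (by omega)
  convert key.symm using 2
  · ext ω
    have hlast : Y (Fin.last _) = s (n + 1) := if_neg (by simp)
    simp only [F, Function.comp_apply, hlast]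
    congr 1
    refine partialSups_congr fun k hk => ?_
    simp only [Y, hmod hk, if_pos hk]
    rfl
  · ext ω
    simp only [F, Function.comp_apply, Fin.val_last]
    congr 1
    exact partialSups_congr fun k hk => by rw [hmod hk]

/-- Each step of a Gaussian random walk contributes equally to the mean of the positive part of
its endpoint. -/
lemma integral_ite_first (hH : IsCenteredGaussianSpace P H)
    (hs : ∀ k ≤ n + 1, s k ∈ H)
    (hcov : ∀ j ≤ n + 1, ∀ k ≤ n + 1, ∫ ω, s j ω * s k ω ∂P = min (j : ℝ) k * v) :
    ∫ ω, (if 0 < s (n + 1) ω then s 1 ω else 0) ∂P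
      = (∫ ω, max (s (n + 1) ω) 0 ∂P) / (n + 1) := by
  have h1 := hs 1 (by omega)
  have hn := hs (n + 1) le_rfl
  have hc := H.smul_mem (2 / (n + 1) : ℝ) hn
  have hn0 : (n + 1 : ℝ) ≠ 0 := by positivity
  let F : (Fin 2 → ℝ) → ℝ := fun x => if 0 < x 1 then x 0 else 0
  have hF : Measurable F :=
    Measurable.ite (measurableSet_lt measurable_const (measurable_pi_apply _))
      (measurable_pi_apply _) measurable_const
  have hmin : min (1 : ℝ) (n + 1) = 1 := min_eq_left (by simp)
  have hlaw := hH.identDistrib (X := ![s 1, s (n + 1)])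
    (Y := ![(2 / (n + 1) : ℝ) • s (n + 1) - s 1, s (n + 1)])
    (by simp [Fin.forall_fin_two, h1, hn])
    (by simp only [Fin.forall_fin_two]; exact ⟨H.sub_mem hc h1, hn⟩) (by
    have e (A : Ω → ℝ) (ω) : ((2 / (n + 1) : ℝ) • A) ω = (2 / (n + 1) : ℝ) * A ω := rfl
    have c11 := hcov 1 (by omega) 1 (by omega)
    have c1n := hcov 1 (by omega) (n + 1) (by omega)
    have cn1 := hcov (n + 1) (by omega) 1 (by omega)
    have cnn := hcov (n + 1) (by omega) (n + 1) (by omega)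
    push_cast at c11 c1n cn1 cnn
    rw [min_self] at c11 cnn
    rw [hmin] at c1n
    rw [min_comm, hmin] at cn1
    have h00 := hH.integral_mul_sub_sub hc h1 hc h1
    have h10 := hH.integral_mul_sub hn hc h1
    have h01 : ∫ ω, ((2 / (n + 1) : ℝ) • s (n + 1) - s 1) ω * s (n + 1) ω ∂P
        = ∫ ω, s (n + 1) ω * ((2 / (n + 1) : ℝ) • s (n + 1) - s 1) ω ∂P := by
      simp_rw [mul_comm]
    have m1 (A B : Ω → ℝ) (c : ℝ) : ∫ ω, A ω * (c * B ω) ∂P = c * ∫ ω, A ω * B ω ∂P := by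
      rw [← integral_const_mul]; congr with ω; ring
    have m2 (A B : Ω → ℝ) (c : ℝ) : ∫ ω, (c * A ω) * B ω ∂P = c * ∫ ω, A ω * B ω ∂P := by
      rw [← integral_const_mul]; congr with ω; ring
    simp only [e, m1, m2] at h00 h10
    simp only [Fin.forall_fin_two, Matrix.cons_val_zero, Matrix.cons_val_one]
    rw [h01, h00, h10, c11, c1n, cn1, cnn]
    refine ⟨⟨?_, ?_⟩, ?_, trivial⟩ <;> field_simp <;> ring)
  have key := (hlaw.comp hF).integral_eq
  have hset : MeasurableSet {ω | 0 < s (n + 1) ω} :=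
    measurableSet_lt measurable_const (hH _ hn).1
  have hint : Integrable (fun ω => if 0 < s (n + 1) ω then s 1 ω else 0) P :=
    (hH.integrable h1).indicator hset
  have e (ω : Ω) : (F ∘ fun ω i => ![(2 / (n + 1) : ℝ) • s (n + 1) - s 1, s (n + 1)] i ω) ω
      = 2 / (n + 1) * max (s (n + 1) ω) 0 - (if 0 < s (n + 1) ω then s 1 ω else 0) := by
    change (if 0 < s (n + 1) ω then 2 / (n + 1) * s (n + 1) ω - s 1 ω else 0) = _
    split_ifs with h
    · rw [max_eq_left h.le]
    · rw [max_eq_right (not_lt.1 h)]; simp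
  simp_rw [e] at key
  rw [integral_sub ((hH.integrable hn).pos_part.const_mul _) hint, integral_const_mul] at key
  change ∫ ω, (if 0 < s (n + 1) ω then s 1 ω else 0) ∂P = _ at key
  field_simp at key ⊢
  linarith

/-- The recursive form of Spitzer's identity for the mean of the maximum of a Gaussian walk. -/
lemma integral_partialSups_add_one (hH : IsCenteredGaussianSpace P H) (h0 : ∀ ω, s 0 ω = 0)
    (hs : ∀ k ≤ n + 1, s k ∈ H)
    (hcov : ∀ j ≤ n + 1, ∀ k ≤ n + 1, ∫ ω, s j ω * s k ω ∂P = min (j : ℝ) k * v) :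
    ∫ ω, partialSups (fun k => s k ω) (n + 1) ∂P
      = ∫ ω, partialSups (fun k => s k ω) n ∂P + (∫ ω, max (s (n + 1) ω) 0 ∂P) / (n + 1) := by
  have h1 := hs 1 (by omega)
  have hset : MeasurableSet {ω | 0 < s (n + 1) ω} :=
    measurableSet_lt measurable_const (hH _ (hs _ le_rfl)).1
  have i0 : Integrable (fun ω => partialSups (fun k => s k ω) n) P :=
    integrable_partialSups fun k hk => hH.integrable (hs k (by omega))
  have i1 : Integrable (fun ω => partialSups (fun k => s k ω) (n + 1)) P :=
    integrable_partialSups fun k hk => hH.integrable (hs k hk)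
  have i2 : Integrable (fun ω => if 0 < s (n + 1) ω then s 1 ω else 0) P :=
    (hH.integrable h1).indicator hset
  have i3 : Integrable (fun ω => if 0 < s (n + 1) ω then
      partialSups (fun k => s (k + 1) ω - s 1 ω) n else 0) P :=
    (integrable_partialSups fun k hk =>
      (hH.integrable (hs _ (by omega))).sub (hH.integrable h1)).indicator hset
  have i4 : Integrable (fun ω => if 0 < s (n + 1) ω then
      partialSups (fun k => s k ω) n else 0) P := i0.indicator hset
  have h := integral_sub i1 i0
  simp_rw [fun ω => partialSups_add_one_sub (fun k => s k ω) (h0 ω) n] at h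
  rw [integral_sub (by exact i2.add i3) i4, integral_add i2 i3,
    hH.integral_ite_partialSups_shift hs hcov, hH.integral_ite_first hs hcov] at h
  linarith

/-- The mean of the maximum of a Gaussian random walk. -/
lemma integral_partialSups_eq (hH : IsCenteredGaussianSpace P H) (h0 : ∀ ω, s 0 ω = 0)
    (hs : ∀ k ≤ n, s k ∈ H)
    (hcov : ∀ j ≤ n, ∀ k ≤ n, ∫ ω, s j ω * s k ω ∂P = min (j : ℝ) k * v) :
    ∫ ω, partialSups (fun k => s k ω) n ∂P
      = (√v * ∫ x, max x 0 ∂(gaussianReal 0 1)) * ∑ k ∈ Finset.range n, (√(k + 1))⁻¹ := by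
  induction n with
  | zero => simp [h0]
  | succ n ih =>
    rw [hH.integral_partialSups_add_one h0 hs hcov,
      ih (fun k hk => hs k (by omega)) (fun j hj k hk => hcov j (by omega) k (by omega)),
      hH.integral_comp_eq_sqrt_mul (f := fun x => max x 0) (hs _ le_rfl) (by fun_prop)
        (fun a ha x => by rw [mul_max_of_nonneg _ _ ha, mul_zero]),
      hcov _ le_rfl _ le_rfl, Finset.sum_range_succ, min_self]
    push_cast
    have hn : (0 : ℝ) ≤ n + 1 := by positivity
    have hn' : (n + 1 : ℝ) ≠ 0 := by positivity
    rw [Real.sqrt_mul hn, mul_add, add_right_inj]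
    have h2 : (√(n + 1 : ℝ))⁻¹ = √(n + 1 : ℝ) / (n + 1) := by
      rw [Real.sqrt_div_self', one_div]
    rw [h2]
    ring

end Walk

end IsCenteredGaussianSpace

lemma sum_inv_sqrt_le (n : ℕ) : ∑ k ∈ Finset.range n, (√(k + 1 : ℝ))⁻¹ ≤ 2 * √n := by
  induction n with
  | zero => simp
  | succ n ih =>
    rw [Finset.sum_range_succ]
    push_cast
    have ha : √(n : ℝ) ^ 2 = n := Real.sq_sqrt (by positivity)
    have hb : √(n + 1 : ℝ) ^ 2 = n + 1 := Real.sq_sqrt (by positivity)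
    have hb0 : 0 < √(n + 1 : ℝ) := by positivity
    have : (√(n + 1 : ℝ))⁻¹ ≤ 2 * √(n + 1 : ℝ) - 2 * √(n : ℝ) := by
      rw [inv_le_iff_one_le_mul₀ hb0]
      nlinarith [sq_nonneg (√(n + 1 : ℝ) - √(n : ℝ))]
    linarith

lemma le_sum_inv_sqrt (n : ℕ) :
    2 * √n - 2 ≤ ∑ k ∈ Finset.range n, (√(k + 1 : ℝ))⁻¹ := by
  have h : 2 * √(n + 1 : ℝ) - 2 ≤ ∑ k ∈ Finset.range n, (√(k + 1 : ℝ))⁻¹ := by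
    induction n with
    | zero => simp
    | succ n ih =>
      rw [Finset.sum_range_succ]
      push_cast
      have ha : √(n + 1 : ℝ) ^ 2 = n + 1 := Real.sq_sqrt (by positivity)
      have hb : √(n + 1 + 1 : ℝ) ^ 2 = n + 1 + 1 := Real.sq_sqrt (by positivity)
      have ha0 : 0 < √(n + 1 : ℝ) := by positivity
      have : 2 * √(n + 1 + 1 : ℝ) - 2 * √(n + 1 : ℝ) ≤ (√(n + 1 : ℝ))⁻¹ := by
        rw [← one_div, le_div_iff₀ ha0]
        nlinarith [sq_nonneg (√(n + 1 + 1 : ℝ) - √(n + 1 : ℝ))]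
      linarith
  have : √(n : ℝ) ≤ √(n + 1 : ℝ) := Real.sqrt_le_sqrt (by linarith)
  linarith

lemma IsBrownianMotion.isCenteredGaussianSpace {Ω : Type*} [MeasurableSpace Ω] {P : Measure Ω}
    {W : ℝ → Ω → ℝ} (hW : IsBrownianMotion P W) :
    IsCenteredGaussianSpace P (Submodule.span ℝ (W '' Set.Icc 0 1)) := by
  obtain ⟨hm, -, -, hg, -⟩ := hW
  intro Y hY
  obtain ⟨n, c, g, rfl⟩ := Submodule.mem_span_set'.1 hY
  choose t ht hgt using fun i => (g i).2
  have h : ∑ i, c i • (g i : Ω → ℝ) = fun ω => ∑ i, c i * W (t i) ω := by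
    ext ω
    simp [← hgt]
  rw [h]
  exact ⟨Finset.measurable_sum _ fun i _ => (hm _).const_mul _, hg n c t ht⟩

/-- The maximum of a path over the grid `0, 1 / N, …, N / N`. -/
def gridMax {Ω : Type*} (W : ℝ → Ω → ℝ) (N : ℕ) (ω : Ω) : ℝ :=
  partialSups (fun k : ℕ => W ((k : ℝ) / N) ω) N

lemma natCast_div_mem_Icc {k N : ℕ} (h : k ≤ N) : (k : ℝ) / N ∈ Set.Icc (0 : ℝ) 1 :=
  ⟨by positivity, div_le_one_of_le₀ (by exact_mod_cast h) (by positivity)⟩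

section Path

variable {Ω : Type*} {W : ℝ → Ω → ℝ} {ω : Ω}

lemma gridMax_le_gridMax_mul {n j : ℕ} (hj : 0 < j) : gridMax W n ω ≤ gridMax W (n * j) ω := by
  refine partialSups_le _ _ _ fun k hk => ?_
  have h : (k : ℝ) / n = ((k * j : ℕ) : ℝ) / (n * j : ℕ) := by
    push_cast
    rw [mul_div_mul_right _ _ (by positivity)]
  rw [h]
  exact le_partialSups_of_le (fun i : ℕ => W ((i : ℝ) / (n * j : ℕ)) ω) (Nat.mul_le_mul_right j hk)

lemma exists_isGreatest_path (hc : ContinuousOn (fun t => W t ω) (Set.Icc 0 1)) :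
    ∃ t ∈ Set.Icc (0 : ℝ) 1, supBM W ω = W t ω ∧ ∀ u ∈ Set.Icc (0 : ℝ) 1, W u ω ≤ W t ω := by
  obtain ⟨t, ht, hmax⟩ := isCompact_Icc.exists_isMaxOn ⟨0, by simp⟩ hc
  refine ⟨t, ht, IsGreatest.csSup_eq ⟨⟨t, ht, rfl⟩, ?_⟩, fun u hu => hmax hu⟩
  rintro _ ⟨u, hu, rfl⟩
  exact hmax hu

lemma le_supBM (hc : ContinuousOn (fun t => W t ω) (Set.Icc 0 1)) {u : ℝ}
    (hu : u ∈ Set.Icc (0 : ℝ) 1) : W u ω ≤ supBM W ω := by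
  obtain ⟨t, -, h, hmax⟩ := exists_isGreatest_path hc
  exact h ▸ hmax u hu

lemma gridMax_le_supBM (hc : ContinuousOn (fun t => W t ω) (Set.Icc 0 1)) (N : ℕ) :
    gridMax W N ω ≤ supBM W ω :=
  partialSups_le _ _ _ fun _ hk => le_supBM hc (natCast_div_mem_Icc hk)

lemma tendsto_gridMax (hc : ContinuousOn (fun t => W t ω) (Set.Icc 0 1)) :
    Tendsto (fun N => gridMax W N ω) atTop (nhds (supBM W ω)) := by
  obtain ⟨t, ht, h, -⟩ := exists_isGreatest_path hc
  have hfloor (N : ℕ) : ⌊t * N⌋₊ ≤ N := by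
    refine Nat.floor_le_of_le ?_
    exact mul_le_of_le_one_left (by positivity) ht.2
  have hlim : Tendsto (fun N : ℕ => W ((⌊t * N⌋₊ : ℝ) / N) ω) atTop (nhds (supBM W ω)) := by
    rw [h]
    refine (hc t ht).tendsto.comp (tendsto_nhdsWithin_iff.2
      ⟨(tendsto_nat_floor_mul_div_atTop ht.1).comp tendsto_natCast_atTop_atTop, ?_⟩)
    exact Eventually.of_forall fun N => natCast_div_mem_Icc (hfloor N)
  exact tendsto_of_tendsto_of_tendsto_of_le_of_le hlim tendsto_const_nhds
    (fun N => le_partialSups_of_le (fun k : ℕ => W ((k : ℝ) / N) ω) (hfloor N))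
    fun N => gridMax_le_supBM hc N

/-- Omitting the starting point from the grid costs at most the modulus of the first value. -/
lemma abs_supBM_sub_le (h0 : W 0 ω = 0) (hc : ContinuousOn (fun t => W t ω) (Set.Icc 0 1))
    {n : ℕ} (hn : 0 < n) :
    |supBM W ω - sSup {x : ℝ | ∃ k : ℕ, 1 ≤ k ∧ k ≤ n ∧ x = W ((k : ℝ) / n) ω}|
      ≤ (supBM W ω - gridMax W n ω) + |W (1 / n) ω| := by
  set A := {x : ℝ | ∃ k : ℕ, 1 ≤ k ∧ k ≤ n ∧ x = W ((k : ℝ) / n) ω}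
  have hA : ∀ x ∈ A, x ≤ supBM W ω := by
    rintro _ ⟨k, -, hk, rfl⟩
    exact le_supBM hc (natCast_div_mem_Icc hk)
  have hmem : W (1 / n) ω ∈ A := ⟨1, le_rfl, hn, by simp⟩
  have hbdd : BddAbove A := ⟨_, hA⟩
  have hle : sSup A ≤ supBM W ω := csSup_le ⟨_, hmem⟩ hA
  have hfirst := le_csSup hbdd hmem
  have hgrid : gridMax W n ω ≤ sSup A + |W (1 / n) ω| := by
    refine partialSups_le _ _ _ fun k hk => ?_
    rcases Nat.eq_zero_or_pos k with rfl | hk0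
    · simp only [Nat.cast_zero, zero_div, h0]
      linarith [neg_abs_le (W (1 / n) ω)]
    · have : W ((k : ℝ) / n) ω ≤ sSup A := le_csSup hbdd ⟨k, hk0, hk, rfl⟩
      linarith [abs_nonneg (W (1 / n) ω)]
  rw [abs_of_nonneg (by linarith)]
  linarith

lemma mem_span_path {t : ℝ} (ht : t ∈ Set.Icc (0 : ℝ) 1) :
    W t ∈ Submodule.span ℝ (W '' Set.Icc 0 1) :=
  Submodule.subset_span ⟨t, ht, rfl⟩

end Path

namespace IsBrownianMotion

variable {Ω : Type*} [MeasurableSpace Ω] {P : Measure Ω} [IsProbabilityMeasure P]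
  {W : ℝ → Ω → ℝ}

lemma integrable_gridMax (hW : IsBrownianMotion P W) (N : ℕ) : Integrable (gridMax W N) P :=
  integrable_partialSups fun _ hk =>
    hW.isCenteredGaussianSpace.integrable (mem_span_path (natCast_div_mem_Icc hk))

lemma integral_gridMax (hW : IsBrownianMotion P W) (N : ℕ) :
    ∫ ω, gridMax W N ω ∂P = ((√N)⁻¹ * ∫ x, max x 0 ∂(gaussianReal 0 1))
      * ∑ k ∈ Finset.range N, (√(k + 1 : ℝ))⁻¹ := by
  rw [← Real.sqrt_inv]
  refine hW.isCenteredGaussianSpace.integral_partialSups_eq (s := fun k : ℕ => W ((k : ℝ) / N))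
    (fun ω => by simp [hW.2.1]) (fun k hk => mem_span_path (natCast_div_mem_Icc hk))
    fun j hj k hk => ?_
  rw [hW.2.2.2.2 _ _ (natCast_div_mem_Icc hj) (natCast_div_mem_Icc hk), div_eq_mul_inv,
    div_eq_mul_inv, min_mul_of_nonneg _ _ (by positivity)]

lemma integral_gridMax_sub_le (hW : IsBrownianMotion P W) {n N : ℕ} (hn : 0 < n) :
    ∫ ω, (gridMax W N ω - gridMax W n ω) ∂P
      ≤ 2 * (∫ x, max x 0 ∂(gaussianReal 0 1)) * (√n)⁻¹ := by
  rw [integral_sub (hW.integrable_gridMax N) (hW.integrable_gridMax n), hW.integral_gridMax,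
    hW.integral_gridMax]
  set m := ∫ x, max x 0 ∂(gaussianReal 0 1)
  have hm : 0 ≤ m := integral_nonneg fun x => le_max_right x 0
  have hN : (√N)⁻¹ * ∑ k ∈ Finset.range N, (√(k + 1 : ℝ))⁻¹ ≤ 2 := by
    rw [inv_mul_eq_div]
    exact div_le_of_le_mul₀ (by positivity) (by norm_num) (sum_inv_sqrt_le N)
  have hn' : 2 - 2 * (√n)⁻¹ ≤ (√n)⁻¹ * ∑ k ∈ Finset.range n, (√(k + 1 : ℝ))⁻¹ := by
    have hs : 0 < √(n : ℝ) := by positivity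
    rw [inv_mul_eq_div, le_div_iff₀ hs]
    refine le_trans (le_of_eq ?_) (le_sum_inv_sqrt n)
    field_simp
  nlinarith

lemma lintegral_supBM_sub_gridMax_le (hW : IsBrownianMotion P W) {n : ℕ} (hn : 0 < n) :
    ∫⁻ ω, ENNReal.ofReal (supBM W ω - gridMax W n ω) ∂P
      ≤ ENNReal.ofReal (2 * (∫ x, max x 0 ∂(gaussianReal 0 1)) * (√n)⁻¹) := by
  have hmeas (N : ℕ) : Measurable (gridMax W N) := measurable_partialSups fun _ _ => hW.1 _
  have hsub : Tendsto (fun j => n * (j + 1)) atTop atTop :=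
    (tendsto_id.const_mul_atTop' hn).comp (tendsto_add_atTop_nat 1)
  have hlim (ω : Ω) : liminf (fun j : ℕ =>
      ENNReal.ofReal (gridMax W (n * (j + 1)) ω - gridMax W n ω)) atTop
      = ENNReal.ofReal (supBM W ω - gridMax W n ω) :=
    ((ENNReal.continuous_ofReal.tendsto _).comp
      (((tendsto_gridMax (hW.2.2.1 ω)).comp hsub).sub_const _)).liminf_eq
  simp_rw [← hlim]
  refine (lintegral_liminf_le fun j => ((hmeas _).sub (hmeas _)).ennreal_ofReal).trans ?_
  refine (liminf_le_liminf (v := fun _ => _) (Eventually.of_forall fun j => ?_)).trans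
    (liminf_const _).le
  rw [← ofReal_integral_eq_lintegral_ofReal
    ((hW.integrable_gridMax _).sub (hW.integrable_gridMax _))
    (Eventually.of_forall fun ω => sub_nonneg.2 (gridMax_le_gridMax_mul j.succ_pos))]
  exact ENNReal.ofReal_le_ofReal (hW.integral_gridMax_sub_le hn)

lemma lintegral_abs_first_eq (hW : IsBrownianMotion P W) {n : ℕ} (hn : 0 < n) :
    ∫⁻ ω, ENNReal.ofReal |W (1 / n) ω| ∂P
      = ENNReal.ofReal ((∫ x, |x| ∂(gaussianReal 0 1)) * (√n)⁻¹) := by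
  have hmem : (1 / n : ℝ) ∈ Set.Icc (0 : ℝ) 1 := by
    simpa using natCast_div_mem_Icc (Nat.succ_le_of_lt hn)
  have hH := hW.isCenteredGaussianSpace
  rw [← ofReal_integral_eq_lintegral_ofReal (hH.integrable (mem_span_path hmem)).abs
    (Eventually.of_forall fun ω => abs_nonneg _),
    hH.integral_comp_eq_sqrt_mul (mem_span_path hmem) measurable_abs
      (fun a ha x => by rw [abs_mul, abs_of_nonneg ha]),
    hW.2.2.2.2 _ _ hmem hmem, min_self, one_div, Real.sqrt_inv, mul_comm]

end IsBrownianMotion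

/-- Error bound for the equidistant (non-adaptive) algorithm
`A_n^eq(W) = max_{k=1,…,n} W(k/n)` approximating `S(W)`:
`E(|S(W) − A_n^eq(W)|) ≤ c₁ · n^{−1/2}`. -/
theorem stmt2 {Ω : Type*} [MeasurableSpace Ω] (P : Measure Ω) [IsProbabilityMeasure P]
    (W : ℝ → Ω → ℝ) (hW : IsBrownianMotion P W) :
    ∃ c₁ > (0 : ℝ), ∀ n : ℕ, 0 < n →
      ∫ ω, |supBM W ω - sSup {x : ℝ | ∃ k : ℕ, 1 ≤ k ∧ k ≤ n ∧ x = W ((k : ℝ) / n) ω}| ∂P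
        ≤ c₁ * (n : ℝ) ^ (-(1 / 2) : ℝ) := by
  obtain ⟨-, h0, hc, -⟩ := id hW
  set a := ∫ x, max x 0 ∂(gaussianReal 0 1)
  set b := ∫ x, |x| ∂(gaussianReal 0 1)
  have ha : 0 ≤ a := integral_nonneg fun x => le_max_right x 0
  have hb : 0 ≤ b := integral_nonneg fun x => abs_nonneg x
  refine ⟨2 * a + b + 1, by positivity, fun n hn => ?_⟩
  have hpow : (n : ℝ) ^ (-(1 / 2) : ℝ) = (√n)⁻¹ := by
    rw [Real.rpow_neg (by positivity), Real.sqrt_eq_rpow]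
  rw [hpow]
  have hs : 0 ≤ (√(n : ℝ))⁻¹ := by positivity
  have hbound : ∫⁻ ω, ENNReal.ofReal ‖|supBM W ω
      - sSup {x : ℝ | ∃ k : ℕ, 1 ≤ k ∧ k ≤ n ∧ x = W ((k : ℝ) / n) ω}|‖ ∂P
      ≤ ENNReal.ofReal (2 * a * (√n)⁻¹ + b * (√n)⁻¹) := by
    rw [ENNReal.ofReal_add (by positivity) (by positivity), ← hW.lintegral_abs_first_eq hn]
    refine le_trans ?_ (add_le_add_left (hW.lintegral_supBM_sub_gridMax_le hn) _)
    rw [← lintegral_add_right _ (hW.1 _).abs.ennreal_ofReal]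
    refine lintegral_mono fun ω => ?_
    rw [← ENNReal.ofReal_add (sub_nonneg.2 (gridMax_le_supBM (hc ω) n)) (abs_nonneg _),
      norm_abs_eq_norm, Real.norm_eq_abs]
    exact ENNReal.ofReal_le_ofReal (abs_supBM_sub_le (h0 ω) (hc ω) hn)
  refine (Real.le_norm_self _).trans ((norm_integral_le_lintegral_norm _).trans ?_)
  refine (ENNReal.toReal_mono ENNReal.ofReal_ne_top hbound).trans ?_
  rw [ENNReal.toReal_ofReal (by positivity)]
  linarith
end
end

section
/- Let W = (W(t))_{t∈[0,1]} be a standard Brownian motion and S(W) = sup_{0≤t≤1} W(t). There exists a sequence of adaptive algorithms (A_n^ad)_{n∈ℕ}, where for each n the algorithm A_n^ad is given by a point t_1 ∈ (0,1] and Borel-measurable mappings χ_k : ℝ^{k−1} → (0,1] for k = 2, ..., n, computes y_1 = W(t_1) and y_k = W(χ_k(y_1, ..., y_{k−1})) for k = 2, ..., n, and outputs A_n^ad(W) = max_{k=1,...,n} y_k, with the following property: for every ρ > 0 there exists a constant c > 0 such that for every n ∈ ℕ, E(|S(W) − A_n^ad(W)|) ≤ c · n^{−ρ}. -/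
open MeasureTheory ProbabilityTheory Filter

noncomputable section

/-- The sequence of values computed by an adaptive algorithm given by the
evaluation-site maps `χ k : ℝ^k → (0,1]` (with `χ 0` a constant giving the first
evaluation site `t₁`): `y k = W (χ k (y 0, …, y (k−1))) ω`. -/
def adaptVals {Ω : Type*} (W : ℝ → Ω → ℝ) (χ : (k : ℕ) → (Fin k → ℝ) → ℝ) (ω : Ω) :
    ℕ → ℝ
  | k => W (χ k (fun j : Fin k => adaptVals W χ ω j)) ω
  decreasing_by exact j.isLt

namespace IsBrownianMotion

variable {Ω : Type*} [MeasurableSpace Ω] {P : Measure Ω} {W : ℝ → Ω → ℝ}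

lemma isGaussianProcess (hW : IsBrownianMotion P W) :
    IsGaussianProcess (fun t : Set.Icc (0 : ℝ) 1 => W t) P where
  hasGaussianLaw I := by
    have hm : Measurable (fun ω => I.restrict (fun t : Set.Icc (0 : ℝ) 1 => W t ω)) :=
      measurable_pi_lambda _ fun t => hW.1 _
    refine ⟨isGaussian_of_map_eq_gaussianReal fun L => ?_⟩
    classical
    let e := I.equivFin.symm
    obtain ⟨v, hv⟩ := hW.2.2.2.1 I.card
      (fun i => L (Pi.single (e i) 1)) (fun i => ((e i : Set.Icc (0 : ℝ) 1) : ℝ))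
      (fun i => (e i : Set.Icc (0 : ℝ) 1).2)
    refine ⟨0, v, ?_⟩
    rw [← hv, Measure.map_map (by fun_prop) hm]
    congr 1
    ext ω
    rw [Function.comp_apply, ← Equiv.sum_comp e.symm]
    simp only [Equiv.apply_symm_apply]
    set x := I.restrict (fun t : Set.Icc (0 : ℝ) 1 => W t ω) with hx
    have : x = ∑ i, x i • (Pi.single i (1 : ℝ) : I → ℝ) := by
      ext j; simp [Finset.sum_apply, Pi.single_apply]
    conv_lhs => rw [this]
    simp [hx, mul_comm]

lemma memLp (hW : IsBrownianMotion P W) {t : ℝ} (ht : t ∈ Set.Icc (0 : ℝ) 1) :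
    MemLp (W t) 2 P :=
  (hW.isGaussianProcess.hasGaussianLaw_eval ⟨t, ht⟩).memLp_two

lemma integral_eq_zero (hW : IsBrownianMotion P W) {t : ℝ} (ht : t ∈ Set.Icc (0 : ℝ) 1) :
    ∫ ω, W t ω ∂P = 0 := by
  obtain ⟨v, hv⟩ := hW.2.2.2.1 1 (fun _ => 1) (fun _ => t) (fun _ => ht)
  simp only [Finset.univ_unique, one_mul, Finset.sum_const, Finset.card_singleton,
    one_smul] at hv
  have := integral_map (μ := P) (hW.1 t).aemeasurable (f := id) (by fun_prop)
  simp only [id] at this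
  rw [← this]
  change ∫ y, y ∂(P.map (fun ω => W t ω)) = 0
  rw [hv, integral_id_gaussianReal]

variable [IsProbabilityMeasure P]

lemma covariance (hW : IsBrownianMotion P W) {s t : ℝ} (hs : s ∈ Set.Icc (0 : ℝ) 1)
    (ht : t ∈ Set.Icc (0 : ℝ) 1) : cov[W s, W t; P] = min s t := by
  rw [covariance_eq_sub (hW.memLp hs) (hW.memLp ht), hW.integral_eq_zero hs]
  simpa using hW.2.2.2.2 s t hs ht

lemma covariance_sub_sub (hW : IsBrownianMotion P W) {a b c d : ℝ}
    (ha : a ∈ Set.Icc (0 : ℝ) 1) (hb : b ∈ Set.Icc (0 : ℝ) 1)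
    (hc : c ∈ Set.Icc (0 : ℝ) 1) (hd : d ∈ Set.Icc (0 : ℝ) 1) :
    cov[W b - W a, W d - W c; P] = min b d - min b c - (min a d - min a c) := by
  rw [covariance_sub_left (hW.memLp hb) (hW.memLp ha) ((hW.memLp hd).sub (hW.memLp hc)),
    covariance_sub_right (hW.memLp hb) (hW.memLp hd) (hW.memLp hc),
    covariance_sub_right (hW.memLp ha) (hW.memLp hd) (hW.memLp hc),
    hW.covariance hb hd, hW.covariance hb hc, hW.covariance ha hd, hW.covariance ha hc]

lemma map_sub (hW : IsBrownianMotion P W) {a b : ℝ}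
    (ha : a ∈ Set.Icc (0 : ℝ) 1) (hb : b ∈ Set.Icc (0 : ℝ) 1) :
    P.map (fun ω => W b ω - W a ω) = gaussianReal 0 |b - a|.toNNReal := by
  have h := (hW.isGaussianProcess.hasGaussianLaw_fun_sub (s := ⟨b, hb⟩)
    (t := ⟨a, ha⟩)).map_eq_gaussianReal
  rw [h, integral_sub ((hW.memLp hb).integrable (by norm_num))
    ((hW.memLp ha).integrable (by norm_num)), hW.integral_eq_zero hb, hW.integral_eq_zero ha]
  have : Var[fun ω => W b ω - W a ω; P] = |b - a| := by
    rw [← covariance_self (X := fun ω => W b ω - W a ω)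
      ((hW.1 b).sub (hW.1 a)).aemeasurable]
    refine (hW.covariance_sub_sub ha hb ha hb).trans ?_
    rcases le_total a b with h | h <;> simp [h, abs_of_nonneg, abs_of_nonpos]
  rw [this]; simp

end IsBrownianMotion

/-- The σ-algebra generated by the increments of `W` over `[s, t]`. -/
@[reducible] def incrementSigma {Ω : Type*} (W : ℝ → Ω → ℝ) (s t : ℝ) : MeasurableSpace Ω :=
  MeasurableSpace.comap
    (fun ω (p : Set.Icc s t × Set.Icc s t) => W p.2 ω - W p.1 ω) inferInstance

lemma measurable_incrementSigma {Ω : Type*} (W : ℝ → Ω → ℝ) {s t a b : ℝ}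
    (ha : a ∈ Set.Icc s t) (hb : b ∈ Set.Icc s t) :
    Measurable[incrementSigma W s t] (fun ω => W b ω - W a ω) :=
  (measurable_pi_apply ((⟨a, ha⟩, ⟨b, hb⟩) : Set.Icc s t × Set.Icc s t)).comp
    (comap_measurable (fun ω (p : Set.Icc s t × Set.Icc s t) => W p.2 ω - W p.1 ω))

namespace IsBrownianMotion

variable {Ω : Type*} [MeasurableSpace Ω] {P : Measure Ω} {W : ℝ → Ω → ℝ}

lemma incrementSigma_le (hW : IsBrownianMotion P W) (s t : ℝ) :
    incrementSigma W s t ≤ ‹MeasurableSpace Ω› :=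
  Measurable.comap_le (measurable_pi_lambda _ fun _ => (hW.1 _).sub (hW.1 _))

lemma indep_incrementSigma [IsProbabilityMeasure P] (hW : IsBrownianMotion P W)
    {s t u v : ℝ} (hs : 0 ≤ s) (htu : t ≤ u) (ht : t ≤ 1) (hu : 0 ≤ u) (hv : v ≤ 1) :
    Indep (incrementSigma W s t) (incrementSigma W u v) P := by
  refine IsGaussianProcess.indepFun_of_covariance_eq_zero
    (X := fun (p : Set.Icc s t × Set.Icc s t) ω => W p.2 ω - W p.1 ω)
    (Y := fun (p : Set.Icc u v × Set.Icc u v) ω => W p.2 ω - W p.1 ω) ?_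
    (fun p => ((hW.1 _).sub (hW.1 _)).aemeasurable)
    (fun p => ((hW.1 _).sub (hW.1 _)).aemeasurable) ?_
  · have key : ∀ a b : Set.Icc (0 : ℝ) 1, ∃ I : Finset (Set.Icc (0 : ℝ) 1),
        ∃ L : (I → ℝ) →L[ℝ] ℝ,
        ∀ ω, W b ω - W a ω = L (I.restrict (fun t : Set.Icc (0 : ℝ) 1 => W t ω)) := by
      intro a b
      classical
      refine ⟨{a, b}, ContinuousLinearMap.proj ⟨b, by simp⟩ -
        ContinuousLinearMap.proj ⟨a, by simp⟩, fun ω => by simp⟩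
    refine hW.isGaussianProcess.of_isGaussianProcess ?_
    rintro (⟨a, b⟩ | ⟨a, b⟩)
    · exact key ⟨a, hs.trans a.2.1, a.2.2.trans ht⟩ ⟨b, hs.trans b.2.1, b.2.2.trans ht⟩
    · exact key ⟨a, hu.trans a.2.1, a.2.2.trans hv⟩ ⟨b, hu.trans b.2.1, b.2.2.trans hv⟩
  · rintro ⟨⟨a, ha⟩, ⟨b, hb⟩⟩ ⟨⟨c, hc⟩, ⟨d, hd⟩⟩
    refine (hW.covariance_sub_sub ⟨hs.trans ha.1, ha.2.trans ht⟩
      ⟨hs.trans hb.1, hb.2.trans ht⟩ ⟨hu.trans hc.1, hc.2.trans hv⟩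
      ⟨hu.trans hd.1, hd.2.trans hv⟩).trans ?_
    have := ha.2; have := hb.2; have := hc.1; have := hd.1
    rw [min_eq_left (by linarith), min_eq_left (by linarith), min_eq_left (by linarith),
      min_eq_left (by linarith)]
    ring

end IsBrownianMotion

section Gaussian

open scoped NNReal

lemma gaussianReal_real_Iio_neg (v : ℝ≥0) (b : ℝ) :
    (gaussianReal 0 v).real (Set.Iio (-b)) = (gaussianReal 0 v).real (Set.Ioi b) := by
  have h := gaussianReal_map_neg (μ := 0) (v := v)
  rw [neg_zero] at h
  conv_lhs => rw [← h]
  rw [map_measureReal_apply measurable_neg measurableSet_Iio]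
  congr 1
  ext x; simp

lemma gaussianReal_real_Ioi_zero_le (v : ℝ≥0) : (gaussianReal 0 v).real (Set.Ioi 0) ≤ 1 / 2 := by
  have h := gaussianReal_real_Iio_neg v 0
  rw [neg_zero] at h
  have hd : Disjoint (Set.Iio (0 : ℝ)) (Set.Ioi 0) :=
    Set.disjoint_left.2 fun x hx hx' => lt_asymm (Set.mem_Iio.1 hx) (Set.mem_Ioi.1 hx')
  have h1 := measureReal_union (μ := gaussianReal 0 v) hd measurableSet_Ioi
  have h2 : (gaussianReal 0 v).real (Set.Iio 0 ∪ Set.Ioi 0) ≤ 1 := measureReal_le_one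
  linarith

lemma gaussianReal_real_Icc_add (v : ℝ≥0) {b : ℝ} (hb : 0 ≤ b) :
    (gaussianReal 0 v).real (Set.Icc (-b) b) + 2 * (gaussianReal 0 v).real (Set.Ioi b) = 1 := by
  have h1 : Set.Icc (-b) b = (Set.Iio (-b) ∪ Set.Ioi b)ᶜ := by
    ext x; simp [Set.mem_Icc]
  have hd : Disjoint (Set.Iio (-b)) (Set.Ioi b) :=
    Set.disjoint_left.2 fun x hx hx' => by
      simp only [Set.mem_Iio, Set.mem_Ioi] at hx hx'; linarith
  rw [h1, probReal_compl_eq_one_sub (measurableSet_Iio.union measurableSet_Ioi),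
    measureReal_union hd measurableSet_Ioi, gaussianReal_real_Iio_neg]
  ring

lemma gaussianReal_real_Icc_le {v : ℝ≥0} (hv : v ≠ 0) {b : ℝ} (hb : 0 ≤ b) :
    (gaussianReal 0 v).real (Set.Icc (-b) b) ≤ b / √v := by
  have hv' : (0 : ℝ) < v := by positivity
  have hpi := Real.pi_gt_three
  have hs : 2 ≤ √(2 * Real.pi) := Real.le_sqrt_of_sq_le (by linarith)
  have hvs : 0 < √(v : ℝ) := Real.sqrt_pos.2 hv'
  rw [measureReal_def, gaussianReal_apply_eq_integral _ hv, ENNReal.toReal_ofReal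
    (integral_nonneg fun x => gaussianPDFReal_nonneg _ _ _)]
  calc ∫ x in Set.Icc (-b) b, gaussianPDFReal 0 v x
      ≤ ∫ x in Set.Icc (-b) b, (2 * √(v : ℝ))⁻¹ := by
        refine setIntegral_mono_on (integrable_gaussianPDFReal 0 v).integrableOn
          continuous_const.integrableOn_Icc measurableSet_Icc fun x _ => ?_
        rw [gaussianPDFReal_def, Real.sqrt_mul (by positivity)]
        calc _ ≤ (√(2 * Real.pi) * √(v : ℝ))⁻¹ * 1 := by
              refine mul_le_mul_of_nonneg_left ?_ (by positivity)
              rw [Real.exp_le_one_iff]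
              exact div_nonpos_of_nonpos_of_nonneg (by nlinarith [sq_nonneg (x - 0)]) (by positivity)
          _ ≤ _ := by rw [mul_one]; gcongr
    _ = b / √v := by
        simp [measureReal_def]
        rw [ENNReal.toReal_ofReal (by linarith)]
        field_simp
        ring

lemma gaussianReal_real_Ioi_le (v : ℝ≥0) {x : ℝ} (hx : 0 ≤ x) :
    (gaussianReal 0 v).real (Set.Ioi (x * √v)) ≤ Real.exp (-x ^ 2 / 2) := by
  rcases eq_or_ne v 0 with rfl | hv
  · simp [measureReal_def]; positivity
  have hv' : (0 : ℝ) < v := by positivity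
  have hvs : 0 < √(v : ℝ) := Real.sqrt_pos.2 hv'
  have h := measure_ge_le_exp_mul_mgf (μ := gaussianReal 0 v) (X := id) (t := x / √v) (x * √v)
    (by positivity) (integrable_exp_mul_gaussianReal _)
  rw [mgf_id_gaussianReal] at h
  refine (measureReal_mono (fun y hy => ?_)).trans (h.trans_eq ?_)
  · exact le_of_lt (Set.mem_Ioi.1 hy)
  · rw [← Real.exp_add]
    congr 1
    have : √(v : ℝ) ^ 2 = v := Real.sq_sqrt hv'.le
    field_simp
    rw [this]; field_simp; ring

lemma gaussianReal_real_compl_Icc_le (v : ℝ≥0) {x : ℝ} (hx : 0 ≤ x) :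
    (gaussianReal 0 v).real (Set.Icc (-(x * √v)) (x * √v))ᶜ ≤ 2 * Real.exp (-x ^ 2 / 2) := by
  have h1 := gaussianReal_real_Icc_add v (b := x * √v) (by positivity)
  have h2 := gaussianReal_real_Ioi_le v hx
  rw [probReal_compl_eq_one_sub measurableSet_Icc]
  linarith

end Gaussian

section FirstPassage

variable {Ω : Type*} {mΩ : MeasurableSpace Ω} {P : Measure Ω} [IsProbabilityMeasure P]

/-- A discrete reflection principle: overshooting is controlled by the largest jump. -/
lemma measure_lt_last_le_half_measure_exceed {T : ℕ → Ω → ℝ} {𝓖 : ℕ → MeasurableSpace Ω}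
    {d : ℕ} (h𝓖 : ∀ i ≤ d, 𝓖 i ≤ mΩ)
    (hT : ∀ i ≤ d, ∀ r ≤ i, Measurable[𝓖 i] (T r))
    (hhalf : ∀ i ≤ d, ∀ s, MeasurableSet[𝓖 i] s →
      P.real (s ∩ {ω | 0 < T d ω - T i ω}) ≤ P.real s / 2)
    {a η : ℝ} (hη : 0 ≤ η) (hT0 : ∀ ω, T 0 ω ≤ a) :
    P.real {ω | a + η < T d ω} ≤ P.real {ω | ∃ i ≤ d, a < T i ω} / 2
      + P.real {ω | ∃ i < d, η < T (i + 1) ω - T i ω} := by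
  set E : ℕ → Set Ω := fun i => {ω | a < T i ω ∧ ∀ r < i, T r ω ≤ a} with hE
  set J : Set Ω := {ω | ∃ i < d, η < T (i + 1) ω - T i ω} with hJ
  have hEm : ∀ i ≤ d, MeasurableSet[𝓖 i] (E i) := by
    intro i hi
    have : E i = {ω | a < T i ω} ∩ ⋂ r ∈ Set.Iio i, {ω | T r ω ≤ a} := by
      ext ω; simp [hE]
    rw [this]
    refine MeasurableSet.inter (hT i hi i le_rfl measurableSet_Ioi) ?_
    exact MeasurableSet.biInter (Set.to_countable _)
      fun r hr => hT i hi r (le_of_lt hr) measurableSet_Iic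
  have hsub : {ω | a + η < T d ω} ⊆
      (⋃ i ∈ Finset.range (d + 1), E i ∩ {ω | 0 < T d ω - T i ω}) ∪ J := by
    intro ω hω
    by_cases hj : ω ∈ J
    · exact Or.inr hj
    left
    have hex : ∃ i, a < T i ω := ⟨d, by simp only [Set.mem_ofPred_eq] at hω; linarith⟩
    classical
    have h1 := Nat.find_spec hex
    have h2 := fun r (hr : r < Nat.find hex) => not_lt.1 (Nat.find_min hex hr)
    have h3 : Nat.find hex ≤ d :=
      Nat.find_min' hex (by simp only [Set.mem_ofPred_eq] at hω; linarith)
    simp only [Set.mem_iUnion, Finset.mem_range]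
    refine ⟨Nat.find hex, by omega, ⟨h1, h2⟩, ?_⟩
    obtain ⟨i, hi⟩ : ∃ i, Nat.find hex = i + 1 := by
      refine Nat.exists_eq_succ_of_ne_zero fun h0 => ?_
      rw [h0] at h1
      exact absurd (hT0 ω) (not_le.2 h1)
    have h4 : T (i + 1) ω - T i ω ≤ η := by
      by_contra hcon
      exact hj ⟨i, by omega, not_le.1 hcon⟩
    have h5 := h2 i (by omega)
    simp only [Set.mem_ofPred_eq] at hω ⊢
    rw [hi]
    linarith
  have hdisj : P.real (⋃ i ∈ Finset.range (d + 1), E i) = ∑ i ∈ Finset.range (d + 1), P.real (E i) := by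
    refine measureReal_biUnion_finset ?_ fun i hi => h𝓖 i ?_ _ (hEm i ?_)
    · intro i _ j _ hij
      refine Set.disjoint_left.2 fun ω hi hj => ?_
      rcases lt_or_gt_of_ne hij with h | h
      · exact absurd hi.1 (not_lt.2 (hj.2 i h))
      · exact absurd hj.1 (not_lt.2 (hi.2 j h))
    all_goals simp only [Finset.mem_range] at hi; omega
  calc P.real {ω | a + η < T d ω}
      ≤ P.real (⋃ i ∈ Finset.range (d + 1), E i ∩ {ω | 0 < T d ω - T i ω}) + P.real J :=
        (measureReal_mono hsub).trans (measureReal_union_le _ _)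
    _ ≤ ∑ i ∈ Finset.range (d + 1), P.real (E i ∩ {ω | 0 < T d ω - T i ω}) + P.real J := by
        gcongr; exact measureReal_biUnion_finset_le _ _
    _ ≤ ∑ i ∈ Finset.range (d + 1), P.real (E i) / 2 + P.real J := by
        gcongr with i hi
        have hi' : i ≤ d := by simp only [Finset.mem_range] at hi; omega
        exact hhalf i hi' _ (hEm i hi')
    _ ≤ _ := by
        rw [← Finset.sum_div, ← hdisj]
        have hsub' : (⋃ i ∈ Finset.range (d + 1), E i) ⊆ {ω | ∃ i ≤ d, a < T i ω} := by
          intro ω hω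
          simp only [Set.mem_iUnion, Finset.mem_range] at hω
          obtain ⟨i, hi, h⟩ := hω
          exact ⟨i, by omega, h.1⟩
        have := measureReal_mono (μ := P) hsub'
        linarith

/-- The probability that a walk with symmetric remaining increments stays below a level. -/
lemma measure_forall_le_le {T : ℕ → Ω → ℝ} {𝓖 : ℕ → MeasurableSpace Ω}
    {d : ℕ} (h𝓖 : ∀ i ≤ d, 𝓖 i ≤ mΩ)
    (hT : ∀ i ≤ d, ∀ r ≤ i, Measurable[𝓖 i] (T r))
    (hhalf : ∀ i ≤ d, ∀ s, MeasurableSet[𝓖 i] s →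
      P.real (s ∩ {ω | 0 < T d ω - T i ω}) ≤ P.real s / 2)
    {v : NNReal} (hv : v ≠ 0) (hlaw : P.map (T d) = gaussianReal 0 v)
    {a η : ℝ} (hη : 0 ≤ η) (ha : 0 ≤ a) (hT0 : ∀ ω, T 0 ω ≤ a) :
    P.real {ω | ∀ i ≤ d, T i ω ≤ a} ≤ (a + η) / √v
      + 2 * P.real {ω | ∃ i < d, η < T (i + 1) ω - T i ω} := by
  have h1 := measure_lt_last_le_half_measure_exceed h𝓖 hT hhalf hη hT0
  have hTm : ∀ i ≤ d, Measurable (T i) := fun i hi =>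
    (hT i hi i le_rfl).mono (h𝓖 i hi) le_rfl
  have h2 : P.real {ω | a + η < T d ω} = (gaussianReal 0 v).real (Set.Ioi (a + η)) := by
    rw [← hlaw, map_measureReal_apply (hTm d le_rfl) measurableSet_Ioi]; rfl
  have h3 := gaussianReal_real_Icc_add v (b := a + η) (by positivity)
  have h4 := gaussianReal_real_Icc_le hv (b := a + η) (by positivity)
  have hm : MeasurableSet {ω | ∀ i ≤ d, T i ω ≤ a} := by
    have : {ω | ∀ i ≤ d, T i ω ≤ a} = ⋂ i ∈ Set.Iic d, {ω | T i ω ≤ a} := by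
      ext ω; simp
    rw [this]
    exact MeasurableSet.biInter (Set.to_countable _) fun i hi => hTm i hi measurableSet_Iic
  have h5 : {ω | ∃ i ≤ d, a < T i ω} = {ω | ∀ i ≤ d, T i ω ≤ a}ᶜ := by
    ext ω; simp
  rw [h5, probReal_compl_eq_one_sub hm] at h1
  linarith

end FirstPassage

section Chains

open scoped ENNReal

/-- The total weight of the increasing chains ending at `l`, where an edge `k < l` is allowed
at `ω` if `ω ∈ B k l` and every edge carries the weight `s`. -/
def chainWeight {Ω : Type*} (s : ℝ≥0∞) (B : ℕ → ℕ → Set Ω) (ω : Ω) : ℕ → ℝ≥0∞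
  | l => 1 + s * ∑ k : Fin l, chainWeight s B ω k * (B k l).indicator 1 ω
  decreasing_by exact k.isLt

lemma chainWeight_eq {Ω : Type*} (s : ℝ≥0∞) (B : ℕ → ℕ → Set Ω) (ω : Ω) (l : ℕ) :
    chainWeight s B ω l =
      1 + s * ∑ k ∈ Finset.range l, chainWeight s B ω k * (B k l).indicator 1 ω := by
  rw [chainWeight, Finset.sum_range]

lemma one_add_pow_card_le {Ω : Type*} (s : ℝ≥0∞) (B : ℕ → ℕ → Set Ω) (ω : Ω) (A : Finset ℕ)
    (hA : ∀ k ∈ A, ∀ l ∈ A, k < l → ω ∈ B k l) :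
    (1 + s) ^ A.card ≤ 1 + s * ∑ l ∈ A, chainWeight s B ω l := by
  induction A using Finset.induction_on_max with
  | empty => simp
  | insert l A hl ih =>
    have hlA : l ∉ A := fun h => lt_irrefl _ (hl l h)
    have ih := ih fun k hk l hl => hA k (Finset.mem_insert_of_mem hk) l (Finset.mem_insert_of_mem hl)
    have h1 : (1 + s) ^ A.card ≤ chainWeight s B ω l := by
      refine ih.trans ?_
      rw [chainWeight_eq s B ω l]
      gcongr 1 + s * ?_
      calc ∑ k ∈ A, chainWeight s B ω k
          = ∑ k ∈ A, chainWeight s B ω k * (B k l).indicator 1 ω := by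
            refine Finset.sum_congr rfl fun k hk => ?_
            rw [Set.indicator_of_mem (hA k (Finset.mem_insert_of_mem hk) l
              (Finset.mem_insert_self _ _) (hl k hk))]
            simp
        _ ≤ _ := Finset.sum_le_sum_of_subset fun k hk => Finset.mem_range.2 (hl k hk)
    rw [Finset.card_insert_of_notMem hlA, Finset.sum_insert hlA]
    calc (1 + s) ^ (A.card + 1) = (1 + s) ^ A.card + s * (1 + s) ^ A.card := by ring
      _ ≤ (1 + s * ∑ l ∈ A, chainWeight s B ω l) + s * chainWeight s B ω l := by gcongr
      _ = _ := by ring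

lemma measurable_chainWeight_of_measurableSet {Ω : Type*} {m : MeasurableSpace Ω} {s : ℝ≥0∞}
    {B : ℕ → ℕ → Set Ω} (l : ℕ) (hB : ∀ j ≤ l, ∀ k < j, MeasurableSet (B k j)) :
    Measurable (fun ω => chainWeight s B ω l) := by
  induction l using Nat.strong_induction_on with
  | _ l ih =>
    simp_rw [chainWeight_eq s B _ l]
    refine Measurable.const_add (Measurable.const_mul
      (Finset.measurable_sum _ fun k hk => ?_) _) _
    have hk' := Finset.mem_range.1 hk
    exact (ih k hk' fun j hj => hB j (by omega)).mul
      (measurable_one.indicator (hB l le_rfl k hk'))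

variable {Ω : Type*} {mΩ : MeasurableSpace Ω} {P : Measure Ω} [IsProbabilityMeasure P]

lemma measurable_chainWeight {s : ℝ≥0∞} {B : ℕ → ℕ → Set Ω} {𝓐 : ℕ → MeasurableSpace Ω}
    (h𝓐 : Monotone 𝓐) {K : ℕ}
    (hB : ∀ l ≤ K, ∀ k < l, MeasurableSet[𝓐 l] (B k l)) (l : ℕ) (hl : l ≤ K) :
    Measurable[𝓐 l] (fun ω => chainWeight s B ω l) :=
  measurable_chainWeight_of_measurableSet l fun j hj k hk => h𝓐 hj _ (hB j (hj.trans hl) k hk)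

lemma lintegral_chainWeight_le {s : ℝ≥0∞} {B : ℕ → ℕ → Set Ω} {𝓐 𝓑 : ℕ → MeasurableSpace Ω}
    (h𝓐 : Monotone 𝓐) {K : ℕ} (h𝓐m : ∀ k ≤ K, 𝓐 k ≤ mΩ) (h𝓑m : ∀ k ≤ K, 𝓑 k ≤ mΩ)
    (hind : ∀ k ≤ K, Indep (𝓐 k) (𝓑 k) P)
    (hB : ∀ l ≤ K, ∀ k < l, MeasurableSet[𝓐 l] (B k l))
    (hB' : ∀ l ≤ K, ∀ k < l, MeasurableSet[𝓑 k] (B k l))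
    (hs : ∀ l ≤ K, s * ∑ k ∈ Finset.range l, P (B k l) ≤ 2⁻¹) (l : ℕ) (hl : l ≤ K) :
    ∫⁻ ω, chainWeight s B ω l ∂P ≤ 2 := by
  induction l using Nat.strong_induction_on with
  | _ l ih =>
    have hV := fun k (hk : k ≤ K) => (measurable_chainWeight (s := s) h𝓐 hB k hk)
    have hI : ∀ k < l, Measurable[𝓑 k] ((B k l).indicator (1 : Ω → ℝ≥0∞)) := fun k hk =>
      @Measurable.indicator _ _ _ _ (𝓑 k) _ _ (@measurable_one _ _ _ (𝓑 k) _) (hB' l hl k hk)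
    have hm : ∀ k ∈ Finset.range l,
        Measurable fun ω => chainWeight s B ω k * (B k l).indicator (1 : Ω → ℝ≥0∞) ω := by
      intro k hk
      have hk' := Finset.mem_range.1 hk
      exact ((hV k (by omega)).mono (h𝓐m k (by omega)) le_rfl).mul
        ((hI k hk').mono (h𝓑m k (by omega)) le_rfl)
    simp_rw [chainWeight_eq s B _ l]
    rw [lintegral_add_left measurable_const, lintegral_const_mul _ (Finset.measurable_sum _ hm),
      lintegral_finsetSum _ hm]
    calc ∫⁻ _, 1 ∂P + s * ∑ k ∈ Finset.range l,
          ∫⁻ ω, chainWeight s B ω k * (B k l).indicator (1 : Ω → ℝ≥0∞) ω ∂P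
        ≤ 1 + s * ∑ k ∈ Finset.range l, 2 * P (B k l) := by
          simp only [lintegral_const, measure_univ, mul_one]
          gcongr with k hk
          have hk' := Finset.mem_range.1 hk
          rw [lintegral_mul_eq_lintegral_mul_lintegral_of_independent_measurableSpace
            (h𝓐m k (by omega)) (h𝓑m k (by omega)) (hind k (by omega)) (hV k (by omega)) (hI k hk'),
            lintegral_indicator_one (h𝓑m k (by omega) _ (hB' l hl k hk'))]
          gcongr
          exact ih k hk' (by omega)
      _ = 1 + 2 * (s * ∑ k ∈ Finset.range l, P (B k l)) := by
          rw [← Finset.mul_sum]; ring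
      _ ≤ 1 + 2 * 2⁻¹ := by gcongr; exact hs l hl
      _ = 2 := by
          rw [ENNReal.mul_inv_cancel (by norm_num) (by norm_num)]; norm_num

/-- Long chains are exponentially unlikely. -/
lemma measure_exists_chain_le {s : ℝ≥0∞} (hs' : s ≠ ∞)
    {B : ℕ → ℕ → Set Ω} {𝓐 𝓑 : ℕ → MeasurableSpace Ω}
    (h𝓐 : Monotone 𝓐) {K : ℕ} (h𝓐m : ∀ k ≤ K, 𝓐 k ≤ mΩ) (h𝓑m : ∀ k ≤ K, 𝓑 k ≤ mΩ)
    (hind : ∀ k ≤ K, Indep (𝓐 k) (𝓑 k) P)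
    (hB : ∀ l ≤ K, ∀ k < l, MeasurableSet[𝓐 l] (B k l))
    (hB' : ∀ l ≤ K, ∀ k < l, MeasurableSet[𝓑 k] (B k l))
    (hs : ∀ l ≤ K, s * ∑ k ∈ Finset.range l, P (B k l) ≤ 2⁻¹) (m : ℕ) :
    P {ω | ∃ A ⊆ Finset.range (K + 1), m ≤ A.card ∧ ∀ k ∈ A, ∀ l ∈ A, k < l → ω ∈ B k l} ≤
      (1 + 2 * s * (K + 1)) / (1 + s) ^ m := by
  have hVm : ∀ l ∈ Finset.range (K + 1), Measurable fun ω => chainWeight s B ω l := fun l hl => by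
    have hl' : l ≤ K := Nat.lt_succ_iff.1 (Finset.mem_range.1 hl)
    exact (measurable_chainWeight h𝓐 hB l hl').mono (h𝓐m l hl') le_rfl
  set f : Ω → ℝ≥0∞ := fun ω => 1 + s * ∑ l ∈ Finset.range (K + 1), chainWeight s B ω l
  have hf : Measurable f := ((Finset.measurable_sum _ hVm).const_mul _).const_add _
  calc P {ω | ∃ A ⊆ Finset.range (K + 1), m ≤ A.card ∧ ∀ k ∈ A, ∀ l ∈ A, k < l → ω ∈ B k l}
      ≤ P {ω | (1 + s) ^ m ≤ f ω} := by
        refine measure_mono ?_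
        rintro ω ⟨A, hA, hm, h⟩
        calc (1 + s) ^ m ≤ (1 + s) ^ A.card := pow_le_pow_right₀ le_self_add hm
          _ ≤ 1 + s * ∑ l ∈ A, chainWeight s B ω l := one_add_pow_card_le s B ω A h
          _ ≤ f ω := by
            simp only [f]
            gcongr 1 + s * ?_
            exact Finset.sum_le_sum_of_subset hA
    _ ≤ (∫⁻ ω, f ω ∂P) / (1 + s) ^ m :=
        meas_ge_le_lintegral_div hf.aemeasurable (pow_ne_zero _ (by simp))
          (ENNReal.pow_ne_top (by simp [hs']))
    _ ≤ _ := by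
        gcongr
        rw [lintegral_add_left measurable_const, lintegral_const_mul _ (Finset.measurable_sum _ hVm),
          lintegral_finsetSum _ hVm]
        calc ∫⁻ _, 1 ∂P + s * ∑ l ∈ Finset.range (K + 1), ∫⁻ ω, chainWeight s B ω l ∂P
            ≤ 1 + s * ∑ l ∈ Finset.range (K + 1), 2 := by
              simp only [lintegral_const, measure_univ, mul_one]
              gcongr with l hl
              exact lintegral_chainWeight_le h𝓐 h𝓐m h𝓑m hind hB hB' hs l
                (Nat.lt_succ_iff.1 (Finset.mem_range.1 hl))
          _ = _ := by simp; ring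

end Chains

lemma incrementSigma_mono {Ω : Type*} (W : ℝ → Ω → ℝ) {s t s' t' : ℝ} (hs : s' ≤ s)
    (ht : t ≤ t') : incrementSigma W s t ≤ incrementSigma W s' t' := by
  refine Measurable.comap_le ?_
  exact @measurable_pi_lambda _ _ _ (incrementSigma W s' t') _ _ fun p =>
    measurable_incrementSigma W (Set.Icc_subset_Icc hs ht p.1.2) (Set.Icc_subset_Icc hs ht p.2.2)

lemma ProbabilityTheory.Indep.measureReal_inter_pos_le {Ω : Type*} {m₁ m₂ mΩ : MeasurableSpace Ω}
    {P : Measure Ω} [IsProbabilityMeasure P] (h : Indep m₁ m₂ P) {s : Set Ω}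
    (hs : MeasurableSet[m₁] s) {X : Ω → ℝ} (hX : Measurable[m₂] X) (hXm : Measurable X)
    {v : NNReal} (hlaw : P.map X = gaussianReal 0 v) :
    P.real (s ∩ {ω | 0 < X ω}) ≤ P.real s / 2 := by
  have h1 := (Indep_iff _ _ P).1 h s {ω | 0 < X ω} hs (hX measurableSet_Ioi)
  have h2 := gaussianReal_real_Ioi_zero_le v
  rw [← hlaw, map_measureReal_apply hXm measurableSet_Ioi] at h2
  rw [measureReal_def, h1, ENNReal.toReal_mul]
  have h3 : (P {ω | 0 < X ω}).toReal ≤ 1 / 2 := h2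
  have : 0 ≤ (P s).toReal := ENNReal.toReal_nonneg
  rw [measureReal_def]
  nlinarith

/-- The event that all values at the grid points `k / K, …, l / K` exceed neither of the values at
the two end points by more than `ε`. -/
def jointMaxSet {Ω : Type*} (W : ℝ → Ω → ℝ) (K : ℕ) (ε : ℝ) (k l : ℕ) : Set Ω :=
  {ω | ∀ r : ℕ, k ≤ r → r ≤ l →
    W (r / K) ω - W (k / K) ω ≤ ε ∧ W (r / K) ω - W (l / K) ω ≤ ε}

lemma measurableSet_jointMaxSet {Ω : Type*} (W : ℝ → Ω → ℝ) (K : ℕ) (ε : ℝ) {k l : ℕ}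
    {s t : ℝ} (hkl : k ≤ l) (hs : s ≤ k / K) (ht : (l : ℝ) / K ≤ t) :
    MeasurableSet[incrementSigma W s t] (jointMaxSet W K ε k l) := by
  have hmem : ∀ r : ℕ, k ≤ r → r ≤ l → (r : ℝ) / K ∈ Set.Icc s t := fun r hk hl =>
    ⟨hs.trans (by gcongr), le_trans (by gcongr) ht⟩
  have : jointMaxSet W K ε k l = ⋂ r ∈ Set.Icc k l,
      ({ω | W (r / K) ω - W (k / K) ω ≤ ε} ∩ {ω | W (r / K) ω - W (l / K) ω ≤ ε}) := by
    ext ω; simp only [jointMaxSet, Set.mem_iInter, Set.mem_Icc, Set.mem_inter_iff,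
      Set.mem_ofPred_eq, and_imp]
  rw [this]
  refine @MeasurableSet.biInter _ _ (incrementSigma W s t) _ _ (Set.to_countable _) fun r hr => ?_
  exact @MeasurableSet.inter _ (incrementSigma W s t) _ _
    (measurable_incrementSigma W (hmem k le_rfl hkl) (hmem r hr.1 hr.2) measurableSet_Iic)
    (measurable_incrementSigma W (hmem l hkl le_rfl) (hmem r hr.1 hr.2) measurableSet_Iic)

namespace IsBrownianMotion

variable {Ω : Type*} [MeasurableSpace Ω] {P : Measure Ω} [IsProbabilityMeasure P] {W : ℝ → Ω → ℝ}

lemma measure_forall_sub_le (hW : IsBrownianMotion P W) {τ : ℕ → ℝ} {d : ℕ}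
    (hτ : ∀ i ≤ d, τ i ∈ Set.Icc (0 : ℝ) 1)
    (hmono : (∀ i j, i ≤ j → j ≤ d → τ i ≤ τ j) ∨ (∀ i j, i ≤ j → j ≤ d → τ j ≤ τ i))
    (hne : τ d ≠ τ 0) {ε η : ℝ} (hη : 0 ≤ η) (hε : 0 ≤ ε) :
    P.real {ω | ∀ i ≤ d, W (τ i) ω - W (τ 0) ω ≤ ε} ≤ (ε + η) / √|τ d - τ 0|
      + 2 * P.real {ω | ∃ i < d, η < W (τ (i + 1)) ω - W (τ i) ω} := by
  have hmem : ∀ i j r, i ≤ r → r ≤ j → j ≤ d →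
      τ r ∈ Set.Icc (min (τ i) (τ j)) (max (τ i) (τ j)) := by
    intro i j r h1 h2 h3
    rcases hmono with h | h
    · exact ⟨(min_le_left _ _).trans (h i r h1 (h2.trans h3)),
        (h r j h2 h3).trans (le_max_right _ _)⟩
    · exact ⟨(min_le_right _ _).trans (h r j h2 h3),
        (h i r h1 (h2.trans h3)).trans (le_max_left _ _)⟩
  have hind : ∀ i ≤ d, Indep (incrementSigma W (min (τ 0) (τ i)) (max (τ 0) (τ i)))
      (incrementSigma W (min (τ i) (τ d)) (max (τ i) (τ d))) P := by
    intro i hi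
    rcases hmono with h | h
    · have h1 := h 0 i (Nat.zero_le _) hi
      have h2 := h i d hi le_rfl
      rw [min_eq_left h1, max_eq_right h1, min_eq_left h2, max_eq_right h2]
      exact hW.indep_incrementSigma (hτ 0 (Nat.zero_le _)).1 le_rfl (hτ i hi).2 (hτ i hi).1
        (hτ d le_rfl).2
    · have h1 := h 0 i (Nat.zero_le _) hi
      have h2 := h i d hi le_rfl
      rw [min_eq_right h1, max_eq_left h1, min_eq_right h2, max_eq_left h2]
      exact (hW.indep_incrementSigma (hτ d le_rfl).1 le_rfl (hτ i hi).2 (hτ i hi).1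
        (hτ 0 (Nat.zero_le _)).2).symm
  have hm : ∀ i j : ℕ, Measurable fun ω => W (τ j) ω - W (τ i) ω := fun i j =>
    (hW.1 _).sub (hW.1 _)
  have key := measure_forall_le_le (P := P) (T := fun i ω => W (τ i) ω - W (τ 0) ω)
    (𝓖 := fun i => incrementSigma W (min (τ 0) (τ i)) (max (τ 0) (τ i))) (d := d)
    (fun i _ => hW.incrementSigma_le _ _)
    (fun i hi r hr => measurable_incrementSigma W (hmem 0 i 0 le_rfl (Nat.zero_le _) hi)
      (hmem 0 i r (Nat.zero_le _) hr hi))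
    (fun i hi s hs => by
      have := (hind i hi).measureReal_inter_pos_le hs
        (measurable_incrementSigma W (hmem i d i le_rfl hi le_rfl) (hmem i d d hi le_rfl le_rfl))
        (hm i d) (hW.map_sub (hτ i hi) (hτ d le_rfl))
      simpa only [sub_sub_sub_cancel_right] using this)
    (v := |τ d - τ 0|.toNNReal)
    (by simpa [Real.toNNReal_eq_zero, sub_eq_zero] using hne)
    (hW.map_sub (hτ 0 (Nat.zero_le _)) (hτ d le_rfl)) hη hε (fun ω => by simpa using hε)
  simpa only [sub_sub_sub_cancel_right, Real.coe_toNNReal _ (abs_nonneg (τ d - τ 0))] using key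

lemma measure_jointMaxSet_le (hW : IsBrownianMotion P W) {K k l : ℕ} (hkl : k + 2 ≤ l)
    (hl : l ≤ K) {ε η δ : ℝ} (hη : 0 ≤ η) (hε : 0 ≤ ε)
    (hδ : P.real {ω | ∃ i < K, η < |W ((i + 1 : ℕ) / K) ω - W (i / K) ω|} ≤ δ) :
    P.real (jointMaxSet W K ε k l) ≤ ((ε + η) / √(((l - k) / 2 : ℕ) / K) + 2 * δ) ^ 2 := by
  set d := (l - k) / 2
  have hK : (0 : ℝ) < K := by exact_mod_cast (by omega : 0 < K)
  have hd : 1 ≤ d := by omega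
  have hdk : k + d ≤ l - d := by omega
  have h01 : ∀ i : ℕ, i ≤ K → (i : ℝ) / K ∈ Set.Icc (0 : ℝ) 1 := fun i hi =>
    ⟨by positivity, div_le_one_of_le₀ (by exact_mod_cast hi) hK.le⟩
  have hdiv : ∀ {i j : ℕ}, i ≤ j → (i : ℝ) / K ≤ j / K := fun h => by gcongr
  have hF := hW.measure_forall_sub_le (τ := fun i => ((k + i : ℕ) : ℝ) / K) (d := d)
    (fun i hi => h01 _ (by omega)) (Or.inl fun i j hij _ => hdiv (by omega))
    (by simp [add_div, hK.ne']; omega) hη hε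
  have hG := hW.measure_forall_sub_le (τ := fun i => ((l - i : ℕ) : ℝ) / K) (d := d)
    (fun i hi => h01 _ (by omega)) (Or.inr fun i j hij _ => hdiv (by omega))
    (by rw [Ne, div_left_inj' hK.ne', Nat.cast_inj]; omega) hη hε
  have e1 : |((k + d : ℕ) : ℝ) / K - ((k + 0 : ℕ) : ℝ) / K| = (d : ℝ) / K := by
    rw [← sub_div]; push_cast; rw [add_zero, add_sub_cancel_left, abs_of_nonneg (by positivity)]
  have e2 : |((l - d : ℕ) : ℝ) / K - ((l - 0 : ℕ) : ℝ) / K| = (d : ℝ) / K := by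
    rw [← sub_div, Nat.cast_sub (by omega), Nat.sub_zero, sub_sub_cancel_left, abs_div, abs_neg, abs_of_nonneg (by positivity),
      abs_of_nonneg hK.le]
  rw [e1] at hF
  rw [e2] at hG
  have jF : P.real {ω | ∃ i < d, η < W (((k + (i + 1) : ℕ) : ℝ) / K) ω
      - W (((k + i : ℕ) : ℝ) / K) ω} ≤ δ := by
    refine (measureReal_mono ?_).trans hδ
    rintro ω ⟨i, hi, h⟩
    exact ⟨k + i, by omega, h.trans_le (le_abs_self _)⟩
  have jG : P.real {ω | ∃ i < d, η < W (((l - (i + 1) : ℕ) : ℝ) / K) ω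
      - W (((l - i : ℕ) : ℝ) / K) ω} ≤ δ := by
    refine (measureReal_mono ?_).trans hδ
    rintro ω ⟨i, hi, h⟩
    refine ⟨l - (i + 1), by omega, ?_⟩
    rw [show l - (i + 1) + 1 = l - i by omega, abs_sub_comm]
    exact h.trans_le (le_abs_self _)
  set F := {ω | ∀ i ≤ d, W (((k + i : ℕ) : ℝ) / K) ω - W (((k + 0 : ℕ) : ℝ) / K) ω ≤ ε}
  set G := {ω | ∀ i ≤ d, W (((l - i : ℕ) : ℝ) / K) ω - W (((l - 0 : ℕ) : ℝ) / K) ω ≤ ε}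
  have hFG : P.real (F ∩ G) = P.real F * P.real G := by
    have hind := hW.indep_incrementSigma (s := (k : ℝ) / K) (t := ((k + d : ℕ) : ℝ) / K)
      (u := ((l - d : ℕ) : ℝ) / K) (v := (l : ℝ) / K) (by positivity) (hdiv hdk)
      (h01 _ (by omega)).2 (by positivity) (h01 _ hl).2
    have h := (Indep_iff _ _ P).1 hind F G ?_ ?_
    · simp [measureReal_def, h]
    · have : F = ⋂ i ∈ Set.Iic d,
          {ω | W (((k + i : ℕ) : ℝ) / K) ω - W (((k + 0 : ℕ) : ℝ) / K) ω ≤ ε} := by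
        ext ω; simp [F]
      rw [this]
      refine @MeasurableSet.biInter _ _ (incrementSigma W _ _) _ _ (Set.to_countable _)
        fun i hi => ?_
      have hi' : i ≤ d := hi
      exact measurable_incrementSigma W ⟨hdiv (by omega), hdiv (by omega)⟩
        ⟨hdiv (by omega), hdiv (by omega)⟩ measurableSet_Iic
    · have : G = ⋂ i ∈ Set.Iic d,
          {ω | W (((l - i : ℕ) : ℝ) / K) ω - W (((l - 0 : ℕ) : ℝ) / K) ω ≤ ε} := by
        ext ω; simp [G]
      rw [this]
      refine @MeasurableSet.biInter _ _ (incrementSigma W _ _) _ _ (Set.to_countable _)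
        fun i hi => ?_
      have hi' : i ≤ d := hi
      exact measurable_incrementSigma W ⟨hdiv (by omega), hdiv (by omega)⟩
        ⟨hdiv (by omega), hdiv (by omega)⟩ measurableSet_Iic
  have hsub : jointMaxSet W K ε k l ⊆ F ∩ G := fun ω hω =>
    ⟨fun i hi => (hω (k + i) (by omega) (by omega)).1,
      fun i hi => (hω (l - i) (by omega) (by omega)).2⟩
  calc P.real (jointMaxSet W K ε k l) ≤ P.real F * P.real G := hFG ▸ measureReal_mono hsub
    _ ≤ ((ε + η) / √((d : ℝ) / K) + 2 * δ) * ((ε + η) / √((d : ℝ) / K) + 2 * δ) := by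
        have hF' := hF.trans (add_le_add_right (mul_le_mul_of_nonneg_left jF zero_le_two) _)
        have hG' := hG.trans (add_le_add_right (mul_le_mul_of_nonneg_left jG zero_le_two) _)
        exact mul_le_mul hF' hG' measureReal_nonneg (measureReal_nonneg.trans hF')
    _ = _ := by ring

lemma sum_measure_jointMaxSet_le (hW : IsBrownianMotion P W) {j l : ℕ} (hl : l ≤ 2 ^ j)
    {ε η δ : ℝ} (hη : 0 ≤ η) (hε : 0 ≤ ε)
    (hδ : P.real {ω | ∃ i < 2 ^ j, η < |W ((i + 1 : ℕ) / (2 ^ j : ℕ)) ω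
      - W (i / (2 ^ j : ℕ)) ω|} ≤ δ) :
    ∑ k ∈ Finset.range l, P.real (jointMaxSet W (2 ^ j) ε k l) ≤
      1 + 8 * 2 ^ j * (ε + η) ^ 2 * (1 + j) + 8 * 2 ^ j * δ ^ 2 := by
  set K := 2 ^ j with hKdef
  have hK : (0 : ℝ) < K := by positivity
  have hδ0 : 0 ≤ δ := measureReal_nonneg.trans hδ
  rcases Nat.eq_zero_or_pos l with rfl | hl0
  · simp; positivity
  have hterm : ∀ i ∈ Finset.range (l - 1), P.real (jointMaxSet W K ε (l - 1 - 1 - i) l) ≤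
      8 * K * (ε + η) ^ 2 * ((i + 1 : ℕ) : ℝ)⁻¹ + 8 * δ ^ 2 := by
    intro i hi
    have hi' := Finset.mem_range.1 hi
    refine (hW.measure_jointMaxSet_le (by omega) hl hη hε hδ).trans ?_
    rw [show l - (l - 1 - 1 - i) = i + 2 by omega]
    have h1 : ((i + 1 : ℕ) : ℝ) ≤ 2 * ((i + 2) / 2 : ℕ) := by
      exact_mod_cast (by omega : i + 1 ≤ 2 * ((i + 2) / 2))
    have hi0 : (0 : ℝ) < ((i + 1 : ℕ) : ℝ) := by positivity
    set D : ℝ := (((i + 2) / 2 : ℕ) : ℝ)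
    have hD : 0 < D := by linarith
    have h2 : ((ε + η) / √(D / K)) ^ 2 = K * (ε + η) ^ 2 * D⁻¹ := by
      rw [div_pow, Real.sq_sqrt (by positivity)]; field_simp
    have h3 : D⁻¹ ≤ 2 * ((i + 1 : ℕ) : ℝ)⁻¹ := by
      rw [← div_eq_mul_inv, inv_le_comm₀ hD (by positivity), inv_div]; linarith
    calc ((ε + η) / √(D / K) + 2 * δ) ^ 2
        ≤ 2 * (((ε + η) / √(D / K)) ^ 2 + (2 * δ) ^ 2) := by
          nlinarith [sq_nonneg ((ε + η) / √(D / K) - 2 * δ)]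
      _ = 2 * (K * (ε + η) ^ 2 * D⁻¹) + 8 * δ ^ 2 := by rw [h2]; ring
      _ ≤ 2 * (K * (ε + η) ^ 2 * (2 * ((i + 1 : ℕ) : ℝ)⁻¹)) + 8 * δ ^ 2 := by gcongr
      _ ≤ _ := by
          have : 0 ≤ K * (ε + η) ^ 2 * ((i + 1 : ℕ) : ℝ)⁻¹ := by positivity
          nlinarith
  obtain ⟨l, rfl⟩ : ∃ l', l = l' + 1 := ⟨l - 1, by omega⟩
  rw [Finset.sum_range_succ, ← Finset.sum_range_reflect]
  simp only [Nat.add_sub_cancel] at hterm ⊢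
  have hharm : ∑ i ∈ Finset.range l, ((i + 1 : ℕ) : ℝ)⁻¹ ≤ 1 + j := by
    have h := harmonic_le_one_add_log l
    simp only [harmonic, Rat.cast_sum, Rat.cast_inv, Rat.cast_natCast] at h
    refine h.trans ?_
    have : Real.log l ≤ j := by
      rcases Nat.eq_zero_or_pos l with rfl | hl1
      · simp
      calc Real.log l ≤ Real.log (2 ^ j) := by
            refine Real.log_le_log (by exact_mod_cast hl1) ?_
            exact_mod_cast (by omega : l ≤ 2 ^ j)
        _ = j * Real.log 2 := Real.log_pow _ _
        _ ≤ j * 1 := by gcongr; linarith [Real.log_two_lt_d9]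
        _ = j := mul_one _
    linarith
  have hlK : (l : ℝ) ≤ 2 ^ j := by exact_mod_cast (by omega : l ≤ 2 ^ j)
  calc _ ≤ ∑ i ∈ Finset.range l, (8 * K * (ε + η) ^ 2 * ((i + 1 : ℕ) : ℝ)⁻¹ + 8 * δ ^ 2) + 1 := by
        gcongr with i hi
        · exact hterm i hi
        · exact measureReal_le_one
    _ = 8 * K * (ε + η) ^ 2 * ∑ i ∈ Finset.range l, ((i + 1 : ℕ) : ℝ)⁻¹ + 8 * l * δ ^ 2 + 1 := by
        rw [Finset.sum_add_distrib, ← Finset.mul_sum]; simp; ring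
    _ ≤ 8 * K * (ε + η) ^ 2 * (1 + j) + 8 * 2 ^ j * δ ^ 2 + 1 := by gcongr
    _ = _ := by rw [hKdef]; push_cast; ring

end IsBrownianMotion

namespace IsBrownianMotion

variable {Ω : Type*} [MeasurableSpace Ω] {P : Measure Ω} [IsProbabilityMeasure P] {W : ℝ → Ω → ℝ}

/-- Many grid points with an almost maximal value are exponentially unlikely. -/
lemma measure_many_nearMax_le (hW : IsBrownianMotion P W) {j β : ℕ} {ε η δ : ℝ}
    (hη : 0 ≤ η) (hε : 0 ≤ ε)
    (hδ : P.real {ω | ∃ i < 2 ^ j, η < |W ((i + 1 : ℕ) / (2 ^ j : ℕ)) ω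
      - W (i / (2 ^ j : ℕ)) ω|} ≤ δ)
    (hβ : 1 + 8 * 2 ^ j * (ε + η) ^ 2 * (1 + j) + 8 * 2 ^ j * δ ^ 2 ≤ β) (n : ℕ) :
    P {ω | ∃ A ⊆ Finset.range (2 ^ j + 1), 2 * β * n ≤ A.card ∧ ∀ k ∈ A,
      ∀ r : ℕ, r ≤ 2 ^ j →
      W (r / (2 ^ j : ℕ)) ω ≤ W (k / (2 ^ j : ℕ)) ω + ε} ≤ ENNReal.ofReal (3 * 2 ^ j / 2 ^ n) := by
  set K := 2 ^ j with hKdef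
  have hK : (0 : ℝ) < K := by positivity
  have hβ1 : (1 : ℝ) ≤ β := le_trans (by linarith [show
    0 ≤ 8 * 2 ^ j * (ε + η) ^ 2 * (1 + j) + 8 * 2 ^ j * δ ^ 2 by positivity]) hβ
  set s : ℝ := (2 * β : ℝ)⁻¹
  have hs0 : 0 ≤ s := by positivity
  have hs2 : s ≤ 2⁻¹ := inv_anti₀ (by norm_num) (by linarith)
  have h01 : ∀ i : ℕ, i ≤ K → (i : ℝ) / K ∈ Set.Icc (0 : ℝ) 1 := fun i hi =>
    ⟨by positivity, div_le_one_of_le₀ (by exact_mod_cast hi) hK.le⟩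
  have key := measure_exists_chain_le (P := P) (s := ENNReal.ofReal s) ENNReal.ofReal_ne_top
    (B := jointMaxSet W K ε) (𝓐 := fun k => incrementSigma W 0 (k / K))
    (𝓑 := fun k => incrementSigma W (k / K) 1) (K := K)
    (fun a b hab => incrementSigma_mono W le_rfl (by gcongr))
    (fun k _ => hW.incrementSigma_le _ _) (fun k _ => hW.incrementSigma_le _ _)
    (fun k hk => hW.indep_incrementSigma le_rfl le_rfl (h01 k hk).2 (h01 k hk).1 le_rfl)
    (fun l hl k hk => measurableSet_jointMaxSet W K ε hk.le (by positivity) le_rfl)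
    (fun l hl k hk => measurableSet_jointMaxSet W K ε hk.le le_rfl (h01 l hl).2)
    (fun l hl => by
      have h := (hW.sum_measure_jointMaxSet_le hl hη hε hδ).trans hβ
      have e (k : ℕ) : P (jointMaxSet W K ε k l) =
          ENNReal.ofReal (P.real (jointMaxSet W K ε k l)) := (ofReal_measureReal (by finiteness)).symm
      simp_rw [e]
      rw [← ENNReal.ofReal_sum_of_nonneg fun _ _ => measureReal_nonneg,
        ← ENNReal.ofReal_mul hs0, ← ENNReal.ofReal_ofNat, ← ENNReal.ofReal_inv_of_pos (by norm_num)]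
      refine ENNReal.ofReal_le_ofReal ?_
      calc s * _ ≤ s * β := by gcongr
        _ = 2⁻¹ := by simp only [s]; field_simp)
    (2 * β * n)
  refine (measure_mono ?_).trans (key.trans ?_)
  · rintro ω ⟨A, hA, hm, h⟩
    refine ⟨A, hA, hm, fun k hk l hl hkl r hkr hrl => ?_⟩
    have hlK : l ≤ K := Nat.lt_succ_iff.1 (Finset.mem_range.1 (hA hl))
    constructor
    · linarith [h k hk r (hrl.trans hlK)]
    · linarith [h l hl r (hrl.trans hlK)]
  · have e1 : (1 + 2 * ENNReal.ofReal s * (K + 1)) = ENNReal.ofReal (1 + 2 * s * (K + 1)) := by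
      rw [ENNReal.ofReal_add one_pos.le (by positivity), ENNReal.ofReal_mul (by positivity),
        ENNReal.ofReal_mul (by positivity), ENNReal.ofReal_add hK.le one_pos.le]
      simp
    have e2 : (1 + ENNReal.ofReal s) ^ (2 * β * n) = ENNReal.ofReal ((1 + s) ^ (2 * β * n)) := by
      rw [ENNReal.ofReal_pow (by positivity), ENNReal.ofReal_add one_pos.le hs0, ENNReal.ofReal_one]
    rw [e1, e2, ← ENNReal.ofReal_div_of_pos (by positivity)]
    refine ENNReal.ofReal_le_ofReal ?_
    have hb : 2 ≤ (1 + s) ^ (2 * β) := by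
      have := one_add_mul_le_pow (a := s) (by linarith) (2 * β)
      refine le_trans ?_ this
      have : ((2 * β : ℕ) : ℝ) * s = 1 := by simp only [s]; push_cast; field_simp
      linarith
    have hK1 : (1 : ℝ) ≤ K := by exact_mod_cast Nat.one_le_two_pow
    have hKc : (K : ℝ) = 2 ^ j := by rw [hKdef]; push_cast; rfl
    rw [pow_mul]
    gcongr
    rw [← hKc]
    nlinarith

end IsBrownianMotion

section Chaining

/-- The admissible size of the increments over dyadic intervals of length `2⁻ⁱ`. -/
def stepBound (ℓ i : ℕ) : ℝ := (ℓ + i) * √(1 / 2) ^ i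

/-- The resulting bound for the oscillation over dyadic intervals of length `2⁻ⁱ`. -/
def oscBound (ℓ i : ℕ) : ℝ := 8 * (ℓ + i) * √(1 / 2) ^ i

lemma stepBound_nonneg (ℓ i : ℕ) : 0 ≤ stepBound ℓ i := by unfold stepBound; positivity

lemma oscBound_nonneg (ℓ i : ℕ) : 0 ≤ oscBound ℓ i := by unfold oscBound; positivity

lemma oscBound_eq (ℓ i : ℕ) : oscBound ℓ i = 8 * stepBound ℓ i := by
  unfold oscBound stepBound; ring

lemma sqrt_half_le : √(1 / 2 : ℝ) ≤ 0.7072 := Real.sqrt_le_iff.2 (by norm_num)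

lemma stepBound_add_oscBound_le {ℓ : ℕ} (hℓ : 5 ≤ ℓ) (i : ℕ) :
    stepBound ℓ (i + 1) + oscBound ℓ (i + 1) ≤ oscBound ℓ i := by
  rw [oscBound_eq, oscBound_eq, stepBound, stepBound, pow_succ]
  have h := sqrt_half_le
  have h0 := Real.sqrt_nonneg (1 / 2 : ℝ)
  have hℓ' : (5 : ℝ) ≤ ℓ := by exact_mod_cast hℓ
  have hi : (0 : ℝ) ≤ i := by positivity
  have key : 9 * ((ℓ : ℝ) + (i + 1 : ℕ)) * √(1 / 2) ≤ 8 * (ℓ + i) := by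
    push_cast
    nlinarith
  have := mul_le_mul_of_nonneg_right key (pow_nonneg h0 i)
  linarith

/-- All dyadic increments of `w` are of the expected order, up to a factor governed by `ℓ`. -/
def RegularPath (ℓ : ℕ) (w : ℝ → ℝ) : Prop :=
  ∀ i k : ℕ, k < 2 ^ i →
    |w ((k + 1 : ℕ) / (2 ^ i : ℕ)) - w (k / (2 ^ i : ℕ))| ≤ stepBound ℓ i

lemma exists_dyadic_approx {t : ℝ} (ht : t ∈ Set.Icc (0 : ℝ) 1) :
    ∃ c : ℕ → ℕ, (∀ i, 1 ≤ c i ∧ c i ≤ 2 ^ i) ∧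
      (∀ i, c (i + 1) = 2 * c i - 1 ∨ c (i + 1) = 2 * c i) ∧
      Tendsto (fun i => (c i : ℝ) / (2 ^ i : ℕ)) atTop (nhds t) := by
  rcases eq_or_lt_of_le ht.1 with rfl | ht0
  · refine ⟨fun _ => 1, fun i => ⟨le_rfl, Nat.one_le_two_pow⟩, fun i => Or.inl rfl, ?_⟩
    have := tendsto_pow_atTop_nhds_zero_of_lt_one (r := (2 : ℝ)⁻¹) (by norm_num) (by norm_num)
    refine this.congr fun i => ?_
    push_cast; rw [inv_pow, one_div]
  refine ⟨fun i => ⌈t * 2 ^ i⌉₊, fun i => ⟨?_, ?_⟩, fun i => ?_, ?_⟩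
  · exact Nat.one_le_iff_ne_zero.2 (Nat.ceil_pos.2 (by positivity)).ne'
  · refine Nat.ceil_le.2 ?_
    push_cast
    exact mul_le_of_le_one_left (by positivity) ht.2
  · have h1 : ⌈t * 2 ^ (i + 1)⌉₊ ≤ 2 * ⌈t * 2 ^ i⌉₊ := by
      refine Nat.ceil_le.2 ?_
      have := Nat.le_ceil (t * 2 ^ i)
      push_cast
      rw [pow_succ]; linarith
    have h2 : 2 * ⌈t * 2 ^ i⌉₊ < ⌈t * 2 ^ (i + 1)⌉₊ + 2 := by
      have h3 := Nat.ceil_lt_add_one (a := t * 2 ^ i) (by positivity)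
      have h4 := Nat.le_ceil (t * 2 ^ (i + 1))
      rw [pow_succ] at h4
      have : (2 * ⌈t * 2 ^ i⌉₊ : ℝ) < ⌈t * (2 ^ i * 2)⌉₊ + 2 := by linarith
      rw [pow_succ]
      exact_mod_cast this
    dsimp only
    omega
  · have h0 := tendsto_pow_atTop_nhds_zero_of_lt_one (r := (2 : ℝ)⁻¹) (by norm_num) (by norm_num)
    refine tendsto_of_tendsto_of_tendsto_of_le_of_le (tendsto_const_nhds (x := t))
      (by simpa using h0.const_add t) (fun i => ?_) (fun i => ?_)
    · simp only
      rw [le_div_iff₀ (by positivity)]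
      push_cast
      exact Nat.le_ceil _
    · simp only
      rw [div_le_iff₀ (by positivity)]
      push_cast
      have h3 := Nat.ceil_lt_add_one (a := t * 2 ^ i) (by positivity)
      rw [add_mul, inv_mul_cancel₀ (by positivity)]
      exact h3.le

lemma RegularPath.exists_dyadic {ℓ : ℕ} (hℓ : 5 ≤ ℓ) {w : ℝ → ℝ} (hw : RegularPath ℓ w)
    (hc : ContinuousOn w (Set.Icc 0 1)) {t : ℝ} (ht : t ∈ Set.Icc (0 : ℝ) 1) :
    ∃ c : ℕ → ℕ, (∀ i, 1 ≤ c i ∧ c i ≤ 2 ^ i) ∧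
      (∀ i, c (i + 1) = 2 * c i - 1 ∨ c (i + 1) = 2 * c i) ∧
      ∀ j, |w t - w (c j / (2 ^ j : ℕ))| ≤ oscBound ℓ j := by
  obtain ⟨c, hc1, hc2, hc3⟩ := exists_dyadic_approx ht
  refine ⟨c, hc1, hc2, fun j => ?_⟩
  set z : ℕ → ℝ := fun i => w (c i / (2 ^ i : ℕ)) with hz
  have hstep : ∀ i, |z (i + 1) - z i| ≤ stepBound ℓ (i + 1) := by
    intro i
    have h1 := hc1 i
    have e : (c i : ℝ) / (2 ^ i : ℕ) = ((2 * c i - 1 + 1 : ℕ) : ℝ) / (2 ^ (i + 1) : ℕ) := by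
      rw [show 2 * c i - 1 + 1 = 2 * c i by omega]
      push_cast
      rw [pow_succ]; field_simp
    simp only [hz]
    rw [e]
    rcases hc2 i with h | h
    · rw [h, abs_sub_comm]
      exact hw (i + 1) (2 * c i - 1) (by rw [pow_succ]; omega)
    · rw [h, show 2 * c i - 1 + 1 = 2 * c i by omega, sub_self, abs_zero]
      exact stepBound_nonneg _ _
  have htel : ∀ n, |z (j + n) - z j| ≤ oscBound ℓ j - oscBound ℓ (j + n) := by
    intro n
    induction n with
    | zero => simp
    | succ n ih =>
      have h1 := hstep (j + n)
      have h2 := stepBound_add_oscBound_le hℓ (j + n)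
      have h3 := abs_sub_le (z (j + n + 1)) (z (j + n)) (z j)
      rw [← add_assoc]
      linarith
  have hmem : ∀ i, (c i : ℝ) / (2 ^ i : ℕ) ∈ Set.Icc (0 : ℝ) 1 := fun i =>
    ⟨by positivity, div_le_one_of_le₀ (by exact_mod_cast (hc1 i).2) (by positivity)⟩
  have hlim : Tendsto z atTop (nhds (w t)) :=
    (hc t ht).tendsto.comp (tendsto_nhdsWithin_iff.2 ⟨hc3, Eventually.of_forall hmem⟩)
  refine le_of_tendsto ((((tendsto_add_atTop_iff_nat j).2 hlim).sub_const (z j)).abs)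
    (Eventually.of_forall fun n => ?_)
  have h1 := htel n
  rw [add_comm n j]
  linarith [oscBound_nonneg ℓ (j + n)]

end Chaining

lemma exp_neg_sq_div_two_le {m : ℕ} (hm : 5 ≤ m) :
    Real.exp (-(m : ℝ) ^ 2 / 2) ≤ (8⁻¹ : ℝ) ^ m := by
  have hm' : (5 : ℝ) ≤ m := by exact_mod_cast hm
  have h8 : (8 : ℝ) ≤ Real.exp (5 / 2) := by
    have h1 := Real.exp_one_gt_d9
    have h2 := Real.add_one_le_exp (1 / 2 : ℝ)
    have : Real.exp (5 / 2) = Real.exp 1 * Real.exp 1 * Real.exp (1 / 2) := by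
      rw [← Real.exp_add, ← Real.exp_add]; norm_num
    rw [this]
    nlinarith [mul_pos (Real.exp_pos 1) (Real.exp_pos 1)]
  calc Real.exp (-(m : ℝ) ^ 2 / 2) ≤ Real.exp (m * (-(5 / 2))) := by
        refine Real.exp_le_exp.2 ?_; nlinarith
    _ = (Real.exp (5 / 2))⁻¹ ^ m := by rw [Real.exp_nat_mul, Real.exp_neg]
    _ ≤ _ := by gcongr

namespace IsBrownianMotion

variable {Ω : Type*} [MeasurableSpace Ω] {P : Measure Ω} {W : ℝ → Ω → ℝ}

lemma measurableSet_regularPath (hW : IsBrownianMotion P W) (ℓ : ℕ) :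
    MeasurableSet {ω | RegularPath ℓ fun t => W t ω} := by
  have : {ω | RegularPath ℓ fun t => W t ω} = ⋂ (i : ℕ) (k : ℕ) (_ : k < 2 ^ i),
      {ω | |W ((k + 1 : ℕ) / (2 ^ i : ℕ)) ω - W (k / (2 ^ i : ℕ)) ω| ≤ stepBound ℓ i} := by
    ext ω; simp [RegularPath]
  rw [this]
  exact MeasurableSet.iInter fun i => MeasurableSet.iInter fun k => MeasurableSet.iInter fun _ =>
    measurableSet_le ((hW.1 _).sub (hW.1 _)).abs measurable_const

variable [IsProbabilityMeasure P]

lemma measure_exists_increment_gt_le (hW : IsBrownianMotion P W) {ℓ : ℕ} (hℓ : 5 ≤ ℓ) (i : ℕ) :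
    P.real {ω | ∃ k < 2 ^ i, stepBound ℓ i < |W ((k + 1 : ℕ) / (2 ^ i : ℕ)) ω
      - W (k / (2 ^ i : ℕ)) ω|} ≤ 2 * (8⁻¹) ^ ℓ * (4⁻¹) ^ i := by
  have hset : {ω | ∃ k < 2 ^ i, stepBound ℓ i < |W ((k + 1 : ℕ) / (2 ^ i : ℕ)) ω
      - W (k / (2 ^ i : ℕ)) ω|} = ⋃ k ∈ Finset.range (2 ^ i),
        {ω | stepBound ℓ i < |W ((k + 1 : ℕ) / (2 ^ i : ℕ)) ω - W (k / (2 ^ i : ℕ)) ω|} := by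
    ext ω; simp
  rw [hset]
  refine (measureReal_biUnion_finset_le _ _).trans ?_
  have hterm : ∀ k ∈ Finset.range (2 ^ i), P.real {ω | stepBound ℓ i <
      |W ((k + 1 : ℕ) / (2 ^ i : ℕ)) ω - W (k / (2 ^ i : ℕ)) ω|} ≤ 2 * (8⁻¹) ^ (ℓ + i) := by
    intro k hk
    have hk' := Finset.mem_range.1 hk
    have h01 : ∀ r : ℕ, r ≤ 2 ^ i → (r : ℝ) / (2 ^ i : ℕ) ∈ Set.Icc (0 : ℝ) 1 := fun r hr =>
      ⟨by positivity, div_le_one_of_le₀ (by exact_mod_cast hr) (by positivity)⟩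
    have hlaw := hW.map_sub (h01 k hk'.le) (h01 (k + 1) hk')
    have hv : |((k + 1 : ℕ) : ℝ) / (2 ^ i : ℕ) - k / (2 ^ i : ℕ)| = (1 / 2) ^ i := by
      rw [← sub_div]; push_cast; rw [add_sub_cancel_left, abs_of_nonneg (by positivity), one_div_pow]
    rw [hv] at hlaw
    have hm : Measurable fun ω => W ((k + 1 : ℕ) / (2 ^ i : ℕ)) ω - W (k / (2 ^ i : ℕ)) ω :=
      (hW.1 _).sub (hW.1 _)
    have hg := gaussianReal_real_compl_Icc_le ((1 / 2 : ℝ) ^ i).toNNReal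
      (x := ((ℓ + i : ℕ) : ℝ)) (by positivity)
    rw [Real.coe_toNNReal _ (by positivity), Real.sqrt_eq_rpow, ← Real.rpow_natCast (1 / 2) i,
      ← Real.rpow_mul (by norm_num), mul_comm (i : ℝ), Real.rpow_mul (by norm_num),
      ← Real.sqrt_eq_rpow, Real.rpow_natCast, Real.rpow_natCast, ← hlaw,
      map_measureReal_apply hm measurableSet_Icc.compl] at hg
    refine (measureReal_mono ?_).trans (hg.trans ?_)
    · intro ω hω
      simp only [Set.mem_preimage, Set.mem_compl_iff, Set.mem_Icc, ← abs_le, not_le]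
      simpa [stepBound] using hω
    · gcongr
      exact exp_neg_sq_div_two_le (by omega)
  refine (Finset.sum_le_sum hterm).trans_eq ?_
  rw [Finset.sum_const, Finset.card_range, nsmul_eq_mul, pow_add]
  push_cast
  have : (4⁻¹ : ℝ) ^ i = 2 ^ i * (8⁻¹) ^ i := by rw [← mul_pow]; norm_num
  rw [this]; ring

lemma measure_not_regularPath_le (hW : IsBrownianMotion P W) {ℓ : ℕ} (hℓ : 5 ≤ ℓ) :
    P {ω | ¬ RegularPath ℓ fun t => W t ω} ≤ ENNReal.ofReal (3 * (8⁻¹) ^ ℓ) := by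
  have hsub : {ω | ¬ RegularPath ℓ fun t => W t ω} ⊆ ⋃ i : ℕ, {ω | ∃ k < 2 ^ i,
      stepBound ℓ i < |W ((k + 1 : ℕ) / (2 ^ i : ℕ)) ω - W (k / (2 ^ i : ℕ)) ω|} := by
    intro ω hω
    simpa [RegularPath] using hω
  have hgeo : HasSum (fun i : ℕ => 2 * (8⁻¹ : ℝ) ^ ℓ * (4⁻¹) ^ i)
      (2 * (8⁻¹) ^ ℓ * (1 - 4⁻¹)⁻¹) :=
    (hasSum_geometric_of_lt_one (by norm_num) (by norm_num)).mul_left _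
  refine (measure_mono hsub).trans ((measure_iUnion_le _).trans ?_)
  calc _ ≤ ∑' i : ℕ, ENNReal.ofReal (2 * (8⁻¹ : ℝ) ^ ℓ * (4⁻¹) ^ i) :=
        ENNReal.tsum_le_tsum fun i => ENNReal.le_ofReal_iff_toReal_le (by finiteness)
          (by positivity) |>.2 (hW.measure_exists_increment_gt_le hℓ i)
    _ = ENNReal.ofReal (2 * (8⁻¹) ^ ℓ * (1 - 4⁻¹)⁻¹) := by
        rw [← ENNReal.ofReal_tsum_of_nonneg (fun i => by positivity) hgeo.summable, hgeo.tsum_eq]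
    _ ≤ _ := by
        refine ENNReal.ofReal_le_ofReal ?_
        have : (0 : ℝ) < (8⁻¹) ^ ℓ := by positivity
        norm_num
        linarith

end IsBrownianMotion

section SearchTree

/-- The evaluation site attached to the node `v = 2 ^ j + r - 1`, `1 ≤ r ≤ 2 ^ j`, of the binary
tree (in heap order), namely `r / 2 ^ j`. -/
def nodeTime (v : ℕ) : ℝ := ((v + 1 - 2 ^ Nat.log 2 v : ℕ) : ℝ) / (2 ^ Nat.log 2 v : ℕ)

lemma nodeTime_mem {v : ℕ} (hv : v ≠ 0) : nodeTime v ∈ Set.Ioc (0 : ℝ) 1 := by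
  have h1 := Nat.pow_log_le_self 2 hv
  have h2 := Nat.lt_pow_succ_log_self one_lt_two v
  rw [pow_succ] at h2
  have hp : 0 < 2 ^ Nat.log 2 v := by positivity
  constructor
  · refine div_pos ?_ (by exact_mod_cast hp)
    exact_mod_cast (by omega : 0 < v + 1 - 2 ^ Nat.log 2 v)
  · refine div_le_one_of_le₀ ?_ (by positivity)
    exact_mod_cast (by omega : v + 1 - 2 ^ Nat.log 2 v ≤ 2 ^ Nat.log 2 v)

lemma log_two_pow_add_sub_one {j r : ℕ} (h1 : 1 ≤ r) (h2 : r ≤ 2 ^ j) :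
    Nat.log 2 (2 ^ j + r - 1) = j :=
  (Nat.log_eq_iff (Or.inr ⟨one_lt_two, by have := Nat.one_le_two_pow (n := j); omega⟩)).2
    ⟨by omega, by rw [pow_succ]; omega⟩

lemma nodeTime_two_pow_add_sub_one {j r : ℕ} (h1 : 1 ≤ r) (h2 : r ≤ 2 ^ j) :
    nodeTime (2 ^ j + r - 1) = (r : ℝ) / (2 ^ j : ℕ) := by
  rw [nodeTime, log_two_pow_add_sub_one h1 h2, show 2 ^ j + r - 1 + 1 - 2 ^ j = r by omega]

/-- The node examined in step `k` of the search, given the values `y` observed before: the smallest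
not yet considered node whose parent carries an almost maximal value, within a tolerance `u j`
depending on the level `j` of the parent; the search ends when it leaves the first `L + 1` levels. -/
def searchNode (L : ℕ) (u : ℕ → ℝ) (y : ℕ → ℝ) : ℕ → ℕ
  | k => sInf {v | 2 ^ (L + 1) ≤ v ∨ (k = 0 ∧ v = 1) ∨
      ((∀ i : Fin k, searchNode L u y i < v) ∧
        ∃ i : Fin k, searchNode L u y i = v / 2 ∧ ∀ i' : Fin k, y i' ≤ y i + u (Nat.log 2 (v / 2)))}
  decreasing_by all_goals exact Fin.isLt _

/-- The nodes eligible in step `k` of the search. -/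
def eligibleNodes (L : ℕ) (u : ℕ → ℝ) (y : ℕ → ℝ) (k : ℕ) : Set ℕ :=
  {v | 2 ^ (L + 1) ≤ v ∨ (k = 0 ∧ v = 1) ∨
    ((∀ i < k, searchNode L u y i < v) ∧
      ∃ i < k, searchNode L u y i = v / 2 ∧ ∀ i' < k, y i' ≤ y i + u (Nat.log 2 (v / 2)))}

variable {L : ℕ} {u : ℕ → ℝ} {y : ℕ → ℝ}

lemma searchNode_eq (L : ℕ) (u y : ℕ → ℝ) (k : ℕ) :
    searchNode L u y k = sInf (eligibleNodes L u y k) := by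
  rw [searchNode]
  simp only [eligibleNodes, Fin.forall_iff, Fin.exists_iff, exists_prop]

lemma eligibleNodes_nonempty (L : ℕ) (u y : ℕ → ℝ) (k : ℕ) : (eligibleNodes L u y k).Nonempty :=
  ⟨2 ^ (L + 1), Or.inl le_rfl⟩

lemma searchNode_mem (L : ℕ) (u y : ℕ → ℝ) (k : ℕ) :
    searchNode L u y k ∈ eligibleNodes L u y k := by
  rw [searchNode_eq]
  exact Nat.sInf_mem (eligibleNodes_nonempty L u y k)

lemma searchNode_le {k v : ℕ} (h : v ∈ eligibleNodes L u y k) : searchNode L u y k ≤ v := by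
  rw [searchNode_eq]
  exact Nat.sInf_le h

lemma searchNode_zero (L : ℕ) (u y : ℕ → ℝ) : searchNode L u y 0 = 1 := by
  have h1 : searchNode L u y 0 ≤ 1 := searchNode_le (Or.inr (Or.inl ⟨rfl, rfl⟩))
  have h2 : 1 < 2 ^ (L + 1) := Nat.one_lt_two_pow (by omega)
  rcases searchNode_mem L u y 0 with h | h | ⟨_, i, hi, _⟩
  · omega
  · exact h.2
  · omega

lemma searchNode_ne_zero (L : ℕ) (u y : ℕ → ℝ) (k : ℕ) : searchNode L u y k ≠ 0 := by
  have h2 : 0 < 2 ^ (L + 1) := by positivity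
  rcases searchNode_mem L u y k with h | h | ⟨h, i, hi, _⟩
  · omega
  · omega
  · have := h i hi; omega

lemma searchNode_congr {y y' : ℕ → ℝ} (k : ℕ) (h : ∀ i < k, y i = y' i) :
    searchNode L u y k = searchNode L u y' k := by
  induction k using Nat.strong_induction_on with
  | _ k ih =>
    have ih' : ∀ i < k, searchNode L u y i = searchNode L u y' i := fun i hi =>
      ih i hi fun j hj => h j (hj.trans hi)
    rw [searchNode_eq, searchNode_eq]
    congr 1
    ext v
    simp only [eligibleNodes, Set.mem_ofPred_eq]
    refine or_congr Iff.rfl (or_congr Iff.rfl (and_congr ?_ ?_))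
    · exact forall₂_congr fun i hi => by rw [ih' i hi]
    · refine exists_congr fun i => and_congr_right fun hi => ?_
      rw [ih' i hi, h i hi]
      exact and_congr_right fun _ => forall₂_congr fun i' hi' => by rw [h i' hi']

lemma measurable_searchNode (L : ℕ) (u : ℕ → ℝ) (k : ℕ) :
    Measurable fun y : ℕ → ℝ => searchNode L u y k := by
  classical
  induction k using Nat.strong_induction_on with
  | _ k ih =>
    have hm : ∀ v, MeasurableSet {y : ℕ → ℝ | v ∈ eligibleNodes L u y k} := by
      intro v
      simp only [eligibleNodes, Set.mem_ofPred_eq, measurableSet_setOfPred]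
      have ha : ∀ i < k, ∀ p : ℕ → Prop, Measurable fun y => p (searchNode L u y i) :=
        fun i hi p => (measurable_of_countable p).comp (ih i hi)
      refine measurable_const.or (measurable_const.or (Measurable.and ?_ ?_))
      · exact Measurable.forall fun i => Measurable.forall fun hi => ha i hi (· < v)
      · refine Measurable.exists fun i => ?_
        by_cases hi : i < k
        · simp only [hi, true_and]
          refine (ha i hi (· = v / 2)).and ?_
          exact Measurable.forall fun i' => Measurable.forall fun _ => measurableSet_setOfPred.1
            (measurableSet_le (measurable_pi_apply _) ((measurable_pi_apply _).add_const _))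
        · simp [hi]
    have : (fun y : ℕ → ℝ => searchNode L u y k) =
        fun y => Nat.find (eligibleNodes_nonempty L u y k) := by
      funext y
      rw [searchNode_eq, Nat.sInf_def (eligibleNodes_nonempty L u y k)]
    rw [this]
    exact measurable_find _ hm

/-- The `k`-th evaluation site of the search, as a function of the `k` preceding values. -/
def searchSite (L : ℕ) (u : ℕ → ℝ) (k : ℕ) (y : Fin k → ℝ) : ℝ :=
  nodeTime (searchNode L u (fun i => if h : i < k then y ⟨i, h⟩ else 0) k)

lemma searchSite_mem (L : ℕ) (u : ℕ → ℝ) (k : ℕ) (y : Fin k → ℝ) :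
    searchSite L u k y ∈ Set.Ioc (0 : ℝ) 1 :=
  nodeTime_mem (searchNode_ne_zero _ _ _ _)

lemma measurable_searchSite (L : ℕ) (u : ℕ → ℝ) (k : ℕ) : Measurable (searchSite L u k) := by
  refine (measurable_of_countable nodeTime).comp ((measurable_searchNode L u k).comp ?_)
  refine measurable_pi_lambda _ fun i => ?_
  by_cases h : i < k
  · simpa [h] using measurable_pi_apply _
  · simp [h]

lemma adaptVals_searchSite {Ω : Type*} (W : ℝ → Ω → ℝ) (L : ℕ) (u : ℕ → ℝ) (ω : Ω) (k : ℕ) :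
    adaptVals W (searchSite L u) ω k =
      W (nodeTime (searchNode L u (adaptVals W (searchSite L u) ω) k)) ω := by
  conv_lhs => rw [adaptVals]
  rw [searchSite]
  congr 2
  exact searchNode_congr k fun i hi => by simp [hi]

variable {w : ℝ → ℝ} {M : ℝ} {c : ℕ → ℕ}

lemma exists_searchNode_eq (hy : ∀ k, y k = w (nodeTime (searchNode L u y k)))
    (hM : ∀ k, y k ≤ M) (hc1 : ∀ i, 1 ≤ c i ∧ c i ≤ 2 ^ i)
    (hc2 : ∀ i, c (i + 1) = 2 * c i - 1 ∨ c (i + 1) = 2 * c i)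
    (hcw : ∀ j ≤ L, M - u j ≤ w (c j / (2 ^ j : ℕ))) {j : ℕ} (hj : j ≤ L) {k : ℕ}
    (hk : 2 ^ j + c j - 1 ≤ searchNode L u y k) :
    ∃ i ≤ k, searchNode L u y i = 2 ^ j + c j - 1 := by
  classical
  induction j generalizing k with
  | zero =>
    refine ⟨0, Nat.zero_le _, ?_⟩
    have := hc1 0
    rw [searchNode_zero, pow_zero] at *
    omega
  | succ j ih =>
    have h1 := hc1 j
    have h2 := hc2 j
    have hp : 2 ^ (j + 1) = 2 * 2 ^ j := by rw [pow_succ, mul_comm]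
    have hex : ∃ k, 2 ^ (j + 1) + c (j + 1) - 1 ≤ searchNode L u y k := ⟨k, hk⟩
    have hk' := Nat.find_spec hex
    have hmin := fun i (hi : i < Nat.find hex) => not_le.1 (Nat.find_min hex hi)
    have hle := Nat.find_min' hex hk
    set k' := Nat.find hex
    obtain ⟨i, hi, hia⟩ := ih (by omega) (k := k') (by omega)
    have hik : i < k' := by
      refine lt_of_le_of_ne hi fun h => ?_
      rw [h] at hia
      omega
    refine ⟨k', hle, le_antisymm (searchNode_le (Or.inr (Or.inr ⟨hmin, i, hik, by omega, ?_⟩))) hk'⟩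
    intro i' _
    rw [show (2 ^ (j + 1) + c (j + 1) - 1) / 2 = 2 ^ j + c j - 1 by omega,
      log_two_pow_add_sub_one h1.1 h1.2, hy i, hia, nodeTime_two_pow_add_sub_one h1.1 h1.2]
    linarith [hcw j (by omega), hM i']

lemma exists_near_max_of_searchNode_lt (hy : ∀ k, y k = w (nodeTime (searchNode L u y k)))
    (hM : ∀ k, y k ≤ M) (hc1 : ∀ i, 1 ≤ c i ∧ c i ≤ 2 ^ i)
    (hc2 : ∀ i, c (i + 1) = 2 * c i - 1 ∨ c (i + 1) = 2 * c i)
    (hcw : ∀ j ≤ L, M - u j ≤ w (c j / (2 ^ j : ℕ))) {k : ℕ} (hk : 0 < k)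
    (hkL : searchNode L u y k < 2 ^ (L + 1)) :
    (∀ i < k, searchNode L u y i < searchNode L u y k) ∧
    ∃ j < L, ∃ r, 1 ≤ r ∧ r ≤ 2 ^ j ∧ searchNode L u y k / 2 = 2 ^ j + r - 1 ∧
      M - 2 * u j ≤ w (r / (2 ^ j : ℕ)) := by
  obtain ⟨hlt, i, hi, hia, hmax⟩ : (∀ i < k, searchNode L u y i < searchNode L u y k) ∧
      ∃ i < k, searchNode L u y i = searchNode L u y k / 2 ∧
        ∀ i' < k, y i' ≤ y i + u (Nat.log 2 (searchNode L u y k / 2)) := by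
    rcases searchNode_mem L u y k with h | h | h
    · omega
    · omega
    · exact h
  refine ⟨hlt, ?_⟩
  have hp0 : searchNode L u y k / 2 ≠ 0 := hia ▸ searchNode_ne_zero _ _ _ _
  set p := searchNode L u y k / 2
  set j := Nat.log 2 p
  have hj1 : 2 ^ j ≤ p := Nat.pow_log_le_self 2 hp0
  have hj2 : p < 2 ^ (j + 1) := Nat.lt_pow_succ_log_self one_lt_two p
  have hjL : j < L := by
    refine (Nat.pow_lt_pow_iff_right one_lt_two).1 (hj1.trans_lt ?_)
    rw [pow_succ] at hkL
    omega
  have hr := pow_succ 2 j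
  refine ⟨j, hjL, p + 1 - 2 ^ j, by omega, by omega, by omega, ?_⟩
  have h1 := hc1 j
  obtain ⟨i'', hi'', ha''⟩ := exists_searchNode_eq hy hM hc1 hc2 hcw hjL.le (k := k) (by omega)
  have hne : i'' < k := by
    refine lt_of_le_of_ne hi'' fun h => ?_
    rw [h] at ha''
    omega
  have h2 := hmax i'' hne
  have h3 := hcw j hjL.le
  rw [hy i'', ha'', nodeTime_two_pow_add_sub_one h1.1 h1.2, hy i, hia,
    show p = 2 ^ j + (p + 1 - 2 ^ j) - 1 by omega,
    nodeTime_two_pow_add_sub_one (by omega) (by omega)] at h2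
  linarith

/-- If few nodes on each level carry almost maximal values, then the search reaches level `L` along
the branch that approximates the location of the maximum. -/
lemma exists_searchValue_ge (hy : ∀ k, y k = w (nodeTime (searchNode L u y k)))
    (hM : ∀ t ∈ Set.Icc (0 : ℝ) 1, w t ≤ M) (hc1 : ∀ i, 1 ≤ c i ∧ c i ≤ 2 ^ i)
    (hc2 : ∀ i, c (i + 1) = 2 * c i - 1 ∨ c (i + 1) = 2 * c i)
    (hcw : ∀ j ≤ L, M - u j ≤ w (c j / (2 ^ j : ℕ))) {m n : ℕ}
    (hm : ∀ j < L, ∀ A ⊆ Finset.range (2 ^ j + 1), (∀ k ∈ A, ∀ r : ℕ, r ≤ 2 ^ j →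
      w (r / (2 ^ j : ℕ)) ≤ w (k / (2 ^ j : ℕ)) + 2 * u j) → A.card ≤ m)
    (hn : 2 * (L * m) + 2 ≤ n) :
    ∃ i < n, M - u L ≤ y i := by
  classical
  have hyM : ∀ k, y k ≤ M := fun k => by
    rw [hy k]
    exact hM _ (Set.Ioc_subset_Icc_self (nodeTime_mem (searchNode_ne_zero _ _ _ _)))
  obtain ⟨k, hk, hkL⟩ : ∃ k < n, 2 ^ (L + 1) ≤ searchNode L u y k := by
    by_contra! hcon
    have hnear := fun k hk (hkn : k < n) =>
      exists_near_max_of_searchNode_lt hy hyM hc1 hc2 hcw (k := k) hk (hcon k hkn)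
    set A : ℕ → Finset ℕ := fun j => (Finset.range (2 ^ j + 1)).filter fun k =>
      ∀ r : ℕ, r ≤ 2 ^ j → w (r / (2 ^ j : ℕ)) ≤ w (k / (2 ^ j : ℕ)) + 2 * u j
    have hA : ∀ j < L, (A j).card ≤ m := fun j hj =>
      hm j hj _ (Finset.filter_subset _ _) fun k hk => (Finset.mem_filter.1 hk).2
    set Q : Finset ℕ := (Finset.range L).biUnion fun j => (A j).image fun r => 2 ^ j + r - 1
    have hQ : Q.card ≤ L * m := by
      refine (Finset.card_biUnion_le_card_mul _ _ m fun j hj => ?_).trans (by simp)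
      exact Finset.card_image_le.trans (hA j (Finset.mem_range.1 hj))
    have hsub : (Finset.Ico 1 n).image (searchNode L u y) ⊆
        Q.image (fun p => 2 * p) ∪ Q.image (fun p => 2 * p + 1) := by
      intro v hv
      obtain ⟨k, hk, rfl⟩ := Finset.mem_image.1 hv
      rw [Finset.mem_Ico] at hk
      obtain ⟨_, j, hj, r, hr1, hr2, hp, hw⟩ := hnear k (by omega) hk.2
      have hQp : searchNode L u y k / 2 ∈ Q := by
        refine Finset.mem_biUnion.2 ⟨j, Finset.mem_range.2 hj, Finset.mem_image.2 ⟨r, ?_, hp.symm⟩⟩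
        refine Finset.mem_filter.2 ⟨Finset.mem_range.2 (by omega), fun r' hr' => ?_⟩
        have := hM ((r' : ℝ) / (2 ^ j : ℕ))
          ⟨by positivity, div_le_one_of_le₀ (by exact_mod_cast hr') (by positivity)⟩
        linarith
      rcases Nat.even_or_odd' (searchNode L u y k) with ⟨b, hb | hb⟩
      · refine Finset.mem_union_left _ (Finset.mem_image.2 ⟨_, hQp, by omega⟩)
      · refine Finset.mem_union_right _ (Finset.mem_image.2 ⟨_, hQp, by omega⟩)
    have hinj : Set.InjOn (searchNode L u y) (Finset.Ico 1 n : Finset ℕ) := by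
      intro a ha b hb hab
      simp only [Finset.coe_Ico, Set.mem_Ico] at ha hb
      rcases lt_trichotomy a b with h | h | h
      · exact absurd hab ((hnear b (by omega) hb.2).1 a h).ne
      · exact h
      · exact absurd hab.symm ((hnear a (by omega) ha.2).1 b h).ne
    have h1 := Finset.card_le_card hsub
    rw [Finset.card_image_of_injOn hinj, Nat.card_Ico] at h1
    have h2 := Finset.card_union_le (Q.image (fun p => 2 * p)) (Q.image (fun p => 2 * p + 1))
    have h3 := Finset.card_image_le (s := Q) (f := fun p => 2 * p)
    have h4 := Finset.card_image_le (s := Q) (f := fun p => 2 * p + 1)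
    omega
  have hL := hc1 L
  obtain ⟨i, hi, hia⟩ := exists_searchNode_eq hy hyM hc1 hc2 hcw le_rfl (k := k)
    (by rw [pow_succ] at hkL; omega)
  refine ⟨i, by omega, ?_⟩
  rw [hy i, hia, nodeTime_two_pow_add_sub_one hL.1 hL.2]
  exact hcw L le_rfl

end SearchTree

section Supremum

variable {Ω : Type*} {W : ℝ → Ω → ℝ} {ω : Ω}

lemma exists_supBM_eq (hc : ContinuousOn (fun t => W t ω) (Set.Icc 0 1)) :
    ∃ t ∈ Set.Icc (0 : ℝ) 1, supBM W ω = W t ω ∧ ∀ s ∈ Set.Icc (0 : ℝ) 1, W s ω ≤ W t ω := by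
  obtain ⟨t, ht, hmax⟩ := isCompact_Icc.exists_isMaxOn
    (Set.nonempty_Icc.2 (zero_le_one (α := ℝ))) hc
  refine ⟨t, ht, IsGreatest.csSup_eq ⟨⟨t, ht, rfl⟩, ?_⟩, fun s hs => hmax hs⟩
  rintro x ⟨s, hs, rfl⟩
  exact hmax hs

lemma RegularPath.supBM_sub_le {ℓ : ℕ} (hℓ : 5 ≤ ℓ) (hr : RegularPath ℓ fun t => W t ω)
    (hc : ContinuousOn (fun t => W t ω) (Set.Icc 0 1)) : supBM W ω - W 1 ω ≤ 8 * ℓ := by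
  obtain ⟨t, ht, hS, -⟩ := exists_supBM_eq hc
  obtain ⟨c, hc1, -, hc3⟩ := hr.exists_dyadic hℓ hc ht
  have h0 := hc1 0
  have h1 := hc3 0
  rw [pow_zero] at h0 h1
  rw [show c 0 = 1 by omega, Nat.cast_one, div_one, oscBound, pow_zero, Nat.cast_zero, add_zero,
    mul_one] at h1
  rw [hS]
  exact (le_abs_self _).trans h1

/-- The largest of the first `n` values of an algorithm starting with the evaluation site `1`
underestimates the supremum, but not by more than the last value of the path does. -/
lemma abs_supBM_sub_sSup {y : ℕ → ℝ} {n : ℕ} (hn : 0 < n)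
    (hc : ContinuousOn (fun t => W t ω) (Set.Icc 0 1)) (hy0 : y 0 = W 1 ω)
    (hy : ∀ k, ∃ t ∈ Set.Icc (0 : ℝ) 1, y k = W t ω) :
    |supBM W ω - sSup {x : ℝ | ∃ k < n, x = y k}| ≤ supBM W ω - W 1 ω ∧
      ∀ k < n, |supBM W ω - sSup {x : ℝ | ∃ k < n, x = y k}| ≤ supBM W ω - y k := by
  obtain ⟨t, -, hS, hmax⟩ := exists_supBM_eq hc
  have hle : ∀ k, y k ≤ supBM W ω := fun k => by
    obtain ⟨s, hs, h⟩ := hy k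
    rw [h, hS]
    exact hmax s hs
  have hub : ∀ x ∈ {x : ℝ | ∃ k < n, x = y k}, x ≤ supBM W ω := by
    rintro x ⟨k, -, rfl⟩
    exact hle k
  have h1 : sSup {x : ℝ | ∃ k < n, x = y k} ≤ supBM W ω := csSup_le ⟨y 0, 0, hn, rfl⟩ hub
  have h2 : ∀ k < n, |supBM W ω - sSup {x : ℝ | ∃ k < n, x = y k}| ≤ supBM W ω - y k := by
    intro k hk
    rw [abs_of_nonneg (sub_nonneg.2 h1)]
    exact sub_le_sub_left (le_csSup ⟨_, hub⟩ ⟨k, hk, rfl⟩) _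
  exact ⟨hy0 ▸ h2 0 hn, h2⟩

end Supremum

namespace IsBrownianMotion

variable {Ω : Type*} [MeasurableSpace Ω] {P : Measure Ω} [IsProbabilityMeasure P] {W : ℝ → Ω → ℝ}

open scoped ENNReal

lemma tsum_measure_not_regularPath_le (hW : IsBrownianMotion P W) {ℓ : ℕ} (hℓ : 5 ≤ ℓ) :
    ∑' i : ℕ, ENNReal.ofReal (8 * (ℓ + i + 1)) * P {ω | ¬ RegularPath (ℓ + i) fun t => W t ω} ≤
      ENNReal.ofReal (32 * (4⁻¹) ^ ℓ) := by
  have hgeo : HasSum (fun i : ℕ => 24 * (4⁻¹ : ℝ) ^ ℓ * (4⁻¹) ^ i)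
      (24 * (4⁻¹) ^ ℓ * (1 - 4⁻¹)⁻¹) :=
    (hasSum_geometric_of_lt_one (by norm_num) (by norm_num)).mul_left _
  calc _ ≤ ∑' i : ℕ, ENNReal.ofReal (24 * (4⁻¹ : ℝ) ^ ℓ * (4⁻¹) ^ i) := by
        refine ENNReal.tsum_le_tsum fun i => ?_
        refine (mul_le_mul_right (hW.measure_not_regularPath_le (by omega)) _).trans ?_
        rw [← ENNReal.ofReal_mul (by positivity)]
        refine ENNReal.ofReal_le_ofReal ?_
        have h2 : ((ℓ : ℝ) + i + 1) ≤ 2 ^ (ℓ + i) := by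
          exact_mod_cast Nat.lt_two_pow_self (n := ℓ + i)
        calc 8 * ((ℓ : ℝ) + i + 1) * (3 * (8⁻¹) ^ (ℓ + i))
            ≤ 8 * 2 ^ (ℓ + i) * (3 * (8⁻¹) ^ (ℓ + i)) := by gcongr
          _ = 24 * (2 * 8⁻¹) ^ (ℓ + i) := by rw [mul_pow]; ring
          _ = _ := by rw [pow_add]; norm_num; ring
    _ = ENNReal.ofReal (24 * (4⁻¹) ^ ℓ * (1 - 4⁻¹)⁻¹) := by
        rw [← ENNReal.ofReal_tsum_of_nonneg (fun i => by positivity) hgeo.summable, hgeo.tsum_eq]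
    _ = _ := by congr 1; norm_num; ring

/-- A bound for the mean of an error that is small outside of an exceptional event. -/
lemma integral_le_of_le_on_compl (hW : IsBrownianMotion P W) {ℓ : ℕ} (hℓ : 5 ≤ ℓ) {f : Ω → ℝ}
    (hf0 : ∀ ω, 0 ≤ f ω) (hf : ∀ ω, f ω ≤ supBM W ω - W 1 ω) {a p : ℝ} (ha : 0 ≤ a) (hp : 0 ≤ p)
    {B : Set Ω} (hB : P B ≤ ENNReal.ofReal p) (hfB : ∀ ω ∉ B, f ω ≤ a) :
    ∫ ω, f ω ∂P ≤ a + 32 * (4⁻¹) ^ ℓ + 8 * ℓ * p := by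
  set N : ℕ → Set Ω := fun i => {ω | ¬ RegularPath (ℓ + i) fun t => W t ω}
  have hN : ∀ i, MeasurableSet (N i) := fun i => (hW.measurableSet_regularPath _).compl
  set g : Ω → ℝ≥0∞ := fun ω =>
    ∑' i : ℕ, (N i).indicator (fun _ => ENNReal.ofReal (8 * (ℓ + i + 1))) ω
  have hgm : ∀ i : ℕ, Measurable ((N i).indicator fun _ : Ω => ENNReal.ofReal (8 * (ℓ + i + 1))) :=
    fun i => measurable_const.indicator (hN i)
  have hg : Measurable g := Measurable.tsum hgm
  have hpt : ∀ ω, ENNReal.ofReal ‖f ω‖ ≤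
      (ENNReal.ofReal a + g ω) + B.indicator (fun _ => ENNReal.ofReal (8 * ℓ)) ω := by
    intro ω
    rw [Real.norm_of_nonneg (hf0 ω)]
    by_cases hωB : ω ∈ B
    · by_cases hex : ∃ i, ω ∉ N i
      · classical
        have hreg : RegularPath (ℓ + Nat.find hex) fun t => W t ω := not_not.1 (Nat.find_spec hex)
        have hle := (hf ω).trans (hreg.supBM_sub_le (by omega) (hW.2.2.1 ω))
        rcases Nat.eq_zero_or_eq_succ_pred (Nat.find hex) with h | h
        · rw [h, add_zero] at hle
          rw [Set.indicator_of_mem hωB]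
          exact (ENNReal.ofReal_le_ofReal hle).trans le_add_self
        · have hmem : ω ∈ N (Nat.find hex).pred :=
            not_not.1 (Nat.find_min hex (by omega))
          refine le_trans ?_ (le_self_add.trans' le_add_self)
          refine le_trans ?_ (ENNReal.le_tsum (Nat.find hex).pred)
          rw [Set.indicator_of_mem hmem]
          refine ENNReal.ofReal_le_ofReal (hle.trans ?_)
          conv_lhs => rw [h]
          push_cast
          linarith
      · push Not at hex
        have : g ω = ∞ := by
          refine top_unique ?_
          calc (∞ : ℝ≥0∞) = ∑' _ : ℕ, 1 := (ENNReal.tsum_const_eq_top_of_ne_zero one_ne_zero).symm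
            _ ≤ g ω := ENNReal.tsum_le_tsum fun i => by
              rw [Set.indicator_of_mem (hex i), ← ENNReal.ofReal_one]
              exact ENNReal.ofReal_le_ofReal (by
                linarith [show (0 : ℝ) ≤ ℓ by positivity, show (0 : ℝ) ≤ i by positivity])
        simp [this]
    · exact (ENNReal.ofReal_le_ofReal (hfB ω hωB)).trans (le_self_add.trans le_self_add)
  have hlint : ∫⁻ ω, ENNReal.ofReal ‖f ω‖ ∂P ≤
      ENNReal.ofReal (a + 32 * (4⁻¹) ^ ℓ + 8 * ℓ * p) := by
    refine (lintegral_mono hpt).trans ?_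
    rw [lintegral_add_left (hg.const_add _), lintegral_add_left measurable_const,
      lintegral_tsum fun i => (hgm i).aemeasurable,
      ENNReal.ofReal_add (by positivity) (by positivity), ENNReal.ofReal_add ha (by positivity),
      ENNReal.ofReal_mul (by positivity : (0 : ℝ) ≤ 8 * ℓ)]
    gcongr
    · simp
    · simp_rw [fun i : ℕ => lintegral_indicator_const (μ := P) (hN i)
        (ENNReal.ofReal (8 * (ℓ + i + 1)))]
      exact hW.tsum_measure_not_regularPath_le hℓ
    · exact (lintegral_indicator_const_le _ _).trans (by gcongr)
  calc ∫ ω, f ω ∂P ≤ ‖∫ ω, f ω ∂P‖ := le_abs_self _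
    _ ≤ (∫⁻ ω, ENNReal.ofReal ‖f ω‖ ∂P).toReal := norm_integral_le_lintegral_norm f
    _ ≤ _ := ENNReal.toReal_le_of_le_ofReal (by positivity) hlint

/-- The event that at level `j` there are exceedingly many nodes with an almost maximal value. -/
lemma measure_crowded_le (hW : IsBrownianMotion P W) {ℓ j : ℕ} (hℓ : 5 ≤ ℓ) (hj : j < ℓ) (n : ℕ) :
    P {ω | ∃ A ⊆ Finset.range (2 ^ j + 1), 2 * (9250 * ℓ ^ 3) * n ≤ A.card ∧ ∀ k ∈ A,
      ∀ r : ℕ, r ≤ 2 ^ j →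
        W (r / (2 ^ j : ℕ)) ω ≤ W (k / (2 ^ j : ℕ)) ω + 2 * oscBound ℓ j} ≤
      ENNReal.ofReal (3 * 2 ^ j / 2 ^ n) := by
  refine hW.measure_many_nearMax_le (stepBound_nonneg ℓ j)
    (mul_nonneg zero_le_two (oscBound_nonneg ℓ j)) (hW.measure_exists_increment_gt_le hℓ j) ?_ n
  have hq : (√(1 / 2 : ℝ) ^ j) ^ 2 = (2 ^ j)⁻¹ := by
    rw [← pow_mul, mul_comm, pow_mul, Real.sq_sqrt (by norm_num), one_div, inv_pow]
  have h1 : 2 ^ j * (2 * oscBound ℓ j + stepBound ℓ j) ^ 2 = 289 * ((ℓ : ℝ) + j) ^ 2 := by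
    rw [oscBound_eq, stepBound]
    calc _ = 289 * ((ℓ : ℝ) + j) ^ 2 * (2 ^ j * (√(1 / 2 : ℝ) ^ j) ^ 2) := by ring
      _ = _ := by rw [hq, mul_inv_cancel₀ (by positivity), mul_one]
  have h2 : 2 ^ j * (2 * (8⁻¹) ^ ℓ * (4⁻¹) ^ j : ℝ) ^ 2 ≤ 8⁻¹ := by
    have e : 2 ^ j * (2 * (8⁻¹) ^ ℓ * (4⁻¹) ^ j : ℝ) ^ 2 = 4 * ((8⁻¹) ^ ℓ) ^ 2 * (8⁻¹) ^ j := by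
      rw [mul_pow, mul_pow, ← pow_mul (4⁻¹ : ℝ), mul_comm j, pow_mul (4⁻¹ : ℝ),
        show (8⁻¹ : ℝ) = 2 * (4⁻¹) ^ 2 by norm_num, mul_pow 2 _ j]
      ring
    rw [e]
    have h3 : (8⁻¹ : ℝ) ^ ℓ ≤ 8⁻¹ ^ 1 := pow_le_pow_of_le_one (by norm_num) (by norm_num) (by omega)
    have h4 : (8⁻¹ : ℝ) ^ j ≤ 1 := pow_le_one₀ (by norm_num) (by norm_num)
    calc 4 * ((8⁻¹ : ℝ) ^ ℓ) ^ 2 * (8⁻¹) ^ j ≤ 4 * ((8⁻¹ : ℝ) ^ 1) ^ 2 * 1 := by gcongr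
      _ ≤ _ := by norm_num
  have hℓ' : (5 : ℝ) ≤ ℓ := by exact_mod_cast hℓ
  have hj' : (j : ℝ) + 1 ≤ ℓ := by exact_mod_cast hj
  have hj0 : (0 : ℝ) ≤ j := by positivity
  have h5 : ((ℓ : ℝ) + j) ^ 2 * (1 + j) ≤ (2 * ℓ) ^ 2 * ℓ := by gcongr <;> linarith
  have h6 : (1 : ℝ) ≤ (ℓ : ℝ) ^ 3 := one_le_pow₀ (by linarith)
  push_cast
  calc _ = 1 + 8 * (2 ^ j * (2 * oscBound ℓ j + stepBound ℓ j) ^ 2) * (1 + j)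
        + 8 * (2 ^ j * (2 * (8⁻¹) ^ ℓ * (4⁻¹) ^ j : ℝ) ^ 2) := by ring
    _ ≤ 1 + 8 * (289 * ((ℓ : ℝ) + j) ^ 2) * (1 + j) + 8 * 8⁻¹ := by rw [h1]; gcongr
    _ = 2 + 2312 * (((ℓ : ℝ) + j) ^ 2 * (1 + j)) := by ring
    _ ≤ 2 + 2312 * ((2 * ℓ) ^ 2 * ℓ) := by gcongr
    _ ≤ 9250 * (ℓ : ℝ) ^ 3 := by linarith [show ((2 * ℓ) ^ 2 * ℓ : ℝ) = 4 * ℓ ^ 3 by ring]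

lemma searchBudget_le (L : ℕ) :
    2 * (L * (2 * (9250 * (L + 5) ^ 3) * (4 * L))) + 2 ≤ 148000 * (L + 5) ^ 5 := by
  generalize hℓ : L + 5 = ℓ
  have h1 : L * (2 * (9250 * ℓ ^ 3) * (4 * L)) = 74000 * (L ^ 2 * ℓ ^ 3) := by ring
  have h2 : L ^ 2 + 1 ≤ ℓ ^ 2 := by nlinarith
  have h3 : (L ^ 2 + 1) * ℓ ^ 3 ≤ ℓ ^ 5 := (Nat.mul_le_mul_right _ h2).trans_eq (by ring)
  have h4 : 1 ≤ ℓ ^ 3 := Nat.one_le_pow _ _ (by omega)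
  rw [h1]
  linarith

/-- The mean error of the search with `L` levels and `n` evaluations. -/
lemma integral_searchError_le (hW : IsBrownianMotion P W) {L n : ℕ} (hn : 0 < n)
    (hL : L = 0 ∨ 148000 * (L + 5) ^ 5 ≤ n) :
    ∫ ω, |supBM W ω - sSup {x : ℝ | ∃ k < n,
        x = adaptVals W (searchSite L (oscBound (L + 5))) ω k}| ∂P ≤
      100 * (L + 5) ^ 2 * √(1 / 2) ^ L := by
  set y : Ω → ℕ → ℝ := adaptVals W (searchSite L (oscBound (L + 5)))
  have hy : ∀ ω k, y ω k = W (nodeTime (searchNode L (oscBound (L + 5)) (y ω) k)) ω := fun ω k =>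
    adaptVals_searchSite W L _ ω k
  have herr := fun ω => abs_supBM_sub_sSup (y := y ω) hn (hW.2.2.1 ω)
    (by rw [hy, searchNode_zero]; simp [nodeTime])
    (fun k => ⟨_, Set.Ioc_subset_Icc_self (nodeTime_mem (searchNode_ne_zero _ _ _ _)), hy ω k⟩)
  rcases hL with rfl | hL
  · refine (hW.integral_le_of_le_on_compl le_rfl (fun ω => abs_nonneg _) (fun ω => (herr ω).1)
      le_rfl zero_le_one (B := Set.univ) (by simp) (by simp)).trans ?_
    norm_num
  set ℓ := L + 5
  set C : ℕ → Set Ω := fun j => {ω | ∃ A ⊆ Finset.range (2 ^ j + 1),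
    2 * (9250 * ℓ ^ 3) * (4 * L) ≤ A.card ∧ ∀ k ∈ A, ∀ r : ℕ, r ≤ 2 ^ j →
      W (r / (2 ^ j : ℕ)) ω ≤ W (k / (2 ^ j : ℕ)) ω + 2 * oscBound ℓ j}
  set B : Set Ω := {ω | ¬ RegularPath ℓ fun t => W t ω} ∪ ⋃ j ∈ Finset.range L, C j
  have hℓ : 5 ≤ ℓ := by omega
  have hPC : ∀ j ∈ Finset.range L, P (C j) ≤ ENNReal.ofReal (3 * (8⁻¹) ^ L) := by
    intro j hj
    have hj' := Finset.mem_range.1 hj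
    refine (hW.measure_crowded_le hℓ (by omega) (4 * L)).trans (ENNReal.ofReal_le_ofReal ?_)
    rw [div_le_iff₀ (by positivity)]
    calc (3 : ℝ) * 2 ^ j ≤ 3 * 2 ^ L := by gcongr; norm_num
      _ = _ := by rw [pow_mul, mul_assoc, ← mul_pow]; norm_num
  have hPB : P B ≤ ENNReal.ofReal (3 * (8⁻¹) ^ ℓ + L * (3 * (8⁻¹) ^ L)) := by
    refine (measure_union_le _ _).trans ?_
    rw [ENNReal.ofReal_add (by positivity) (by positivity)]
    refine add_le_add (hW.measure_not_regularPath_le hℓ) ?_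
    refine (measure_biUnion_finset_le _ _).trans ((Finset.sum_le_sum hPC).trans_eq ?_)
    rw [Finset.sum_const, Finset.card_range, nsmul_eq_mul, ENNReal.ofReal_mul (Nat.cast_nonneg L),
      ENNReal.ofReal_natCast]
  have hgood : ∀ ω ∉ B, |supBM W ω - sSup {x : ℝ | ∃ k < n, x = y ω k}| ≤ oscBound ℓ L := by
    intro ω hω
    simp only [B, Set.mem_union, not_or, Set.mem_ofPred_eq, not_not, Set.mem_iUnion, not_exists,
      Finset.mem_range] at hω
    obtain ⟨t, ht, hS, hmax⟩ := exists_supBM_eq (hW.2.2.1 ω)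
    obtain ⟨c, hc1, hc2, hc3⟩ := hω.1.exists_dyadic hℓ (hW.2.2.1 ω) ht
    obtain ⟨i, hi, h⟩ := exists_searchValue_ge (w := fun t => W t ω) (m := 2 * (9250 * ℓ ^ 3) * (4 * L))
      (n := n) (hy ω) hmax hc1 hc2
      (fun j _ => by linarith [le_abs_self (W t ω - W (c j / (2 ^ j : ℕ)) ω), hc3 j])
      (fun j hj A hA hmem => by
        by_contra! hcon
        exact hω.2 j hj ⟨A, hA, hcon.le, hmem⟩)
      ((searchBudget_le L).trans hL)
    have := (herr ω).2 i hi
    rw [hS] at this ⊢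
    linarith
  refine (hW.integral_le_of_le_on_compl hℓ (fun ω => abs_nonneg _) (fun ω => (herr ω).1)
    (oscBound_nonneg ℓ L) (by positivity) hPB hgood).trans ?_
  have hq : (8⁻¹ : ℝ) ≤ √(1 / 2) := Real.le_sqrt_of_sq_le (by norm_num)
  have hq4 : (4⁻¹ : ℝ) ≤ √(1 / 2) := Real.le_sqrt_of_sq_le (by norm_num)
  set q : ℝ := √(1 / 2) ^ L with hqdef
  have h8 : (8⁻¹ : ℝ) ^ L ≤ q := pow_le_pow_left₀ (by norm_num) hq L
  have h8' : (8⁻¹ : ℝ) ^ ℓ ≤ q :=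
    (pow_le_pow_of_le_one (by norm_num) (by norm_num) (by omega)).trans h8
  have h4 : (4⁻¹ : ℝ) ^ ℓ ≤ q :=
    (pow_le_pow_of_le_one (by norm_num) (by norm_num) (by omega : L ≤ ℓ)).trans
      (pow_le_pow_left₀ (by norm_num) hq4 L)
  have hq0 : 0 ≤ q := by positivity
  have hℓc : (ℓ : ℝ) = L + 5 := by simp [ℓ]
  have hL0 : (0 : ℝ) ≤ L := by positivity
  calc oscBound ℓ L + 32 * (4⁻¹) ^ ℓ + 8 * ℓ * (3 * (8⁻¹) ^ ℓ + L * (3 * (8⁻¹) ^ L))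
      ≤ 8 * (ℓ + L) * q + 32 * q + 8 * ℓ * (3 * q + L * (3 * q)) := by
        rw [oscBound, ← hqdef]; gcongr
    _ = (8 * (ℓ + L) + 32 + 24 * ℓ * (1 + L)) * q := by ring
    _ ≤ (100 * (L + 5) ^ 2) * q := by
        rw [hℓc]; gcongr; nlinarith
    _ = _ := by ring

end IsBrownianMotion

lemma exists_forall_mul_rpow_le (ρ : ℝ) :
    ∃ c > (0 : ℝ), ∀ L : ℕ, 100 * ((L : ℝ) + 5) ^ 2 * √(1 / 2) ^ L *
      (148000 * ((L : ℝ) + 6) ^ 5) ^ ρ ≤ c := by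
  obtain ⟨N, hN⟩ := exists_nat_ge ρ
  have hq1 : |√(1 / 2 : ℝ)| < 1 := by
    rw [abs_of_nonneg (Real.sqrt_nonneg _)]; linarith [sqrt_half_le]
  have hlim := tendsto_pow_const_mul_const_pow_of_abs_lt_one (2 + 5 * N) hq1
  obtain ⟨b, hb⟩ := hlim.bddAbove_range
  set q : ℝ := √(1 / 2) with hq
  have hq0 : 0 < q := Real.sqrt_pos.2 (by norm_num)
  refine ⟨100 * 148000 ^ N * (|b| + 1) / q ^ 6, by positivity, fun L => ?_⟩
  have h1 := hb (Set.mem_range_self (L + 6))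
  push_cast at h1
  have hbase : (1 : ℝ) ≤ 148000 * ((L : ℝ) + 6) ^ 5 := by
    have : (1 : ℝ) ≤ ((L : ℝ) + 6) ^ 5 := one_le_pow₀ (by
      linarith [show (0 : ℝ) ≤ L by positivity])
    linarith
  rw [le_div_iff₀ (by positivity)]
  calc _ ≤ 100 * ((L : ℝ) + 6) ^ 2 * q ^ L * (148000 * ((L : ℝ) + 6) ^ 5) ^ (N : ℝ) * q ^ 6 := by
        gcongr; norm_num
    _ = 100 * 148000 ^ N * (((L : ℝ) + 6) ^ (2 + 5 * N) * q ^ (L + 6)) := by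
        rw [Real.rpow_natCast, mul_pow, ← pow_mul, pow_add, pow_add]; ring
    _ ≤ 100 * 148000 ^ N * (|b| + 1) := by
        gcongr
        linarith [le_abs_self b]

/-- The number of levels that can be searched with `n` evaluations. -/
def searchDepth (n : ℕ) : ℕ := Nat.findGreatest (fun L => 148000 * (L + 5) ^ 5 ≤ n) n

lemma searchDepth_spec (n : ℕ) :
    searchDepth n = 0 ∨ 148000 * (searchDepth n + 5) ^ 5 ≤ n := by
  rcases eq_or_ne (searchDepth n) 0 with h | h
  · exact Or.inl h
  · exact Or.inr (Nat.findGreatest_of_ne_zero (P := fun L => 148000 * (L + 5) ^ 5 ≤ n) rfl h)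

lemma lt_searchDepth_add (n : ℕ) : n < 148000 * (searchDepth n + 6) ^ 5 := by
  rcases le_or_gt (searchDepth n + 1) n with h | h
  · exact not_le.1 (Nat.findGreatest_is_greatest (P := fun L => 148000 * (L + 5) ^ 5 ≤ n)
      (Nat.lt_succ_self _) h)
  · have := Nat.le_self_pow (n := 5) (by norm_num) (searchDepth n + 6)
    omega

/-- There is a sequence of adaptive algorithms `A_n^ad`, each given by a first
evaluation site in `(0,1]` and measurable site maps into `(0,1]`, evaluating `W`
sequentially and outputting the maximum of the `n` observed values, such that for
every `ρ > 0` there is `c > 0` with `E(|S(W) − A_n^ad(W)|) ≤ c · n^{−ρ}` for all `n`. -/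
theorem stmt5 {Ω : Type*} [MeasurableSpace Ω] (P : Measure Ω) [IsProbabilityMeasure P]
    (W : ℝ → Ω → ℝ) (hW : IsBrownianMotion P W) :
    ∃ χ : ℕ → (k : ℕ) → (Fin k → ℝ) → ℝ,
      (∀ n k, Measurable (χ n k)) ∧
      (∀ n k y, χ n k y ∈ Set.Ioc (0 : ℝ) 1) ∧
      ∀ ρ > (0 : ℝ), ∃ c > (0 : ℝ), ∀ n : ℕ, 0 < n →
        ∫ ω, |supBM W ω - sSup {x : ℝ | ∃ k < n, x = adaptVals W (χ n) ω k}| ∂P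
          ≤ c * (n : ℝ) ^ (-ρ) := by
  refine ⟨fun n => searchSite (searchDepth n) (oscBound (searchDepth n + 5)),
    fun n k => measurable_searchSite _ _ k, fun n k y => searchSite_mem _ _ k y, fun ρ hρ => ?_⟩
  obtain ⟨c, hc0, hc⟩ := exists_forall_mul_rpow_le ρ
  refine ⟨c, hc0, fun n hn => (hW.integral_searchError_le hn (searchDepth_spec n)).trans ?_⟩
  rw [Real.rpow_neg (by positivity), ← div_eq_mul_inv, le_div_iff₀ (by positivity)]
  refine le_trans ?_ (hc (searchDepth n))
  gcongr
  exact_mod_cast (lt_searchDepth_add n).le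
end
end

section
/- Let B be a standard Brownian bridge on [0,1]. Then for every x > 0, P( sup_{0≤t≤1} |B(t)| ≤ x ) = 1 − 2·Σ_{k=1}^{∞} (−1)^{k+1} e^{−2 k² x²}. -/
open MeasureTheory ProbabilityTheory Filter Finset

noncomputable section

/-- A standard Brownian bridge on `[0,1]`: `B t = W t − t · W 1` for a standard
Brownian motion `W`. -/
def IsBrownianBridge {Ω : Type*} [MeasurableSpace Ω] (P : Measure Ω)
    (B : ℝ → Ω → ℝ) : Prop :=
  ∃ W : ℝ → Ω → ℝ, IsBrownianMotion P W ∧ ∀ t ω, B t ω = W t ω - t * W 1 ω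

section

variable {Ω : Type*} [MeasurableSpace Ω] {P : Measure Ω}

lemma IsBrownianMotion.memLp_s14 {W : ℝ → Ω → ℝ} (hW : IsBrownianMotion P W) {t : ℝ}
    (ht : t ∈ Set.Icc (0 : ℝ) 1) : MemLp (W t) 2 P := by
  obtain ⟨v, hv⟩ := hW.2.2.2.1 1 (fun _ => 1) (fun _ => t) (fun _ => ht)
  simp only [Finset.univ_unique, one_mul, Finset.sum_const, Finset.card_singleton, one_smul] at hv
  have := memLp_id_gaussianReal' (μ := 0) (v := v) 2 (by simp)
  rw [← hv] at this
  exact (memLp_map_measure_iff aestronglyMeasurable_id (hW.1 t).aemeasurable).1 this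

lemma IsBrownianMotion.integral_exp {W : ℝ → Ω → ℝ} (hW : IsBrownianMotion P W) {n : ℕ}
    (c t : Fin n → ℝ) (ht : ∀ i, t i ∈ Set.Icc (0 : ℝ) 1) :
    Integrable (fun ω => Real.exp (∑ i, c i * W (t i) ω)) P ∧
      ∫ ω, Real.exp (∑ i, c i * W (t i) ω) ∂P
        = Real.exp ((∑ i, ∑ j, c i * c j * min (t i) (t j)) / 2) := by
  obtain ⟨v, hv⟩ := hW.2.2.2.1 n c t ht
  have hm : Measurable (fun ω => ∑ i, c i * W (t i) ω) :=
    Finset.measurable_sum _ fun i _ => (hW.1 (t i)).const_mul _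
  have hvar : (v : ℝ) = ∑ i, ∑ j, c i * c j * min (t i) (t j) := by
    have h1 : ∫ y, y ^ 2 ∂(gaussianReal 0 v) = v := by
      have h := variance_fun_id_gaussianReal (μ := 0) (v := v)
      rwa [variance_of_integral_eq_zero aemeasurable_id' (by simp)] at h
    rw [← h1, ← hv, integral_map hm.aemeasurable (by fun_prop)]
    have hI : ∀ i j, Integrable (fun ω => c i * c j * (W (t i) ω * W (t j) ω)) P := fun i j =>
      ((hW.memLp_s14 (ht i)).integrable_mul (hW.memLp_s14 (ht j))).const_mul _
    have h2 : ∀ ω, (∑ i, c i * W (t i) ω) ^ 2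
        = ∑ i, ∑ j, c i * c j * (W (t i) ω * W (t j) ω) := by
      intro ω
      rw [sq, Finset.sum_mul_sum]
      exact Finset.sum_congr rfl fun i _ => Finset.sum_congr rfl fun j _ => by ring
    simp_rw [h2]
    rw [integral_finsetSum _ fun i _ => integrable_finsetSum _ fun j _ => hI i j]
    refine Finset.sum_congr rfl fun i _ => ?_
    rw [integral_finsetSum _ fun j _ => hI i j]
    refine Finset.sum_congr rfl fun j _ => ?_
    rw [integral_const_mul, hW.2.2.2.2 _ _ (ht i) (ht j)]
  have hmgf := mgf_gaussianReal hv 1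
  constructor
  · have h := integrable_exp_mul_gaussianReal (μ := 0) (v := v) 1
    rw [← hv, integrable_map_measure (by fun_prop) hm.aemeasurable] at h
    simpa [Function.comp_def] using h
  · simpa [mgf, hvar] using hmgf

/-- The properties of the Brownian bridge used below, in a form stable under negation; the
Gaussian finite-dimensional distributions enter through their exponential moments. -/
structure BridgeLaw (P : Measure Ω) (B : ℝ → Ω → ℝ) : Prop where
  measurable : ∀ t, Measurable (B t)
  zero : ∀ ω, B 0 ω = 0
  one : ∀ ω, B 1 ω = 0
  continuousOn : ∀ ω, ContinuousOn (fun t => B t ω) (Set.Icc 0 1)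
  integrable_exp : ∀ {n : ℕ} (c t : Fin n → ℝ), (∀ i, t i ∈ Set.Icc (0 : ℝ) 1) →
    Integrable (fun ω => Real.exp (∑ i, c i * B (t i) ω)) P
  integral_exp : ∀ {n : ℕ} (c t : Fin n → ℝ), (∀ i, t i ∈ Set.Icc (0 : ℝ) 1) →
    ∫ ω, Real.exp (∑ i, c i * B (t i) ω) ∂P
      = Real.exp ((∑ i, ∑ j, c i * c j * (min (t i) (t j) - t i * t j)) / 2)

lemma IsBrownianBridge.bridgeLaw {B : ℝ → Ω → ℝ} (hB : IsBrownianBridge P B) :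
    BridgeLaw P B := by
  obtain ⟨W, hW, hBW⟩ := hB
  have hB' : B = fun t ω => W t ω - t * W 1 ω := by ext t ω; exact hBW t ω
  subst hB'
  have hsum : ∀ {n : ℕ} (c t : Fin n → ℝ) (ω : Ω),
      ∑ i, c i * (W (t i) ω - t i * W 1 ω)
        = ∑ i, Fin.cons (α := fun _ => ℝ) (-∑ i, c i * t i) c i
            * W (Fin.cons (α := fun _ => ℝ) 1 t i) ω := by
    intro n c t ω
    simp only [Fin.sum_univ_succ, Fin.cons_zero, Fin.cons_succ, mul_sub, Finset.sum_sub_distrib,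
      neg_mul, Finset.sum_mul, mul_assoc]
    ring
  have hmem : ∀ {n : ℕ} (t : Fin n → ℝ), (∀ i, t i ∈ Set.Icc (0 : ℝ) 1) →
      ∀ i, Fin.cons (α := fun _ => ℝ) 1 t i ∈ Set.Icc (0 : ℝ) 1 := by
    intro n t ht i
    refine Fin.cases ?_ (fun j => ?_) i
    · simp
    · simpa using ht j
  refine ⟨fun t => (hW.1 t).sub ((hW.1 1).const_mul t), fun ω => by simp [hW.2.1],
    fun ω => by simp, fun ω => (hW.2.2.1 ω).sub (by fun_prop), fun c t ht => ?_,
    fun c t ht => ?_⟩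
  · simp_rw [hsum]
    exact (hW.integral_exp _ _ (hmem t ht)).1
  · simp_rw [hsum]
    rw [(hW.integral_exp _ _ (hmem t ht)).2]
    congr 2
    have e1 : ∀ i, min 1 (t i) = t i := fun i => min_eq_right (ht i).2
    have e2 : ∀ i, min (t i) 1 = t i := fun i => min_eq_left (ht i).2
    simp only [Fin.sum_univ_succ, Fin.cons_zero, Fin.cons_succ, e1, e2, min_self, mul_sub,
      Finset.sum_sub_distrib, Finset.sum_add_distrib]
    have h1 : ∑ i, ∑ j, c i * c j * (t i * t j) = (∑ i, c i * t i) * ∑ i, c i * t i := by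
      rw [Finset.sum_mul_sum]
      exact Finset.sum_congr rfl fun i _ => Finset.sum_congr rfl fun j _ => by ring
    have h2 : ∑ i, (-∑ i, c i * t i) * c i * t i = -((∑ i, c i * t i) * ∑ i, c i * t i) := by
      rw [← neg_mul, Finset.mul_sum]
      exact Finset.sum_congr rfl fun i _ => by ring
    have h3 : ∑ i, c i * (-∑ i, c i * t i) * t i = -((∑ i, c i * t i) * ∑ i, c i * t i) := by
      rw [← h2]
      exact Finset.sum_congr rfl fun i _ => by ring
    rw [h1, h2, h3]
    ring

lemma BridgeLaw.neg {B : ℝ → Ω → ℝ} (hB : BridgeLaw P B) :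
    BridgeLaw P (fun t ω => -B t ω) := by
  have h : ∀ {n : ℕ} (c t : Fin n → ℝ) (ω : Ω),
      ∑ i, c i * -B (t i) ω = ∑ i, (-c i) * B (t i) ω := by
    intro n c t ω
    simp
  refine ⟨fun t => (hB.measurable t).neg, fun ω => by simp [hB.zero], fun ω => by simp [hB.one],
    fun ω => (hB.continuousOn ω).neg, fun c t ht => ?_, fun c t ht => ?_⟩
  · simp_rw [h]
    exact hB.integrable_exp _ t ht
  · simp_rw [h]
    rw [hB.integral_exp _ t ht]
    simp

/-- Cameron-Martin formula for finitely many jointly Gaussian variables: exponential tilting by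
`Z` translates `X` by its covariances `m` with `Z`. -/
lemma map_tilted_eq_map_add [IsProbabilityMeasure P] {ι : Type*} [Fintype ι] {X : ι → Ω → ℝ}
    {Z : Ω → ℝ} (hX : ∀ i, Measurable (X i)) (m : ι → ℝ) (v : ℝ) (q : (ι → ℝ) → ℝ)
    (hint : ∀ c : ι → ℝ, Integrable (fun ω => Real.exp (∑ i, c i * X i ω + Z ω)) P)
    (hexp : ∀ c : ι → ℝ, ∫ ω, Real.exp (∑ i, c i * X i ω) ∂P = Real.exp (q c / 2))
    (hexpZ : ∀ c : ι → ℝ, ∫ ω, Real.exp (∑ i, c i * X i ω + Z ω) ∂P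
      = Real.exp ((q c + 2 * ∑ i, c i * m i + v) / 2)) (hq : q 0 = 0) :
    (P.tilted Z).map (fun ω i => X i ω) = P.map (fun ω i => X i ω + m i) := by
  have hZ : Integrable (fun ω => Real.exp (Z ω)) P := by simpa using hint 0
  have hZv : ∫ ω, Real.exp (Z ω) ∂P = Real.exp (v / 2) := by simpa [hq] using hexpZ 0
  have : IsProbabilityMeasure (P.tilted Z) := isProbabilityMeasure_tilted hZ
  have hXm : Measurable (fun ω i => X i ω) := measurable_pi_lambda _ hX
  have hXm' : Measurable (fun ω i => X i ω + m i) :=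
    measurable_pi_lambda _ fun i => (hX i).add_const _
  have : IsProbabilityMeasure ((P.tilted Z).map (fun ω i => X i ω)) :=
    Measure.isProbabilityMeasure_map hXm.aemeasurable
  have : IsProbabilityMeasure (P.map (fun ω i => X i ω + m i)) :=
    Measure.isProbabilityMeasure_map hXm'.aemeasurable
  refine Measure.ext_of_charFunDual (funext fun L => ?_)
  classical
  set c : ι → ℝ := fun i => L (Pi.single i 1) with hc
  have hL : ∀ y : ι → ℝ, L y = ∑ i, c i * y i := by
    intro y
    conv_lhs => rw [pi_eq_sum_univ' y, map_sum]
    exact Finset.sum_congr rfl fun i _ => by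
      rw [map_smul, smul_eq_mul, mul_comm, hc]
  rw [charFunDual_eq_charFun_map_one, charFunDual_eq_charFun_map_one,
    Measure.map_map (by fun_prop) hXm, Measure.map_map (by fun_prop) hXm']
  have hYm : Measurable (L ∘ fun ω i => X i ω) := (by fun_prop : Measurable L).comp hXm
  have hYm' : Measurable (L ∘ fun ω i => X i ω + m i) := (by fun_prop : Measurable L).comp hXm'
  congr 1
  have hmgf : mgf (L ∘ fun ω i => X i ω) (P.tilted Z)
      = fun s => Real.exp ((q (s • c) + 2 * ∑ i, (s • c) i * m i) / 2) := by
    ext s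
    rw [mgf, integral_tilted]
    simp only [Function.comp_apply, smul_eq_mul, hL, hZv]
    have : ∀ ω, Real.exp (Z ω) / Real.exp (v / 2) * Real.exp (s * ∑ i, c i * X i ω)
        = Real.exp (∑ i, (s • c) i * X i ω + Z ω) * (Real.exp (v / 2))⁻¹ := by
      intro ω
      rw [Real.exp_add, div_eq_mul_inv]
      simp only [Pi.smul_apply, smul_eq_mul, mul_assoc, ← Finset.mul_sum]
      ring
    simp_rw [this]
    rw [integral_mul_const, hexpZ, ← Real.exp_neg, ← Real.exp_add]
    congr 1
    ring
  have hmgf' : mgf (L ∘ fun ω i => X i ω + m i) P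
      = fun s => Real.exp ((q (s • c) + 2 * ∑ i, (s • c) i * m i) / 2) := by
    ext s
    simp only [mgf, Function.comp_apply, hL]
    have : ∀ ω, Real.exp (s * ∑ i, c i * (X i ω + m i))
        = Real.exp (∑ i, (s • c) i * X i ω) * Real.exp (∑ i, (s • c) i * m i) := by
      intro ω
      rw [← Real.exp_add, ← Finset.sum_add_distrib, Finset.mul_sum]
      congr 1
      exact Finset.sum_congr rfl fun i _ => by simp only [Pi.smul_apply, smul_eq_mul]; ring
    simp_rw [this]
    rw [integral_mul_const, hexp, ← Real.exp_add]
    congr 1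
    ring
  have hset : integrableExpSet (L ∘ fun ω i => X i ω) (P.tilted Z) = Set.univ := by
    ext s
    simp only [integrableExpSet, Set.mem_univ, iff_true]
    refine mgf_pos_iff.1 ?_
    rw [hmgf]
    exact Real.exp_pos _
  refine Measure.ext_of_complexMGF_eq hYm.aemeasurable hYm'.aemeasurable ?_
  ext z
  refine eqOn_complexMGF_of_mgf (hmgf.trans hmgf'.symm) ?_
  simp [hset]

lemma BridgeLaw.map_tilted [IsProbabilityMeasure P] {B : ℝ → Ω → ℝ} (hB : BridgeLaw P B) {n : ℕ}
    {t : Fin n → ℝ} {u : ℝ} (hu : 0 ≤ u) (hu1 : u < 1) (ht : ∀ i, 0 ≤ t i ∧ t i ≤ u) (μ : ℝ) :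
    (P.tilted fun ω => μ / (1 - u) * B u ω).map (fun ω i => B (t i) ω)
      = P.map (fun ω i => B (t i) ω + μ * t i) := by
  have ht1 : ∀ i, t i ∈ Set.Icc (0 : ℝ) 1 := fun i => ⟨(ht i).1, (ht i).2.trans hu1.le⟩
  have hne : 1 - u ≠ 0 := by linarith
  have hmem : ∀ i, Fin.cons (α := fun _ => ℝ) u t i ∈ Set.Icc (0 : ℝ) 1 := by
    intro i
    refine Fin.cases ?_ (fun j => ?_) i
    · simpa using ⟨hu, hu1.le⟩
    · simpa using ht1 j
  have hsum : ∀ (c : Fin n → ℝ) (ω : Ω),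
      ∑ i, c i * B (t i) ω + μ / (1 - u) * B u ω
        = ∑ i, Fin.cons (α := fun _ => ℝ) (μ / (1 - u)) c i
            * B (Fin.cons (α := fun _ => ℝ) u t i) ω := by
    intro c ω
    simp only [Fin.sum_univ_succ, Fin.cons_zero, Fin.cons_succ]
    ring
  refine map_tilted_eq_map_add (fun i => hB.measurable (t i)) (fun i => μ * t i)
    (μ ^ 2 * u / (1 - u)) (fun c => ∑ i, ∑ j, c i * c j * (min (t i) (t j) - t i * t j))
    (fun c => ?_) (fun c => ?_) (fun c => ?_) (by simp)
  · simp_rw [hsum]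
    exact hB.integrable_exp _ _ hmem
  · exact hB.integral_exp c t ht1
  · simp_rw [hsum]
    rw [hB.integral_exp _ _ hmem]
    congr 2
    have e1 : ∀ i, min u (t i) = t i := fun i => min_eq_right (ht i).2
    have e2 : ∀ i, min (t i) u = t i := fun i => min_eq_left (ht i).2
    simp only [Fin.sum_univ_succ, Fin.cons_zero, Fin.cons_succ, e1, e2, min_self,
      Finset.sum_add_distrib]
    have h1 : ∑ i, μ / (1 - u) * c i * (t i - u * t i) = ∑ i, c i * (μ * t i) :=
      Finset.sum_congr rfl fun i _ => by field_simp
    have h2 : ∑ i, c i * (μ / (1 - u)) * (t i - t i * u) = ∑ i, c i * (μ * t i) :=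
      Finset.sum_congr rfl fun i _ => by field_simp
    rw [h1, h2]
    field_simp
    ring

lemma BridgeLaw.integral_exp_mul {B : ℝ → Ω → ℝ} (hB : BridgeLaw P B) {u : ℝ}
    (hu : u ∈ Set.Icc (0 : ℝ) 1) (c : ℝ) :
    Integrable (fun ω => Real.exp (c * B u ω)) P ∧
      ∫ ω, Real.exp (c * B u ω) ∂P = Real.exp (c ^ 2 * (u * (1 - u)) / 2) := by
  have h1 := hB.integrable_exp (n := 1) (fun _ => c) (fun _ => u) (fun _ => hu)
  have h2 := hB.integral_exp (n := 1) (fun _ => c) (fun _ => u) (fun _ => hu)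
  simp only [Finset.univ_unique, Finset.sum_const, Finset.card_singleton, one_smul,
    min_self] at h1 h2
  refine ⟨h1, h2.trans ?_⟩
  congr 1
  ring

/-- The event that on the grid `ℕ / N` the path `t ↦ B t + l * t` leaves `[-x, x]` for the first
time at `i / N`, upwards. -/
def firstExitAbove {α : Type*} (B : ℝ → α → ℝ) (x l : ℝ) (N i : ℕ) : Set α :=
  {ω | x < B (i / N) ω + l * (i / N) ∧ ∀ j < i, |B (j / N) ω + l * (j / N)| ≤ x}

lemma BridgeLaw.measurableSet_firstExitAbove {B : ℝ → Ω → ℝ} (hB : BridgeLaw P B)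
    (x l : ℝ) (N i : ℕ) : MeasurableSet (firstExitAbove B x l N i) := by
  have h : firstExitAbove B x l N i = {ω | x < B (i / N) ω + l * (i / N)} ∩
      ⋂ j, ⋂ (_ : j < i), {ω | |B (j / N) ω + l * (j / N)| ≤ x} := by
    ext ω
    simp [firstExitAbove]
  rw [h]
  refine (measurableSet_lt measurable_const ((hB.measurable _).add_const _)).inter
    (MeasurableSet.iInter fun j => MeasurableSet.iInter fun _ =>
      measurableSet_le (continuous_abs.measurable.comp ((hB.measurable _).add_const _))
        measurable_const)

/-- Reflection identity: replacing the drift `l` by `2 * x - l` amounts to weighting by an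
exponential of the overshoot over `x`. -/
lemma BridgeLaw.reflection [IsProbabilityMeasure P] {B : ℝ → Ω → ℝ} (hB : BridgeLaw P B)
    (x l : ℝ) {N i : ℕ} (hi : i < N) :
    Real.exp (-(2 * x - l) ^ 2 / 2) * P.real (firstExitAbove B x (2 * x - l) N i)
      = Real.exp (-l ^ 2 / 2) * ∫ ω in firstExitAbove B x l N i,
          Real.exp (-(2 * (l - x) / (1 - i / N) * (B (i / N) ω + l * (i / N) - x))) ∂P := by
  have hN : (0 : ℝ) < N := by exact_mod_cast (Nat.zero_le i).trans_lt hi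
  set u : ℝ := i / N with hu
  have hu0 : 0 ≤ u := by positivity
  have hu1 : u < 1 := by rw [hu, div_lt_one hN]; exact_mod_cast hi
  have hne : 1 - u ≠ 0 := by linarith
  set t : Fin (i + 1) → ℝ := fun j => (j : ℕ) / N with ht
  have htu : ∀ j, 0 ≤ t j ∧ t j ≤ u := fun j => by
    refine ⟨by positivity, div_le_div_of_nonneg_right ?_ hN.le⟩
    exact_mod_cast Nat.lt_succ_iff.1 j.2
  set A : Set (Fin (i + 1) → ℝ) := {y | x < y (Fin.last i) + l * t (Fin.last i)} ∩
    ⋂ j : Fin (i + 1), ⋂ (_ : (j : ℕ) < i), {y | |y j + l * t j| ≤ x} with hA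
  have hAm : MeasurableSet A := by
    refine (measurableSet_lt measurable_const (by fun_prop)).inter
      (MeasurableSet.iInter fun j => MeasurableSet.iInter fun _ =>
        measurableSet_le (by fun_prop) measurable_const)
  have hpre : ∀ m : ℝ, firstExitAbove B x (l + m) N i
      = (fun ω j => B (t j) ω + m * t j) ⁻¹' A := by
    intro m
    ext ω
    simp only [firstExitAbove, hA, ht, Set.mem_ofPred_eq, Set.mem_preimage, Set.mem_inter_iff,
      Set.mem_iInter, Fin.val_last, Fin.forall_iff]
    refine and_congr ?_ ⟨fun h j _ hj => ?_, fun h j hj => ?_⟩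
    · rw [add_mul, add_assoc, add_comm (m * _)]
    · convert h j hj using 2; ring
    · convert h j (by omega) hj using 2; ring
  have hpre0 : firstExitAbove B x l N i = (fun ω j => B (t j) ω) ⁻¹' A := by
    simpa using hpre 0
  have hBt : Measurable fun ω j => B (t j) ω := measurable_pi_lambda _ fun j => hB.measurable _
  have hE := hB.integral_exp_mul ⟨hu0, hu1.le⟩ ((2 * x - 2 * l) / (1 - u))
  have key : P.real (firstExitAbove B x (2 * x - l) N i)
      = ∫ ω in firstExitAbove B x l N i, Real.exp ((2 * x - 2 * l) / (1 - u) * B u ω) /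
          ∫ ω, Real.exp ((2 * x - 2 * l) / (1 - u) * B u ω) ∂P ∂P := by
    rw [show 2 * x - l = l + (2 * x - 2 * l) by ring, hpre, measureReal_def,
      ← Measure.map_apply (measurable_pi_lambda _ fun j => (hB.measurable _).add_const _) hAm,
      ← hB.map_tilted hu0 hu1 htu, Measure.map_apply hBt hAm, ← hpre0,
      tilted_apply_eq_ofReal_integral' _ (hB.measurableSet_firstExitAbove x l N i),
      ENNReal.toReal_ofReal]
    exact integral_nonneg fun ω => by positivity
  rw [key, hE.2, ← integral_const_mul, ← integral_const_mul]
  congr 1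
  ext ω
  rw [← Real.exp_sub, ← Real.exp_add, ← Real.exp_add]
  congr 1
  field_simp
  ring

lemma exists_lt_abs_of_lt_abs_one {b : ℝ → ℝ} (hb : ContinuousOn b (Set.Icc 0 1)) {x : ℝ}
    (h : x < |b 1|) : ∃ t ∈ Set.Ico (0 : ℝ) 1, x < |b t| := by
  have hc : ContinuousWithinAt (fun t => |b t|) (Set.Ico 0 1) 1 :=
    ((hb 1 (by simp)).mono Set.Ico_subset_Icc_self).abs
  have hne : (nhdsWithin (1 : ℝ) (Set.Ico 0 1)).NeBot := by
    rw [← mem_closure_iff_nhdsWithin_neBot, closure_Ico (by norm_num)]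
    simp
  obtain ⟨t, ht, ht'⟩ := ((hc.eventually_const_lt h).and self_mem_nhdsWithin).exists
  exact ⟨t, ht', ht⟩

lemma eventually_lt_abs_grid {b : ℝ → ℝ} (hb : ContinuousOn b (Set.Icc 0 1)) {x t : ℝ}
    (ht : t ∈ Set.Ico (0 : ℝ) 1) (h : x < |b t|) :
    ∀ᶠ N : ℕ in atTop, x < |b ((⌊t * N⌋₊ : ℝ) / N)| := by
  have h1 : Tendsto (fun N : ℕ => (⌊t * N⌋₊ : ℝ) / N) atTop (nhdsWithin t (Set.Icc 0 1)) := by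
    refine tendsto_nhdsWithin_iff.2
      ⟨(tendsto_nat_floor_mul_div_atTop ht.1).comp tendsto_natCast_atTop_atTop,
        .of_forall fun N => ⟨by positivity, div_le_one_of_le₀ ?_ (Nat.cast_nonneg N)⟩⟩
    refine (Nat.floor_le (mul_nonneg ht.1 (Nat.cast_nonneg N))).trans ?_
    exact mul_le_of_le_one_left (Nat.cast_nonneg N) ht.2.le
  exact ((hb t (Set.Ico_subset_Icc_self ht)).abs.tendsto.comp h1).eventually_const_lt h

lemma disjoint_firstExitAbove {α : Type*} (B : ℝ → α → ℝ) (x l : ℝ) (N : ℕ) {i j : ℕ} (hij : i ≠ j) :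
    Disjoint (firstExitAbove B x l N i) (firstExitAbove B x l N j) := by
  rw [Set.disjoint_left]
  intro ω hi hj
  rcases lt_or_gt_of_ne hij with h | h
  · exact absurd hi.1 (not_lt.2 ((le_abs_self _).trans (hj.2 i h)))
  · exact absurd hj.1 (not_lt.2 ((le_abs_self _).trans (hi.2 j h)))

/-- The probability that on the grid the path `t ↦ B t + l * t` leaves `[-x, x]` before time `1`,
the first time upwards. -/
def gridExitAbove (P : Measure Ω) (B : ℝ → Ω → ℝ) (x l : ℝ) (N : ℕ) : ℝ :=
  ∑ i ∈ Finset.range N, P.real (firstExitAbove B x l N i)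

lemma gridExitAbove_nonneg (B : ℝ → Ω → ℝ) (x l : ℝ) (N : ℕ) : 0 ≤ gridExitAbove P B x l N :=
  Finset.sum_nonneg fun _ _ => measureReal_nonneg

lemma BridgeLaw.gridExitAbove_le_one [IsProbabilityMeasure P] {B : ℝ → Ω → ℝ}
    (hB : BridgeLaw P B) (x l : ℝ) (N : ℕ) : gridExitAbove P B x l N ≤ 1 := by
  rw [gridExitAbove, ← measureReal_biUnion_finset
    (fun i _ j _ hij => disjoint_firstExitAbove B x l N hij)
    fun i _ => hB.measurableSet_firstExitAbove x l N i]
  exact measureReal_le_one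

/-- For a drift that forces an exit, the overshoot over `x` is negligible on fine grids, uniformly
on the first exit event. -/
lemma BridgeLaw.eventually_overshoot_le {B : ℝ → Ω → ℝ} (hB : BridgeLaw P B) {x l : ℝ}
    (hx : 0 < x) (hl : x < l) (ω : Ω) {ε : ℝ} (hε : 0 < ε) :
    ∀ᶠ N : ℕ in atTop, ∀ i < N, ω ∈ firstExitAbove B x l N i →
      2 * (l - x) / (1 - i / N) * (B (i / N) ω + l * (i / N) - x) ≤ ε := by
  set b : ℝ → ℝ := fun t => B t ω + l * t with hbdef
  have hb : ContinuousOn b (Set.Icc 0 1) := (hB.continuousOn ω).add (by fun_prop)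
  have hb1 : x < |b 1| := by
    simp only [hbdef, hB.one, zero_add, mul_one]
    exact hl.trans_le (le_abs_self l)
  obtain ⟨t₀, ht₀, hxt₀⟩ := exists_lt_abs_of_lt_abs_one hb hb1
  have ht₀' : 0 < 1 - t₀ := by linarith [ht₀.2]
  have hlx : 0 < 2 * (l - x) := by linarith
  obtain ⟨δ, hδ, hunif⟩ := Metric.uniformContinuousOn_iff.1
    (isCompact_Icc.uniformContinuousOn_of_continuous hb) (ε * (1 - t₀) / (2 * (l - x)))
    (by positivity)
  filter_upwards [eventually_lt_abs_grid hb ht₀ hxt₀,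
    (tendsto_one_div_atTop_nhds_zero_nat (𝕜 := ℝ)).eventually_lt_const hδ] with N hN hNδ i hi hω
  have hN0 : (0 : ℝ) < N := by exact_mod_cast (Nat.zero_le i).trans_lt hi
  have hit : (i : ℝ) / N ≤ t₀ := by
    have : i ≤ ⌊t₀ * N⌋₊ := by
      by_contra hlt
      exact absurd (hω.2 _ (not_le.1 hlt)) (not_le.2 hN)
    rw [div_le_iff₀ hN0]
    exact (Nat.le_floor_iff (mul_nonneg ht₀.1 hN0.le)).1 this
  obtain ⟨k, rfl⟩ : ∃ k, i = k + 1 := by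
    refine Nat.exists_eq_succ_of_ne_zero ?_
    rintro rfl
    have := hω.1
    simp only [Nat.cast_zero, zero_div, hB.zero, mul_zero, add_zero] at this
    linarith
  have hk := (le_abs_self _).trans (hω.2 k (by omega))
  have hiN : ((k + 1 : ℕ) : ℝ) / N ≤ 1 := hit.trans ht₀.2.le
  have hdiff : ((k + 1 : ℕ) : ℝ) / N - k / N = 1 / N := by push_cast; ring
  have h1N : 0 < 1 / (N : ℝ) := by positivity
  have hd := hunif (((k + 1 : ℕ) : ℝ) / N) ⟨by positivity, hiN⟩ (k / N)
    ⟨by positivity, by linarith⟩ (by rw [Real.dist_eq, hdiff, abs_of_pos h1N]; exact hNδ)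
  rw [Real.dist_eq] at hd
  have hd' : B (((k + 1 : ℕ) : ℝ) / N) ω + l * (((k + 1 : ℕ) : ℝ) / N) - x
      ≤ ε * (1 - t₀) / (2 * (l - x)) := by
    have := (le_abs_self _).trans hd.le
    simp only [hbdef] at this
    linarith
  have hov : 0 ≤ B (((k + 1 : ℕ) : ℝ) / N) ω + l * (((k + 1 : ℕ) : ℝ) / N) - x := by
    linarith [hω.1]
  calc _ ≤ 2 * (l - x) / (1 - t₀) * (ε * (1 - t₀) / (2 * (l - x))) := by gcongr
    _ = ε := by
      have : l - x ≠ 0 := by linarith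
      field_simp

lemma abs_one_sub_exp_neg_le {z : ℝ} (hz : 0 ≤ z) : |1 - Real.exp (-z)| ≤ min z 1 := by
  have h1 : Real.exp (-z) ≤ 1 := Real.exp_le_one_iff.2 (by linarith)
  rw [abs_of_nonneg (by linarith)]
  exact le_min (by linarith [Real.add_one_le_exp (-z)]) (by linarith [Real.exp_pos (-z)])

lemma BridgeLaw.tendsto_gridExitAbove_sub [IsProbabilityMeasure P] {B : ℝ → Ω → ℝ}
    (hB : BridgeLaw P B) {x l : ℝ} (hx : 0 < x) (hl : x < l) :
    Tendsto (fun N => Real.exp (-l ^ 2 / 2) * gridExitAbove P B x l N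
      - Real.exp (-(2 * x - l) ^ 2 / 2) * gridExitAbove P B x (2 * x - l) N) atTop (nhds 0) := by
  set z : ℕ → ℕ → Ω → ℝ := fun N i ω =>
    2 * (l - x) / (1 - i / N) * (B (i / N) ω + l * (i / N) - x) with hz
  set g : ℕ → Ω → ℝ := fun N ω => ∑ i ∈ Finset.range N,
    (firstExitAbove B x l N i).indicator (fun ω => 1 - Real.exp (-z N i ω)) ω with hg
  have hzm : ∀ N i, Measurable (z N i) := fun N i =>
    (((hB.measurable _).add_const _).sub_const _).const_mul _
  have hznn : ∀ N, ∀ i < N, ∀ ω ∈ firstExitAbove B x l N i, 0 ≤ z N i ω := by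
    intro N i hi ω hω
    have hN0 : (0 : ℝ) < N := by exact_mod_cast (Nat.zero_le i).trans_lt hi
    have h1 : (i : ℝ) / N ≤ 1 := by rw [div_le_one hN0]; exact_mod_cast hi.le
    have h2 := hω.1
    exact mul_nonneg (div_nonneg (by linarith) (by linarith)) (by linarith)
  have hgle : ∀ N ω (ε : ℝ), 0 ≤ ε →
      (∀ i < N, ω ∈ firstExitAbove B x l N i → |1 - Real.exp (-z N i ω)| ≤ ε) → |g N ω| ≤ ε := by
    intro N ω ε hε h
    by_cases hex : ∃ i < N, ω ∈ firstExitAbove B x l N i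
    · obtain ⟨i, hi, hω⟩ := hex
      have : g N ω = 1 - Real.exp (-z N i ω) := by
        rw [hg]
        simp only
        rw [Finset.sum_eq_single_of_mem i (Finset.mem_range.2 hi), Set.indicator_of_mem hω]
        intro j _ hj
        exact Set.indicator_of_notMem
          (Set.disjoint_left.1 (disjoint_firstExitAbove B x l N hj.symm) hω) _
      rw [this]
      exact h i hi hω
    · push Not at hex
      have : g N ω = 0 := Finset.sum_eq_zero fun i hi =>
        Set.indicator_of_notMem (hex i (Finset.mem_range.1 hi)) _
      simpa [this] using hε
  have hgm : ∀ N, Measurable (g N) := fun N => Finset.measurable_fun_sum _ fun i _ =>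
    ((measurable_const.sub ((hzm N i).neg.exp)).indicator
      (hB.measurableSet_firstExitAbove x l N i))
  have hlim : Tendsto (fun N => ∫ ω, g N ω ∂P) atTop (nhds (∫ _, (0 : ℝ) ∂P)) := by
    refine tendsto_integral_of_dominated_convergence (fun _ => 1)
      (fun N => (hgm N).aestronglyMeasurable) (integrable_const _)
      (fun N => .of_forall fun ω => ?_) (.of_forall fun ω => ?_)
    · exact hgle N ω 1 zero_le_one fun i hi hω =>
        (abs_one_sub_exp_neg_le (hznn N i hi ω hω)).trans (min_le_right _ _)
    · rw [Metric.tendsto_nhds]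
      intro ε hε
      filter_upwards [hB.eventually_overshoot_le hx hl ω (half_pos hε)] with N hN
      rw [Real.dist_eq, sub_zero]
      exact (hgle N ω _ (half_pos hε).le fun i hi hω =>
        ((abs_one_sub_exp_neg_le (hznn N i hi ω hω)).trans (min_le_left _ _)).trans
          (hN i hi hω)).trans_lt (half_lt_self hε)
  have hlim' := hlim.const_mul (Real.exp (-l ^ 2 / 2))
  rw [integral_zero, mul_zero] at hlim'
  refine hlim'.congr fun N => ?_
  have hexpint : ∀ i < N, IntegrableOn (fun ω => Real.exp (-z N i ω))
      (firstExitAbove B x l N i) P := by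
    intro i hi
    refine Integrable.mono' (integrable_const (1 : ℝ))
      (hzm N i).neg.exp.aestronglyMeasurable ?_
    refine (ae_restrict_iff' (hB.measurableSet_firstExitAbove x l N i)).2 (.of_forall fun ω hω => ?_)
    rw [Real.norm_eq_abs, Real.abs_exp]
    exact Real.exp_le_one_iff.2 (neg_nonpos.2 (hznn N i hi ω hω))
  simp only [hg, gridExitAbove]
  rw [integral_finsetSum, Finset.mul_sum, Finset.mul_sum, Finset.mul_sum, ← Finset.sum_sub_distrib]
  · refine Finset.sum_congr rfl fun i hi => ?_
    have hi := Finset.mem_range.1 hi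
    rw [hB.reflection x l hi, ← mul_sub,
      integral_indicator (hB.measurableSet_firstExitAbove x l N i),
      integral_sub (integrable_const _) (hexpint i hi)]
    simp
    rfl
  · intro i hi
    have hi := Finset.mem_range.1 hi
    exact (integrable_indicator_iff (hB.measurableSet_firstExitAbove x l N i)).2
      ((integrable_const (1 : ℝ)).sub (hexpint i hi))

/-- The event that the path `t ↦ B t + l * t` leaves `[-x, x]` on the grid before time `1`. -/
def gridExit {α : Type*} (B : ℝ → α → ℝ) (x l : ℝ) (N : ℕ) : Set α :=
  {ω | ∃ i < N, x < |B ((i : ℝ) / N) ω + l * (i / N)|}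

lemma gridExit_eq_biUnion {α : Type*} (B : ℝ → α → ℝ) (x l : ℝ) (N : ℕ) :
    gridExit B x l N = (⋃ i ∈ Finset.range N, firstExitAbove B x l N i) ∪
      ⋃ i ∈ Finset.range N, firstExitAbove (fun t ω => -B t ω) x (-l) N i := by
  have habs : ∀ (j : ℕ) ω, |(-B (j / N) ω) + -l * (j / N)| = |B (j / N) ω + l * (j / N)| := by
    intro j ω
    rw [← abs_neg]
    congr 1
    ring
  ext ω
  simp only [gridExit, firstExitAbove, Set.mem_ofPred_eq, Set.mem_union, Set.mem_iUnion,
    Finset.mem_range, exists_prop, habs]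
  constructor
  · intro h
    classical
    obtain ⟨hN, hx⟩ := Nat.find_spec h
    have hmin : ∀ j < Nat.find h, |B (j / N) ω + l * (j / N)| ≤ x := fun j hj =>
      not_lt.1 fun hlt => Nat.find_min h hj ⟨hj.trans hN, hlt⟩
    rcases lt_abs.1 hx with hpos | hneg
    · exact .inl ⟨_, hN, hpos, hmin⟩
    · exact .inr ⟨_, hN, by linarith, hmin⟩
  · rintro (⟨i, hi, hlt, -⟩ | ⟨i, hi, hlt, -⟩)
    · exact ⟨i, hi, lt_abs.2 (.inl hlt)⟩
    · exact ⟨i, hi, lt_abs.2 (.inr (by linarith))⟩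

lemma disjoint_firstExitAbove_neg {α : Type*} (B : ℝ → α → ℝ) {x : ℝ} (hx : 0 < x) (l : ℝ)
    (N i j : ℕ) : Disjoint (firstExitAbove B x l N i)
      (firstExitAbove (fun t ω => -B t ω) x (-l) N j) := by
  rw [Set.disjoint_left]
  intro ω hi hj
  have h1 := hi.1
  have h2 := hj.1
  rcases lt_trichotomy i j with h | rfl | h
  · have := (neg_le_abs _).trans (hj.2 i h)
    linarith
  · linarith
  · have := (neg_le_abs _).trans (hi.2 j h)
    linarith

lemma BridgeLaw.measurableSet_gridExit {B : ℝ → Ω → ℝ} (hB : BridgeLaw P B) (x l : ℝ) (N : ℕ) :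
    MeasurableSet (gridExit B x l N) := by
  rw [gridExit_eq_biUnion]
  exact (Finset.measurableSet_biUnion _ fun i _ => hB.measurableSet_firstExitAbove x l N i).union
    (Finset.measurableSet_biUnion _ fun i _ => hB.neg.measurableSet_firstExitAbove x (-l) N i)

lemma BridgeLaw.measureReal_gridExit [IsProbabilityMeasure P] {B : ℝ → Ω → ℝ}
    (hB : BridgeLaw P B) {x : ℝ} (hx : 0 < x) (l : ℝ) (N : ℕ) :
    P.real (gridExit B x l N)
      = gridExitAbove P B x l N + gridExitAbove P (fun t ω => -B t ω) x (-l) N := by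
  rw [gridExit_eq_biUnion, measureReal_union _
    (Finset.measurableSet_biUnion _ fun i _ => hB.neg.measurableSet_firstExitAbove x (-l) N i)
      (measure_ne_top _ _) (measure_ne_top _ _),
    measureReal_biUnion_finset (fun i _ j _ hij => disjoint_firstExitAbove _ x _ N hij)
      (fun i _ => hB.measurableSet_firstExitAbove x l N i),
    measureReal_biUnion_finset (fun i _ j _ hij => disjoint_firstExitAbove _ x _ N hij)
      (fun i _ => hB.neg.measurableSet_firstExitAbove x (-l) N i)]
  · rfl
  · simp only [Set.disjoint_iUnion_left, Set.disjoint_iUnion_right]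
    exact fun i _ j _ => disjoint_firstExitAbove_neg B hx l N j i

lemma BridgeLaw.tendsto_gridExit [IsProbabilityMeasure P] {B : ℝ → Ω → ℝ} (hB : BridgeLaw P B)
    (x l : ℝ) :
    Tendsto (fun N => P.real (gridExit B x l N)) atTop
      (nhds (P.real {ω | ∃ t ∈ Set.Ico (0 : ℝ) 1, x < |B t ω + l * t|})) := by
  refine (ENNReal.tendsto_toReal (measure_ne_top _ _)).comp
    (tendsto_measure_of_tendsto_indicator_of_isFiniteMeasure atTop P
      (fun N => hB.measurableSet_gridExit x l N) fun ω => ?_)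
  have hgrid : ∀ N, ω ∈ gridExit B x l N → ∃ t ∈ Set.Ico (0 : ℝ) 1, x < |B t ω + l * t| := by
    rintro N ⟨i, hi, h⟩
    have hN : (0 : ℝ) < N := by exact_mod_cast (Nat.zero_le i).trans_lt hi
    exact ⟨i / N, ⟨by positivity, by rw [div_lt_one hN]; exact_mod_cast hi⟩, h⟩
  by_cases hω : ∃ t ∈ Set.Ico (0 : ℝ) 1, x < |B t ω + l * t|
  · obtain ⟨t, ht, hxt⟩ := hω
    have hb : ContinuousOn (fun t => B t ω + l * t) (Set.Icc 0 1) :=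
      (hB.continuousOn ω).add (by fun_prop)
    filter_upwards [eventually_lt_abs_grid hb ht hxt, eventually_gt_atTop 0] with N hN hN0
    refine iff_of_true ⟨⌊t * N⌋₊, ?_, hN⟩ ⟨t, ht, hxt⟩
    have hN0' : (0 : ℝ) < N := by exact_mod_cast hN0
    rw [Nat.floor_lt (mul_nonneg ht.1 hN0'.le)]
    exact mul_lt_of_lt_one_left hN0' ht.2
  · exact .of_forall fun N => iff_of_false (fun h => hω (hgrid N h)) hω

lemma summable_exp_neg_sq_int {x : ℝ} (hx : 0 < x) :
    Summable fun k : ℤ => Real.exp (-(2 * k * x) ^ 2 / 2) := by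
  have h : Summable fun k : ℕ => Real.exp (-(2 * k * x) ^ 2 / 2) := by
    refine Summable.of_nonneg_of_le (fun k => (Real.exp_pos _).le) (fun k => ?_)
      (Real.summable_exp_nat_mul_iff.2 (by nlinarith : -2 * x ^ 2 < 0))
    rw [Real.exp_le_exp]
    have : (k : ℝ) ≤ (k : ℝ) ^ 2 := by exact_mod_cast Nat.le_self_pow two_ne_zero k
    nlinarith [mul_le_mul_of_nonneg_right this (sq_nonneg x)]
  refine Summable.of_nat_of_neg (by simpa using h) (by simpa using h)

lemma abs_neg_one_zpow_mul (k : ℤ) (y : ℝ) : |(-1 : ℝ) ^ k * y| = |y| := by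
  simp [abs_mul, abs_zpow]

lemma BridgeLaw.tendsto_tsum_gridExitAbove [IsProbabilityMeasure P] {B : ℝ → Ω → ℝ}
    (hB : BridgeLaw P B) {x : ℝ} (hx : 0 < x) :
    Tendsto (fun N => ∑' k : ℤ, (-1 : ℝ) ^ k *
      (Real.exp (-(2 * k * x) ^ 2 / 2) * gridExitAbove P B x (2 * k * x) N)) atTop (nhds 0) := by
  set a : ℤ → ℝ := fun k => Real.exp (-(2 * k * x) ^ 2 / 2) with ha
  set U : ℕ → ℤ → ℝ := fun N k => gridExitAbove P B x (2 * k * x) N with hU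
  have haU : ∀ N k, |a k * U N k| ≤ a k := fun N k => by
    have := gridExitAbove_nonneg (P := P) B x (2 * k * x) N
    rw [abs_of_nonneg (by positivity)]
    exact mul_le_of_le_one_right (by positivity) (hB.gridExitAbove_le_one x _ N)
  have hasum : Summable a := summable_exp_neg_sq_int hx
  have hasum' : Summable fun k => a (1 - k) := (Equiv.subLeft (1 : ℤ)).summable_iff.2 hasum
  have hpos : ∀ k : ℤ, 1 ≤ k →
      Tendsto (fun N => a k * U N k - a (1 - k) * U N (1 - k)) atTop (nhds 0) := by
    intro k hk
    have hk' : (1 : ℝ) ≤ k := by exact_mod_cast hk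
    have h := hB.tendsto_gridExitAbove_sub hx (l := 2 * k * x) (by nlinarith)
    simp only [ha, hU]
    convert h using 5 <;> push_cast <;> ring_nf
  have hall : ∀ k : ℤ, Tendsto (fun N => a k * U N k - a (1 - k) * U N (1 - k)) atTop (nhds 0) := by
    intro k
    rcases le_or_gt 1 k with hk | hk
    · exact hpos k hk
    · simpa using (hpos (1 - k) (by omega)).neg
  have hsum : ∀ N, Summable fun k : ℤ => (-1 : ℝ) ^ k * (a k * U N k) := fun N =>
    hasum.of_norm_bounded fun k => by
      rw [Real.norm_eq_abs, abs_neg_one_zpow_mul]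
      exact haU N k
  have hdouble : ∀ N, ∑' k : ℤ, (-1 : ℝ) ^ k * (a k * U N k)
      = 2⁻¹ * ∑' k : ℤ, (-1 : ℝ) ^ k * (a k * U N k - a (1 - k) * U N (1 - k)) := by
    intro N
    have hpow : ∀ k : ℤ, (-1 : ℝ) ^ (1 - k) = -(-1 : ℝ) ^ k := fun k => by
      rw [zpow_sub₀ (by norm_num), zpow_one, div_eq_mul_inv, ← inv_zpow]
      norm_num
    have e1 := (Equiv.subLeft (1 : ℤ)).tsum_eq fun k : ℤ => (-1 : ℝ) ^ k * (a k * U N k)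
    have e2 := (Equiv.subLeft (1 : ℤ)).summable_iff.2 (hsum N)
    simp only [Equiv.subLeft_apply, Function.comp_def, hpow, neg_mul] at e1 e2
    have e3 := (hsum N).tsum_add e2
    rw [e1] at e3
    rw [tsum_congr fun k => (mul_sub _ _ _).trans (sub_eq_add_neg _ _), e3]
    ring
  refine Tendsto.congr (fun N => (hdouble N).symm) ?_
  have := tendsto_tsum_of_dominated_convergence (𝓕 := atTop)
    (f := fun N k => (-1 : ℝ) ^ k * (a k * U N k - a (1 - k) * U N (1 - k)))
    (g := fun _ : ℤ => (0 : ℝ)) (hasum.add hasum')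
    (fun k => by simpa using (hall k).const_mul ((-1 : ℝ) ^ k))
    (.of_forall fun N k => by
      rw [Real.norm_eq_abs, abs_neg_one_zpow_mul]
      exact (abs_sub _ _).trans (add_le_add (haU N k) (haU N (1 - k))))
  simpa using this.const_mul 2⁻¹

lemma BridgeLaw.measureReal_exit [IsProbabilityMeasure P] {B : ℝ → Ω → ℝ}
    (hB : BridgeLaw P B) {x : ℝ} (hx : 0 < x) :
    P.real {ω | ∃ t ∈ Set.Ico (0 : ℝ) 1, x < |B t ω|}
      = 1 - ∑' k : ℤ, (-1 : ℝ) ^ k * Real.exp (-(2 * k * x) ^ 2 / 2) := by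
  set a : ℤ → ℝ := fun k => Real.exp (-(2 * k * x) ^ 2 / 2) with ha
  have hasum : Summable a := summable_exp_neg_sq_int hx
  set p := P.real {ω | ∃ t ∈ Set.Ico (0 : ℝ) 1, x < |B t ω|} with hp
  have hbound : ∀ (q : ℤ → ℝ), (∀ k, |q k| ≤ 1) →
      ∀ k : ℤ, ‖(-1 : ℝ) ^ k * (a k * q k)‖ ≤ a k := fun q hq k => by
    rw [Real.norm_eq_abs, abs_neg_one_zpow_mul, abs_mul, Real.abs_exp]
    exact mul_le_of_le_one_right (Real.exp_pos _).le (hq k)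
  have hU : ∀ {B' : ℝ → Ω → ℝ}, BridgeLaw P B' → ∀ l N, |gridExitAbove P B' x l N| ≤ 1 :=
    fun hB' l N => by
      rw [abs_of_nonneg (gridExitAbove_nonneg _ _ _ _)]
      exact hB'.gridExitAbove_le_one x l N
  have hzero : Tendsto (fun N => ∑' k : ℤ, (-1 : ℝ) ^ k *
      (a k * P.real (gridExit B x (2 * k * x) N))) atTop (nhds 0) := by
    have h := (hB.tendsto_tsum_gridExitAbove hx).add (hB.neg.tendsto_tsum_gridExitAbove hx)
    rw [add_zero] at h
    refine h.congr fun N => ?_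
    rw [← (Equiv.neg ℤ).tsum_eq fun k : ℤ => (-1 : ℝ) ^ k * (Real.exp (-(2 * k * x) ^ 2 / 2) *
      gridExitAbove P (fun t ω => -B t ω) x (2 * k * x) N), ← Summable.tsum_add]
    · refine tsum_congr fun k => ?_
      have e : 2 * ((-k : ℤ) : ℝ) * x = -(2 * k * x) := by push_cast; ring
      have e' : (-1 : ℝ) ^ (-k) = (-1 : ℝ) ^ k := by rw [zpow_neg, ← inv_zpow]; norm_num
      rw [hB.measureReal_gridExit hx, Equiv.neg_apply, e, e', neg_sq, mul_add, mul_add]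
    · exact hasum.of_norm_bounded
        (hbound (fun k => gridExitAbove P B x (2 * k * x) N) fun k => hU hB _ N)
    · exact (Equiv.neg ℤ).summable_iff.2 (hasum.of_norm_bounded
        (hbound (fun k => gridExitAbove P (fun t ω => -B t ω) x (2 * k * x) N)
          fun k => hU hB.neg _ N))
  have hlim : ∀ k : ℤ, Tendsto (fun N => P.real (gridExit B x (2 * k * x) N)) atTop
      (nhds (Function.update (fun _ => (1 : ℝ)) 0 p k)) := by
    intro k
    have h := hB.tendsto_gridExit x (2 * k * x)
    rcases eq_or_ne k 0 with rfl | hk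
    · simpa [hp] using h
    · rw [Function.update_of_ne hk]
      have huniv : {ω | ∃ t ∈ Set.Ico (0 : ℝ) 1, x < |B t ω + 2 * k * x * t|} = Set.univ := by
        refine Set.eq_univ_of_forall fun ω => ?_
        refine exists_lt_abs_of_lt_abs_one (b := fun t => B t ω + 2 * k * x * t)
          ((hB.continuousOn ω).add (by fun_prop)) ?_
        have hk' : (1 : ℝ) ≤ |(k : ℝ)| := by exact_mod_cast Int.one_le_abs hk
        rw [hB.one, zero_add, mul_one, abs_mul, abs_mul, abs_two, abs_of_pos hx]
        nlinarith
      rwa [huniv, probReal_univ] at h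
  have hsum := tendsto_tsum_of_dominated_convergence (𝓕 := atTop)
    (f := fun N (k : ℤ) => (-1 : ℝ) ^ k * (a k * P.real (gridExit B x (2 * k * x) N)))
    hasum (fun k => ((hlim k).const_mul (a k)).const_mul ((-1 : ℝ) ^ k))
    (.of_forall fun N => hbound _ fun k => by
      rw [abs_of_nonneg measureReal_nonneg]
      exact measureReal_le_one)
  have heq := tendsto_nhds_unique hsum hzero
  have hsa : Summable fun k : ℤ => (-1 : ℝ) ^ k * a k :=
    hasum.of_norm_bounded fun k => by simpa using hbound (fun _ => 1) (by simp) k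
  have hsingle : ∑' k : ℤ, Pi.single (M := fun _ => ℝ) 0 (1 - p) k = 1 - p :=
    tsum_pi_single 0 (1 - p)
  have hsplit : ∀ k : ℤ, (-1 : ℝ) ^ k * (a k * Function.update (fun _ => (1 : ℝ)) 0 p k)
      = (-1 : ℝ) ^ k * a k - Pi.single (M := fun _ => ℝ) 0 (1 - p) k := by
    intro k
    rcases eq_or_ne k 0 with rfl | hk
    · simp [ha]
    · simp [hk]
  simp_rw [hsplit] at heq
  rw [hsa.tsum_sub (hasSum_pi_single (0 : ℤ) (1 - p)).summable, hsingle] at heq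
  linarith

lemma tsum_int_neg_one_zpow_mul_exp {x : ℝ} (hx : 0 < x) :
    ∑' k : ℤ, (-1 : ℝ) ^ k * Real.exp (-(2 * k * x) ^ 2 / 2)
      = 1 - 2 * ∑' k : ℕ, (-1 : ℝ) ^ k * Real.exp (-2 * ((k : ℝ) + 1) ^ 2 * x ^ 2) := by
  have hs : Summable fun k : ℤ => (-1 : ℝ) ^ k * Real.exp (-(2 * k * x) ^ 2 / 2) :=
    (summable_exp_neg_sq_int hx).of_norm_bounded fun k => by
      rw [Real.norm_eq_abs, abs_neg_one_zpow_mul, Real.abs_exp]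
  have hterm : ∀ k : ℕ, (-1 : ℝ) ^ ((k : ℤ) + 1) *
      Real.exp (-(2 * (((k : ℤ) + 1 : ℤ) : ℝ) * x) ^ 2 / 2)
        = -((-1 : ℝ) ^ k * Real.exp (-2 * ((k : ℝ) + 1) ^ 2 * x ^ 2)) := by
    intro k
    rw [zpow_add₀ (by norm_num), zpow_natCast, zpow_one, mul_neg_one, neg_mul]
    congr 3
    push_cast
    ring
  have hterm' : ∀ k : ℕ, (-1 : ℝ) ^ (-((k : ℤ) + 1)) *
      Real.exp (-(2 * ((-((k : ℤ) + 1) : ℤ) : ℝ) * x) ^ 2 / 2)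
        = -((-1 : ℝ) ^ k * Real.exp (-2 * ((k : ℝ) + 1) ^ 2 * x ^ 2)) := by
    intro k
    rw [← hterm, zpow_neg, ← inv_zpow, Int.cast_neg, mul_neg, neg_mul, neg_sq]
    norm_num
  have hinj : Function.Injective fun k : ℕ => (k : ℤ) + 1 := fun i j h => by
    simpa using h
  have hinj' : Function.Injective fun k : ℕ => -((k : ℤ) + 1) := fun i j h => by
    simpa using h
  have h := tsum_of_add_one_of_neg_add_one
    (f := fun k : ℤ => (-1 : ℝ) ^ k * Real.exp (-(2 * k * x) ^ 2 / 2))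
    (hs.comp_injective hinj) (hs.comp_injective hinj')
  rw [h, tsum_congr hterm, tsum_congr hterm', tsum_neg]
  simp only [zpow_zero, Int.cast_zero]
  simp
  ring

end

/-- The Kolmogorov distribution: for a standard Brownian bridge `B` and `x > 0`,
`P(sup_{0≤t≤1} |B t| ≤ x) = 1 − 2 ∑_{k=1}^∞ (−1)^{k+1} e^{−2k²x²}`
(below the series is indexed by `k : ℕ` via the shift `k ↦ k+1`). -/
theorem stmt14 {Ω : Type*} [MeasurableSpace Ω] (P : Measure Ω) [IsProbabilityMeasure P]
    (B : ℝ → Ω → ℝ) (hB : IsBrownianBridge P B) (x : ℝ) (hx : 0 < x) :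
    (P {ω | sSup {y : ℝ | ∃ t ∈ Set.Icc (0 : ℝ) 1, y = |B t ω|} ≤ x}).toReal
      = 1 - 2 * ∑' k : ℕ, (-1 : ℝ) ^ k * Real.exp (-2 * ((k : ℝ) + 1) ^ 2 * x ^ 2) := by
  have hBL := hB.bridgeLaw
  have hbdd : ∀ ω, BddAbove {y : ℝ | ∃ t ∈ Set.Icc (0 : ℝ) 1, y = |B t ω|} := fun ω => by
    refine (isCompact_Icc.bddAbove_image (hBL.continuousOn ω).abs).mono ?_
    rintro _ ⟨t, ht, rfl⟩
    exact ⟨t, ht, rfl⟩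
  have hset : {ω | sSup {y : ℝ | ∃ t ∈ Set.Icc (0 : ℝ) 1, y = |B t ω|} ≤ x}
      = {ω | ∃ t ∈ Set.Ico (0 : ℝ) 1, x < |B t ω|}ᶜ := by
    ext ω
    simp only [Set.mem_ofPred_eq, Set.mem_compl_iff, not_exists, not_and, not_lt]
    rw [csSup_le_iff (hbdd ω) ⟨_, 0, by simp, rfl⟩]
    refine ⟨fun h t ht => h _ ⟨t, Set.Ico_subset_Icc_self ht, rfl⟩, ?_⟩
    rintro h _ ⟨t, ht, rfl⟩
    rcases eq_or_lt_of_le ht.2 with rfl | h1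
    · rw [hBL.one, abs_zero]
      exact hx.le
    · exact h t ⟨ht.1, h1⟩
  have hm : MeasurableSet {ω | ∃ t ∈ Set.Ico (0 : ℝ) 1, x < |B t ω|} := by
    have h : {ω | ∃ t ∈ Set.Ico (0 : ℝ) 1, x < |B t ω|} = ⋃ N, gridExit B x 0 N := by
      ext ω
      simp only [Set.mem_ofPred_eq, Set.mem_iUnion]
      constructor
      · rintro ⟨t, ht, hxt⟩
        obtain ⟨N, hN, hN0⟩ := ((eventually_lt_abs_grid (hBL.continuousOn ω) ht hxt).and
          (eventually_gt_atTop 0)).exists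
        have hN0' : (0 : ℝ) < N := by exact_mod_cast hN0
        refine ⟨N, ⌊t * N⌋₊, ?_, by simpa using hN⟩
        rw [Nat.floor_lt (mul_nonneg ht.1 hN0'.le)]
        exact mul_lt_of_lt_one_left hN0' ht.2
      · rintro ⟨N, i, hi, h⟩
        have hN : (0 : ℝ) < N := by exact_mod_cast (Nat.zero_le i).trans_lt hi
        exact ⟨i / N, ⟨by positivity, by rw [div_lt_one hN]; exact_mod_cast hi⟩, by simpa using h⟩
    rw [h]
    exact MeasurableSet.iUnion fun N => hBL.measurableSet_gridExit x 0 N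
  rw [hset, ← measureReal_def, probReal_compl_eq_one_sub hm, hBL.measureReal_exit hx,
    tsum_int_neg_one_zpow_mul_exp hx]
  ring
end
end
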